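/- Let (Ω, Σ, μ) be a σ-finite measure space and fix 1 < r < ∞. Let T be an invertible bounded linear operator on (the real or complex) L^r(μ) such that sup_{n ∈ ℤ} ‖T^n‖ < ∞. Then for every f ∈ L^r(μ), both (1/n)∑_{j=1}^n T^{p_j} f and (1/N)∑_{j=1}^{π(N)} (log p_j) T^{p_j} f converge in the L^r norm. -/

import Mathlib

open Filter Finset MeasureTheory
open scoped ENNReal

set_option linter.all false

namespace PP
section WI
open Topology

noncomputable def fK (l v : ℝ) : ℝ := 2 * (1 - Real.cos (l * v)) / (l * v ^ 2)

lemma fK_nonneg {l : ℝ} (hl : 0 < l) (v : ℝ) : 0 ≤ fK l v := by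
  unfold fK
  have := Real.cos_le_one (l * v)
  apply div_nonneg <;> [linarith; positivity]

lemma fK_le {l : ℝ} (hl : 0 < l) (v : ℝ) : fK l v ≤ 4 / (l * v ^ 2) := by
  unfold fK
  have := Real.neg_one_le_cos (l * v)
  gcongr; linarith

lemma fK_le' {l : ℝ} (hl : 0 < l) (v : ℝ) : fK l v ≤ l := by
  unfold fK
  rcases eq_or_ne v 0 with rfl | hv
  · simp [hl.le]
  rw [div_le_iff₀ (by positivity)]
  nlinarith [Real.one_sub_sq_div_two_le_cos (x := l * v)]

lemma fK_meas (l : ℝ) : Measurable (fK l) := by unfold fK; fun_prop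

lemma fK_int {l : ℝ} (hl : 0 < l) : Integrable (fK l) := by
  refine (integrable_inv_one_add_sq.const_mul (l + 4 / l)).mono' (fK_meas l).aestronglyMeasurable
    (Eventually.of_forall fun v => ?_)
  rw [Real.norm_of_nonneg (fK_nonneg hl v), ← div_eq_mul_inv, le_div_iff₀ (by positivity)]
  have h1 := fK_le' hl v
  have h2 : fK l v * v ^ 2 ≤ 4 / l := by
    rcases eq_or_ne v 0 with rfl | hv
    · simp; positivity
    · have := fK_le hl v
      calc fK l v * v ^ 2 ≤ 4 / (l * v ^ 2) * v ^ 2 := by gcongr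
        _ = 4 / l := by field_simp
  linarith

lemma fK_ge {l : ℝ} (hl : 0 < l) {v : ℝ} (hv : v ≠ 0) (h : |l * v| ≤ 1) : l / 2 ≤ fK l v := by
  unfold fK
  rw [le_div_iff₀ (by positivity)]
  have := (abs_le.1 (Real.cos_bound h)).2
  have h4 : |l * v| ^ 4 ≤ (l * v) ^ 2 := by
    rw [show |l * v| ^ 4 = (l * v) ^ 2 * |l * v| ^ 2 by rw [← sq_abs (l*v)]; ring]
    exact mul_le_of_le_one_right (by positivity) (pow_le_one₀ (abs_nonneg _) h)
  nlinarith

lemma fK_eq {l : ℝ} (hl : 0 < l) {v : ℝ} (hv : v ≠ 0) :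
    ∫ t in Set.Icc (-l) l, ((1 - |t| / l : ℝ) : ℂ) * Complex.exp (t * v * Complex.I) = fK l v := by
  rw [integral_Icc_eq_integral_Ioc, ← intervalIntegral.integral_of_le (by linarith)]
  have hc : Continuous fun t : ℝ => ((1 - |t| / l : ℝ) : ℂ) * Complex.exp (t * v * Complex.I) := by
    fun_prop
  rw [← intervalIntegral.integral_add_adjacent_intervals (b := 0) (hc.intervalIntegrable _ _)
    (hc.intervalIntegrable _ _)]
  have hvI : (v : ℂ) * Complex.I ≠ 0 := by simp [hv]
  have hl' : (l : ℂ) ≠ 0 := by simp [hl.ne']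
  have hv' : (v : ℂ) ≠ 0 := by simp [hv]
  have key : ∀ c : ℝ, ∀ t : ℝ, HasDerivAt (fun t : ℝ => (1 - (c * t : ℂ) / l) * Complex.exp (t * v * Complex.I)
      / (v * Complex.I) + (c / l : ℂ) * Complex.exp (t * v * Complex.I) / (v * Complex.I) ^ 2)
      ((1 - (c * t : ℂ) / l) * Complex.exp (t * v * Complex.I)) t := by
    intro c t
    have h1 : HasDerivAt (fun t : ℝ => (t : ℂ)) 1 t := Complex.ofRealCLM.hasDerivAt
    have h2 : HasDerivAt (fun t : ℝ => Complex.exp (t * v * Complex.I))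
      (Complex.exp (t * v * Complex.I) * (1 * v * Complex.I)) t :=
      ((h1.mul_const _).mul_const _).cexp
    have h3 : HasDerivAt (fun t : ℝ => (1 - (c * t : ℂ) / l)) (-(c * 1 / l)) t :=
      ((h1.const_mul _).div_const _).const_sub _
    refine (((h3.mul h2).div_const _).add ((h2.const_mul _).div_const _)).congr_deriv ?_
    field_simp
    ring
  have e1 : ∫ t in (-l)..0, ((1 - |t| / l : ℝ) : ℂ) * Complex.exp (t * v * Complex.I) =
      ∫ t in (-l)..0, (1 - (((-1 : ℝ) : ℂ) * t : ℂ) / l) * Complex.exp (t * v * Complex.I) := by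
    refine intervalIntegral.integral_congr fun t ht => ?_
    rw [Set.uIcc_of_le (by linarith)] at ht
    simp only [abs_of_nonpos ht.2]; push_cast; ring_nf
  have e2 : ∫ t in (0:ℝ)..l, ((1 - |t| / l : ℝ) : ℂ) * Complex.exp (t * v * Complex.I) =
      ∫ t in (0:ℝ)..l, (1 - (((1 : ℝ) : ℂ) * t : ℂ) / l) * Complex.exp (t * v * Complex.I) := by
    refine intervalIntegral.integral_congr fun t ht => ?_
    rw [Set.uIcc_of_le (by linarith)] at ht
    simp only [abs_of_nonneg ht.1]; push_cast; ring_nf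
  rw [e1, e2, intervalIntegral.integral_eq_sub_of_hasDerivAt (fun t _ => key _ t)
    (Continuous.intervalIntegrable (by fun_prop) _ _),
    intervalIntegral.integral_eq_sub_of_hasDerivAt (fun t _ => key _ t)
    (Continuous.intervalIntegrable (by fun_prop) _ _)]
  have hcos : (Real.cos (l * v) : ℂ) =
      (Complex.exp (l * v * Complex.I) + Complex.exp (-l * v * Complex.I)) / 2 := by
    push_cast; rw [Complex.cos]; ring_nf
  unfold fK
  push_cast at hcos ⊢
  rw [hcos]
  simp only [Complex.ofReal_zero, zero_mul, Complex.exp_zero, mul_pow, Complex.I_sq]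
  field_simp
  ring_nf

end WI
end PP

namespace PP
section WI2
open Topology Complex

lemma wi_fub {D : ℝ → ℝ} {C : ℝ} (hDm : Measurable D) (hD : ∀ u, |D u| ≤ C) {H : ℂ → ℂ}
    (hH : ∀ δ : ℝ, 0 < δ → ∀ t : ℝ, ∫ u in Set.Ioi (0:ℝ), (D u : ℂ) * exp (-(δ + t * I) * u) = H (δ + t * I))
    {l : ℝ} (hl : 0 < l) (y : ℝ) {δ : ℝ} (hδ : 0 < δ) :
    ∫ t in Set.Icc (-l) l, ((1 - |t| / l : ℝ) : ℂ) * exp (t * y * I) * H (δ + t * I) =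
      ((∫ u in Set.Ioi (0:ℝ), D u * Real.exp (-δ * u) * fK l (y - u) : ℝ) : ℂ) := by
  have hC : 0 ≤ C := (abs_nonneg _).trans (hD 0)
  have step1 : ∀ t : ℝ, ((1 - |t| / l : ℝ) : ℂ) * exp (t * y * I) * H (δ + t * I) =
      ∫ u in Set.Ioi (0:ℝ), ((1 - |t| / l : ℝ) : ℂ) * exp (t * y * I) * ((D u : ℂ) * exp (-(δ + t * I) * u)) := by
    intro t
    rw [integral_const_mul, hH δ hδ t]
  simp_rw [step1]
  rw [integral_integral_swap]
  · rw [← integral_complex_ofReal]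
    have : ∀ᵐ u : ℝ ∂(volume.restrict (Set.Ioi 0)), u ≠ y := by
      apply ae_restrict_of_ae
      simp [ae_iff]
    apply integral_congr_ae
    filter_upwards [this] with u hu
    have hv : y - u ≠ 0 := sub_ne_zero.2 (Ne.symm hu)
    push_cast
    rw [← fK_eq hl hv, ← integral_const_mul]
    congr 1
    ext t
    rw [show (-(δ + t * I) * u : ℂ) = -δ * u + (- t * u * I) by ring, Complex.exp_add,
      show (t * ((y - u : ℝ) : ℂ) * I : ℂ) = t * y * I + (-t * u * I) by push_cast; ring, Complex.exp_add]
    push_cast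
    ring
  · have hint : Integrable (fun p : ℝ × ℝ => (1 : ℝ) * (C * Real.exp (-δ * p.2)))
        ((volume.restrict (Set.Icc (-l) l)).prod (volume.restrict (Set.Ioi (0:ℝ)))) := by
      refine Integrable.mul_prod (μ := volume.restrict (Set.Icc (-l) l))
        (ν := volume.restrict (Set.Ioi (0:ℝ))) (f := fun _ : ℝ => (1:ℝ)) (g := fun u : ℝ => C * Real.exp (-δ * u))
        (integrable_const _) ?_
      exact (integrableOn_exp_mul_Ioi (neg_lt_zero.2 hδ) 0).const_mul C
    refine hint.mono' ?_ ?_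
    · apply Measurable.aestronglyMeasurable
      simp only [Function.uncurry_def]
      fun_prop
    · rw [Measure.prod_restrict]
      refine (ae_restrict_iff' (measurableSet_Icc.prod measurableSet_Ioi)).2 (Eventually.of_forall ?_)
      rintro ⟨t, u⟩ ⟨ht, hu⟩
      simp only [Function.uncurry_apply_pair, norm_mul]
      have ht' : |t| ≤ l := abs_le.2 ht
      have h1 : ‖((1 - |t| / l : ℝ) : ℂ)‖ ≤ 1 := by
        rw [norm_real, Real.norm_eq_abs, abs_le]
        have h2 : |t| / l ≤ 1 := (div_le_one hl).2 ht'
        have h3 : 0 ≤ |t| / l := by positivity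
        constructor <;> linarith
      have h2 : ‖exp (t * y * I)‖ = 1 := by
        rw [show (t * y * I : ℂ) = ((t * y : ℝ) : ℂ) * I by push_cast; ring, norm_exp_ofReal_mul_I]
      have h3 : ‖exp (-(δ + t * I) * u)‖ = Real.exp (-δ * u) := by
        rw [Complex.norm_exp]; congr 1; simp
      have h4 : ‖(D u : ℂ)‖ ≤ C := by rw [norm_real]; exact hD u
      rw [h2, h3, mul_one]
      exact mul_le_mul h1 (mul_le_mul_of_nonneg_right h4 (Real.exp_pos _).le) (by positivity) zero_le_one

lemma fK_int' {l : ℝ} (hl : 0 < l) (y : ℝ) : Integrable (fun u => fK l (y - u)) :=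
  (fK_int hl).comp_sub_left y

lemma wi_lim {D : ℝ → ℝ} {C : ℝ} (hDm : Measurable D) (hD : ∀ u, |D u| ≤ C) {H : ℂ → ℂ}
    (hHc : ContinuousOn H {s | 0 ≤ s.re})
    (hH : ∀ δ : ℝ, 0 < δ → ∀ t : ℝ, ∫ u in Set.Ioi (0:ℝ), (D u : ℂ) * exp (-(δ + t * I) * u) = H (δ + t * I))
    {l : ℝ} (hl : 0 < l) (y : ℝ) :
    ∫ t in Set.Icc (-l) l, ((1 - |t| / l : ℝ) : ℂ) * exp (t * y * I) * H (t * I) =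
      ((∫ u in Set.Ioi (0:ℝ), D u * fK l (y - u) : ℝ) : ℂ) := by
  have hC : 0 ≤ C := (abs_nonneg _).trans (hD 0)
  let d : ℕ → ℝ := fun n => 1 / ((n : ℝ) + 1)
  have hd0 : ∀ n, 0 < d n := fun n => by positivity
  have hd1 : ∀ n, d n ≤ 1 := fun n => by
    rw [div_le_one (by positivity)]; linarith [n.cast_nonneg (α := ℝ)]
  have hd : Tendsto d atTop (𝓝 0) := tendsto_one_div_add_atTop_nhds_zero_nat
  have hg : ContinuousOn (fun p : ℝ × ℝ => H (p.1 + p.2 * I)) (Set.Icc 0 1 ×ˢ Set.Icc (-l) l) := by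
    refine hHc.comp (by fun_prop) ?_
    rintro ⟨a, b⟩ ⟨ha, hb⟩
    simpa using ha.1
  obtain ⟨M, hM⟩ := (isCompact_Icc.prod isCompact_Icc).exists_bound_of_continuousOn hg
  have lim1 : Tendsto (fun n => ∫ t in Set.Icc (-l) l, ((1 - |t| / l : ℝ) : ℂ) * exp (t * y * I) * H (d n + t * I))
      atTop (𝓝 (∫ t in Set.Icc (-l) l, ((1 - |t| / l : ℝ) : ℂ) * exp (t * y * I) * H (t * I))) := by
    refine tendsto_integral_of_dominated_convergence (fun _ => M) ?_ (integrable_const _) ?_ ?_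
    · intro n
      refine ContinuousOn.aestronglyMeasurable ?_ measurableSet_Icc
      refine ContinuousOn.mul (by fun_prop) (hHc.comp (by fun_prop) ?_)
      intro t _
      simpa using (hd0 n).le
    · intro n
      refine (ae_restrict_iff' measurableSet_Icc).2 (Eventually.of_forall fun t ht => ?_)
      have ht' : |t| ≤ l := abs_le.2 ht
      have h1 : ‖((1 - |t| / l : ℝ) : ℂ)‖ ≤ 1 := by
        rw [norm_real, Real.norm_eq_abs, abs_le]
        have h2 : |t| / l ≤ 1 := (div_le_one hl).2 ht'
        have h3 : 0 ≤ |t| / l := by positivity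
        constructor <;> linarith
      have h2 : ‖exp (t * y * I)‖ = 1 := by
        rw [show (t * y * I : ℂ) = ((t * y : ℝ) : ℂ) * I by push_cast; ring, norm_exp_ofReal_mul_I]
      rw [norm_mul, norm_mul, h2, mul_one]
      have := hM (d n, t) ⟨⟨(hd0 n).le, hd1 n⟩, ht⟩
      simp only at this
      calc _ ≤ 1 * ‖H (d n + t * I)‖ := by gcongr
        _ ≤ M := by rw [one_mul]; exact this
    · refine (ae_restrict_iff' measurableSet_Icc).2 (Eventually.of_forall fun t ht => ?_)
      refine Tendsto.const_mul _ ?_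
      have h0 : ((t : ℂ) * I) ∈ {s : ℂ | 0 ≤ s.re} := by simp
      refine (hHc _ h0).tendsto.comp (tendsto_nhdsWithin_iff.2 ⟨?_, Eventually.of_forall fun n => ?_⟩)
      · have : Tendsto (fun n => ((d n : ℝ) : ℂ) + t * I) atTop (𝓝 (((0:ℝ) : ℂ) + t * I)) :=
          ((continuous_ofReal.tendsto 0).comp hd).add_const _
        simpa using this
      · simpa using (hd0 n).le
  have lim2 : Tendsto (fun n => ∫ u in Set.Ioi (0:ℝ), D u * Real.exp (-d n * u) * fK l (y - u)) atTop
      (𝓝 (∫ u in Set.Ioi (0:ℝ), D u * fK l (y - u))) := by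
    refine tendsto_integral_of_dominated_convergence (fun u => C * fK l (y - u)) ?_
      ((fK_int' hl y).integrableOn.const_mul C) ?_ ?_
    · intro n
      have := fK_meas l
      exact (by fun_prop : Measurable _).aestronglyMeasurable
    · intro n
      refine (ae_restrict_iff' measurableSet_Ioi).2 (Eventually.of_forall fun u hu => ?_)
      rw [norm_mul, norm_mul, Real.norm_of_nonneg (fK_nonneg hl _), Real.norm_eq_abs, Real.norm_of_nonneg (Real.exp_pos _).le]
      have : Real.exp (-d n * u) ≤ 1 := by
        rw [Real.exp_le_one_iff]
        have := mul_pos (hd0 n) hu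
        linarith
      have hk := fK_nonneg hl (y - u)
      calc _ ≤ C * 1 * fK l (y - u) := by gcongr; exact hD u
        _ = _ := by ring
    · refine Eventually.of_forall fun u => ?_
      have : Tendsto (fun n => D u * Real.exp (-d n * u) * fK l (y - u)) atTop
          (𝓝 (D u * Real.exp (-0 * u) * fK l (y - u))) := by
        refine Tendsto.mul_const _ (Tendsto.const_mul _ ?_)
        exact (Real.continuous_exp.tendsto _).comp (hd.neg.mul_const u)
      simpa using this
  refine tendsto_nhds_unique lim1 ?_
  have := (continuous_ofReal.tendsto _).comp lim2
  refine this.congr fun n => ?_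
  exact (wi_fub hDm hD hH hl y (hd0 n)).symm

lemma wi_conv {D : ℝ → ℝ} {C : ℝ} (hDm : Measurable D) (hD : ∀ u, |D u| ≤ C) {H : ℂ → ℂ}
    (hHc : ContinuousOn H {s | 0 ≤ s.re})
    (hH : ∀ δ : ℝ, 0 < δ → ∀ t : ℝ, ∫ u in Set.Ioi (0:ℝ), (D u : ℂ) * exp (-(δ + t * I) * u) = H (δ + t * I))
    {l : ℝ} (hl : 0 < l) :
    Tendsto (fun y => ∫ u in Set.Ioi (0:ℝ), D u * fK l (y - u)) atTop (𝓝 0) := by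
  have RL := Real.tendsto_integral_exp_smul_cocompact
    ((Set.Icc (-l) l).indicator (fun t : ℝ => ((1 - |t| / l : ℝ) : ℂ) * H (t * I)))
  have h1 : Tendsto (fun y : ℝ => (-1 / (2 * Real.pi)) * y) atTop (cocompact ℝ) := by
    refine Tendsto.mono_right ?_ atBot_le_cocompact
    refine tendsto_id.const_mul_atTop_of_neg ?_
    have := Real.pi_pos
    exact div_neg_of_neg_of_pos (by norm_num) (by positivity)
  have h2 := RL.comp h1
  have h3 : Tendsto (fun y => ((∫ u in Set.Ioi (0:ℝ), D u * fK l (y - u) : ℝ) : ℂ)) atTop (𝓝 0) := by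
    refine h2.congr fun y => ?_
    rw [← wi_lim hDm hD hHc hH hl y, ← integral_indicator measurableSet_Icc]
    simp only [Function.comp]
    congr 1
    ext t
    by_cases ht : t ∈ Set.Icc (-l) l
    · simp only [Set.indicator_of_mem ht, Circle.smul_def, Real.fourierChar_apply, smul_eq_mul]
      rw [show ((2 * Real.pi * (-(t * (-1 / (2 * Real.pi) * y))) : ℝ) : ℂ) * I = t * y * I by
        have := Real.pi_pos.ne'
        rw [show (2 * Real.pi * (-(t * (-1 / (2 * Real.pi) * y))) : ℝ) = t * y by field_simp]
        push_cast; ring]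
      ring
    · simp [Set.indicator_of_notMem ht]
  have := (continuous_re.tendsto _).comp h3
  simpa [Function.comp_def] using this

lemma wi_taub {D : ℝ → ℝ} {C : ℝ} (hDm : Measurable D) (hD : ∀ u, |D u| ≤ C) 
    (hT : ∀ l : ℝ, 0 < l → Tendsto (fun y => ∫ u in Set.Ioi (0:ℝ), D u * fK l (y - u)) atTop (𝓝 0))
    {η h : ℝ} (hη : 0 < η) (hh : 0 < h) :
    ∀ᶠ c in atTop, ∃ u, c - h ≤ u ∧ u ≤ c + h ∧ D u < η := by
  have hC : 0 ≤ C := (abs_nonneg _).trans (hD 0)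
  set G : ℝ := 4 * C * (1 + 1 / h ^ 2) * Real.pi with hG
  have hG0 : 0 ≤ G := by have := Real.pi_pos; positivity
  obtain ⟨l, hl1, hl2⟩ : ∃ l : ℝ, 1 / h < l ∧ 2 * G / η < l :=
    ⟨max (1 / h) (2 * G / η) + 1, by linarith [le_max_left (1 / h) (2 * G / η)],
      by linarith [le_max_right (1 / h) (2 * G / η)]⟩
  have hl : 0 < l := lt_trans (by positivity) hl1
  have hlh : 1 / l ≤ h := by
    rw [div_le_iff₀ hl]; rw [div_lt_iff₀ hh] at hl1; linarith
  have hlG : G / l ≤ η / 2 := by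
    rw [div_le_iff₀ hl]; rw [div_lt_iff₀ hη] at hl2; linarith
  filter_upwards [(hT l hl).eventually (gt_mem_nhds (show (0:ℝ) < η / 2 by linarith)),
    eventually_gt_atTop (1 / l)] with c hc hcl
  by_contra hcon
  push Not at hcon
  have i1 : Integrable (fun u : ℝ => (Set.Icc (c - 1 / l) (c + 1 / l)).indicator (fun _ => η * (l / 2)) u) := by
    rw [integrable_indicator_iff measurableSet_Icc]
    exact integrableOn_const (by simp)
  have i2 : Integrable (fun u : ℝ => (4 * C * (1 + 1 / h ^ 2) / l) * (1 + (c - u) ^ 2)⁻¹) :=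
    (integrable_inv_one_add_sq.comp_sub_left c).const_mul _
  have i3 : IntegrableOn (fun u => D u * fK l (c - u)) (Set.Ioi 0) := by
    refine Integrable.mono' ((fK_int' hl c).integrableOn.const_mul C) ?_ (Eventually.of_forall fun u => ?_)
    · have := fK_meas l
      exact (by fun_prop : Measurable _).aestronglyMeasurable
    · rw [norm_mul, Real.norm_of_nonneg (fK_nonneg hl _)]
      exact mul_le_mul_of_nonneg_right (hD u) (fK_nonneg hl _)
  have key : ∫ u in Set.Ioi (0:ℝ), ((Set.Icc (c - 1 / l) (c + 1 / l)).indicator (fun _ => η * (l / 2)) u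
      - (4 * C * (1 + 1 / h ^ 2) / l) * (1 + (c - u) ^ 2)⁻¹) ≤ ∫ u in Set.Ioi (0:ℝ), D u * fK l (c - u) := by
    refine integral_mono_ae (i1.integrableOn.sub i2.integrableOn) i3 ?_
    have : ∀ᵐ u : ℝ ∂(volume.restrict (Set.Ioi 0)), u ≠ c := by
      apply ae_restrict_of_ae
      simp [ae_iff]
    filter_upwards [this] with u hu
    have hv : c - u ≠ 0 := sub_ne_zero.2 (Ne.symm hu)
    have hk := fK_nonneg hl (c - u)
    have hp : 0 ≤ (4 * C * (1 + 1 / h ^ 2) / l) * (1 + (c - u) ^ 2)⁻¹ := by positivity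
    by_cases h1 : u ∈ Set.Icc (c - 1 / l) (c + 1 / l)
    · rw [Set.indicator_of_mem h1]
      have h2 : |l * (c - u)| ≤ 1 := by
        rw [abs_mul, abs_of_pos hl, ← le_div_iff₀' hl, abs_le]
        constructor <;> linarith [h1.1, h1.2]
      have h3 := fK_ge hl hv h2
      have h4 := hcon u (by linarith [h1.1]) (by linarith [h1.2])
      have : η * (l / 2) ≤ D u * fK l (c - u) := mul_le_mul h4 h3 (by positivity) (by linarith)
      linarith
    · rw [Set.indicator_of_notMem h1]
      by_cases h5 : c - h ≤ u ∧ u ≤ c + h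
      · have h4 := hcon u h5.1 h5.2
        have : 0 ≤ D u * fK l (c - u) := mul_nonneg (by linarith) hk
        linarith
      · have h6 : h ^ 2 ≤ (c - u) ^ 2 := by
          rw [not_and_or] at h5
          rcases h5 with h5 | h5 <;> nlinarith
        have h7 : fK l (c - u) ≤ (4 * (1 + 1 / h ^ 2) / l) * (1 + (c - u) ^ 2)⁻¹ := by
          refine (fK_le hl _).trans ?_
          rw [← div_eq_mul_inv, div_div, div_le_div_iff₀ (by positivity) (by positivity)]
          have : 1 ≤ (c - u) ^ 2 / h ^ 2 := (one_le_div (by positivity)).2 h6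
          have : 4 * l * (1 + (c - u) ^ 2) ≤ 4 * l * ((c - u) ^ 2 + (c - u) ^ 2 / h ^ 2) := by
            gcongr ?_ * ?_; linarith
          calc _ = 4 * l * (1 + (c - u) ^ 2) := by ring
            _ ≤ _ := this
            _ = _ := by ring
        have h8 := neg_le_of_abs_le (hD u)
        have : -C * fK l (c - u) ≤ D u * fK l (c - u) := by gcongr
        have h9 : C * fK l (c - u) ≤ C * ((4 * (1 + 1 / h ^ 2) / l) * (1 + (c - u) ^ 2)⁻¹) := by gcongr
        have h10 : C * ((4 * (1 + 1 / h ^ 2) / l) * (1 + (c - u) ^ 2)⁻¹) =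
          (4 * C * (1 + 1 / h ^ 2) / l) * (1 + (c - u) ^ 2)⁻¹ := by ring
        linarith
  rw [integral_sub i1.integrableOn i2.integrableOn] at key
  have k1 : ∫ u in Set.Ioi (0:ℝ), (Set.Icc (c - 1 / l) (c + 1 / l)).indicator (fun _ => η * (l / 2)) u = η := by
    rw [setIntegral_indicator measurableSet_Icc, Set.inter_eq_right.2, setIntegral_const]
    · rw [Real.volume_real_Icc_of_le (by linarith [show 0 < 1 / l by positivity])]
      simp; field_simp; ring
    · intro u hu; have := hu.1; simp; linarith
  have k2 : ∫ u in Set.Ioi (0:ℝ), (4 * C * (1 + 1 / h ^ 2) / l) * (1 + (c - u) ^ 2)⁻¹ ≤ G / l := by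
    refine (setIntegral_le_integral i2 (Eventually.of_forall fun u => by simp only [Pi.zero_apply]; positivity)).trans ?_
    rw [integral_const_mul, integral_sub_left_eq_self (fun x : ℝ => (1 + x ^ 2)⁻¹) volume c, integral_univ_inv_one_add_sq]
    rw [hG]; apply le_of_eq; ring
  linarith

end WI2
end PP

namespace PP
section WI3
set_option linter.unusedSectionVars false
open Topology Complex ArithmeticFunction.vonMangoldt

variable {q : ℕ} [NeZero q] (a : ZMod q)

noncomputable def psia (x : ℝ) : ℝ := ∑ k ∈ Icc 1 ⌊x⌋₊, residueClass a k

lemma psia_nonneg (x : ℝ) : 0 ≤ psia a x := sum_nonneg fun _ _ => residueClass_nonneg a _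

lemma psia_mono : Monotone (psia a) := fun x y h =>
  sum_le_sum_of_subset_of_nonneg (Icc_subset_Icc_right (Nat.floor_mono h))
    fun _ _ _ => residueClass_nonneg a _

lemma psia_le {x : ℝ} (hx : 0 ≤ x) : psia a x ≤ (Real.log 4 + 4) * x := by
  refine le_trans ?_ (Chebyshev.psi_le_const_mul_self hx)
  exact sum_le_sum fun _ _ => residueClass_le a _

lemma psia_int {s : ℂ} (hs : 0 < s.re) :
    ∫ u in Set.Ioi (0:ℝ), ((psia a (Real.exp u) * Real.exp (-u) : ℝ) : ℂ) * exp (-s * u) =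
      LSeries (fun n => (residueClass a n : ℂ)) (1 + s) / (1 + s) := by
  have h0 : (1 + s) ≠ 0 := by
    intro h; have := congrArg Complex.re h; simp at this; linarith
  rw [LSeries_eq_mul_integral_of_nonneg (residueClass a) (r := 1) zero_le_one (s := 1 + s) (by simpa using hs)
    ?_ (residueClass_nonneg a), mul_div_cancel_left₀ _ h0]
  · have himg : Real.exp '' Set.Ioi 0 = Set.Ioi 1 := by
      ext x; constructor
      · rintro ⟨u, hu, rfl⟩; simpa using hu
      · intro hx
        exact ⟨Real.log x, Real.log_pos hx, Real.exp_log (zero_lt_one.trans hx)⟩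
    rw [← himg, integral_image_eq_integral_abs_deriv_smul measurableSet_Ioi
      (fun x _ => (Real.hasDerivAt_exp x).hasDerivWithinAt) Real.exp_injective.injOn]
    congr 1
    ext u
    rw [abs_of_pos (Real.exp_pos u), Complex.real_smul]
    have : ((Real.exp u : ℝ) : ℂ) ^ (-(1 + s + 1)) = exp (-s * u) * exp (-u) * exp (-u) := by
      rw [Complex.cpow_def_of_ne_zero (by simp), ← Complex.ofReal_log (Real.exp_pos u).le, Real.log_exp,
        ← Complex.exp_add, ← Complex.exp_add]
      congr 1; ring
    rw [this]
    unfold psia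
    push_cast
    have e : exp (u : ℂ) * exp (-u) = 1 := by rw [← Complex.exp_add]; simp
    linear_combination (-(∑ k ∈ Icc 1 ⌊Real.exp u⌋₊, (residueClass a k : ℂ)) * exp (-u) * exp (-s * u)) * e
  · refine Asymptotics.IsBigO.of_bound (Real.log 4 + 4) (Eventually.of_forall fun n => ?_)
    have := psia_le a (x := n) n.cast_nonneg
    have h2 := psia_nonneg a (n : ℝ)
    simp only [psia, Nat.floor_natCast] at this h2
    rw [Real.norm_of_nonneg h2, Real.rpow_one, Real.norm_natCast]
    exact this

lemma psia_lim {a : ZMod q} (ha : IsUnit a) :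
    Tendsto (fun u => psia a (Real.exp u) * Real.exp (-u)) atTop (𝓝 ((q.totient : ℝ)⁻¹)) := by
  set A : ℝ := (q.totient : ℝ)⁻¹ with hA
  set B : ℝ → ℝ := fun u => psia a (Real.exp u) * Real.exp (-u) with hB
  set C0 : ℝ := Real.log 4 + 4 with hC0
  have hA0 : 0 ≤ A := by positivity
  have hB0 : ∀ u, 0 ≤ B u := fun u => mul_nonneg (psia_nonneg a _) (Real.exp_pos _).le
  have hB1 : ∀ u, B u ≤ C0 := fun u => by
    have := psia_le a (Real.exp_pos u).le
    calc B u ≤ (C0 * Real.exp u) * Real.exp (-u) := by simp only [hB]; gcongr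
      _ = C0 := by rw [mul_assoc, ← Real.exp_add]; simp
  have hBm : Measurable B := ((psia_mono a).measurable.comp Real.measurable_exp).mul (by fun_prop)
  have hBr : ∀ u v, u ≤ v → B u * Real.exp (u - v) ≤ B v := by
    intro u v huv
    have := psia_mono a (Real.exp_le_exp.2 huv)
    calc B u * Real.exp (u - v) = psia a (Real.exp u) * Real.exp (-v) := by
          simp only [hB]; rw [mul_assoc, ← Real.exp_add]; ring_nf
      _ ≤ _ := by simp only [hB]; gcongr
  set H : ℂ → ℂ := fun s => (LFunctionResidueClassAux a (1 + s) - A) / (1 + s) with hHd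
  have hHc : ContinuousOn H {s | 0 ≤ s.re} := by
    refine ContinuousOn.div (ContinuousOn.sub ?_ continuousOn_const) (by fun_prop) ?_
    · refine (continuousOn_LFunctionResidueClassAux a).comp (by fun_prop) ?_
      intro s hs; simpa using hs
    · intro s hs h; have := congrArg Complex.re h; simp at this hs; linarith
  have hH : ∀ δ : ℝ, 0 < δ → ∀ t : ℝ, ∫ u in Set.Ioi (0:ℝ), ((B u - A : ℝ) : ℂ) * exp (-(δ + t * I) * u) = H (δ + t * I) := by
    intro δ hδ t
    set s : ℂ := δ + t * I with hs
    have hsr : s.re = δ := by simp [hs]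
    have hs0 : s ≠ 0 := by intro h; rw [h] at hsr; simp at hsr; linarith
    have h0 : (1 + s) ≠ 0 := by
      intro h; have := congrArg Complex.re h; simp [hsr] at this; linarith
    have ie : IntegrableOn (fun u : ℝ => exp (-s * u)) (Set.Ioi 0) :=
      integrableOn_exp_mul_complex_Ioi (by simpa [hsr] using hδ) 0
    have iB : IntegrableOn (fun u : ℝ => (B u : ℂ) * exp (-s * u)) (Set.Ioi 0) := by
      refine Integrable.mono' (ie.norm.const_mul C0) (by
        exact (by fun_prop : Measurable _).aestronglyMeasurable) (Eventually.of_forall fun u => ?_)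
      rw [norm_mul, norm_real, Real.norm_of_nonneg (hB0 u)]
      exact mul_le_mul_of_nonneg_right (hB1 u) (norm_nonneg _)
    have : ∀ u : ℝ, ((B u - A : ℝ) : ℂ) * exp (-s * u) = (B u : ℂ) * exp (-s * u) - A * exp (-s * u) := by
      intro u; push_cast; ring
    simp_rw [this]
    rw [integral_sub iB (ie.const_mul _), psia_int a (by rw [hsr]; exact hδ), integral_const_mul,
      integral_exp_mul_complex_Ioi (by simpa [hsr] using hδ)]
    have e := eqOn_LFunctionResidueClassAux ha (show 1 + s ∈ {s : ℂ | 1 < s.re} by simp [hsr, hδ])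
    simp only [hHd]
    rw [e]
    simp only [hA]
    push_cast
    simp only [mul_zero, Complex.exp_zero, add_sub_cancel_left]
    field_simp
    ring
  have hDm : Measurable fun u => B u - A := hBm.sub_const _
  have hD : ∀ u, |B u - A| ≤ C0 + A := fun u => by
    rw [abs_le]; constructor <;> linarith [hB0 u, hB1 u, hA0, (hB0 u).trans (hB1 u)]
  have hT := fun l (hl : 0 < l) => wi_conv hDm hD hHc hH hl
  have hT' : ∀ l : ℝ, 0 < l → Tendsto (fun y => ∫ u in Set.Ioi (0:ℝ), (A - B u) * fK l (y - u)) atTop (𝓝 0) := by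
    intro l hl
    have := (hT l hl).neg
    rw [neg_zero] at this
    refine this.congr fun y => ?_
    rw [← integral_neg]; congr 1; ext u; ring
  have hD' : ∀ u, |A - B u| ≤ C0 + A := fun u => by rw [abs_sub_comm]; exact hD u
  rw [Metric.tendsto_nhds]
  intro ε hε
  -- choose h
  obtain ⟨h, hh0, hh1, hh2⟩ : ∃ h > 0, (A + ε) * Real.exp (-(2*h)) > A + ε / 2 ∧
      (A + ε/2) * (Real.exp (2*h) - 1) < ε / 2 := by
    have c1 : Tendsto (fun h : ℝ => (A + ε) * Real.exp (-(2*h))) (𝓝[>] 0) (𝓝 ((A + ε) * Real.exp (-(2*0)))) :=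
      ((by fun_prop : Continuous fun h : ℝ => (A + ε) * Real.exp (-(2*h))).tendsto 0).mono_left nhdsWithin_le_nhds
    have c2 : Tendsto (fun h : ℝ => (A + ε/2) * (Real.exp (2*h) - 1)) (𝓝[>] 0) (𝓝 ((A + ε/2) * (Real.exp (2*0) - 1))) :=
      ((by fun_prop : Continuous fun h : ℝ => (A + ε/2) * (Real.exp (2*h) - 1)).tendsto 0).mono_left nhdsWithin_le_nhds
    have e1 := c1.eventually (lt_mem_nhds (show A + ε / 2 < _ by simp; linarith))
    have e2 := c2.eventually (gt_mem_nhds (show _ < ε / 2 by simp; linarith))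
    obtain ⟨h, h1, h2, h3⟩ := (e1.and (e2.and self_mem_nhdsWithin)).exists
    exact ⟨h, h3, h1, h2⟩
  have w1 := wi_taub hDm hD hT (half_pos hε) hh0
  have w2 := wi_taub (D := fun u => A - B u) (measurable_const.sub hBm) hD' hT' (half_pos hε) hh0
  filter_upwards [(tendsto_atTop_add_const_right _ h tendsto_id).eventually w1,
    (tendsto_atTop_add_const_right _ (-h) tendsto_id).eventually w2] with y h1 h2
  obtain ⟨u1, a1, b1, d1⟩ := h1
  obtain ⟨u2, a2, b2, d2⟩ := h2
  simp only [id] at a1 b1 a2 b2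
  rw [Real.dist_eq, abs_lt]
  constructor
  · by_contra hcon
    push Not at hcon
    have h3 := hBr u2 y (by linarith)
    have h4 : Real.exp (-(2*h)) ≤ Real.exp (u2 - y) := Real.exp_le_exp.2 (by linarith)
    have h5 : B u2 * Real.exp (-(2*h)) ≤ A - ε :=
      (mul_le_mul_of_nonneg_left h4 (hB0 u2)).trans (by linarith)
    have e1 : Real.exp (-(2*h)) * Real.exp (2*h) = 1 := by rw [← Real.exp_add]; simp
    have e2 : 1 ≤ Real.exp (2*h) := Real.one_le_exp (by linarith)
    have h6 : B u2 ≤ (A - ε) * Real.exp (2*h) := by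
      calc B u2 = B u2 * Real.exp (-(2*h)) * Real.exp (2*h) := by rw [mul_assoc, e1, mul_one]
        _ ≤ _ := by gcongr
    nlinarith
  · by_contra hcon
    push Not at hcon
    have h3 := hBr y u1 (by linarith)
    have h4 : Real.exp (-(2*h)) ≤ Real.exp (y - u1) := Real.exp_le_exp.2 (by linarith)
    have h5 : (A + ε) * Real.exp (-(2*h)) ≤ B y * Real.exp (y - u1) :=
      mul_le_mul (by linarith) h4 (Real.exp_pos _).le (hB0 y)
    linarith

theorem pnt_ap {a : ZMod q} (ha : IsUnit a) :
    Tendsto (fun N : ℕ => (∑ n ∈ Icc 1 N, residueClass a n) / (N : ℝ)) atTop (𝓝 ((q.totient : ℝ)⁻¹)) := by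
  have := (psia_lim ha).comp (Real.tendsto_log_atTop.comp (tendsto_natCast_atTop_atTop (R := ℝ)))
  refine this.congr' ?_
  filter_upwards [eventually_gt_atTop 0] with N hN
  have : (0:ℝ) < N := by exact_mod_cast hN
  simp only [Function.comp, Real.exp_neg, Real.exp_log this, psia, Nat.floor_natCast, div_eq_mul_inv]

end WI3
end PP

namespace PP
section BT

lemma fac_sum (s M : Finset ℕ) (hs : ∀ p ∈ s, p.Prime) (hM : ∀ m ∈ M, m ∈ Nat.factoredNumbers s) :
    ∑ m ∈ M, ((m : ℝ))⁻¹ ≤ ∏ p ∈ s, (1 - (p : ℝ)⁻¹)⁻¹ := by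
  let f : ℕ →* ℝ := { toFun := fun n => (n : ℝ)⁻¹, map_one' := by simp, map_mul' := by intros; simp [mul_comm] }
  have h := EulerProduct.summable_and_hasSum_factoredNumbers_prod_filter_prime_geometric (f := f)
    (fun {p} hp => by
      simp only [f, MonoidHom.coe_mk, OneHom.coe_mk, norm_inv, Real.norm_natCast]
      exact inv_lt_one_of_one_lt₀ (by exact_mod_cast hp.one_lt)) s
  rw [Finset.filter_true_of_mem hs] at h
  have h2 := sum_le_hasSum (M.subtype (· ∈ Nat.factoredNumbers s)) (fun i _ => by simp [f]) h.2
  refine le_trans (le_of_eq ?_) h2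
  rw [Finset.sum_subtype_of_mem (f := fun m : ℕ => f m) hM]
  rfl

lemma phi_prod {q : ℕ} (hq : 0 < q) : ∏ p ∈ q.primeFactors, (1 - (p : ℝ)⁻¹)⁻¹ = q / q.totient := by
  have h := Nat.totient_eq_mul_prod_factors q
  have h' : (q.totient : ℝ) = q * ∏ p ∈ q.primeFactors, (1 - (p : ℝ)⁻¹) := by
    have := congrArg (fun x : ℚ => (x : ℝ)) h
    push_cast at this
    exact this
  rw [prod_inv_distrib]
  have hp : (0:ℝ) < q.totient := by exact_mod_cast Nat.totient_pos.2 hq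
  have hq' : (0:ℝ) < q := by exact_mod_cast hq
  rw [eq_div_iff hp.ne', h']
  rw [h'] at hp
  have : ∏ p ∈ q.primeFactors, (1 - (p : ℝ)⁻¹) ≠ 0 := fun h => by simp [h] at hp
  rw [mul_left_comm, inv_mul_cancel₀ this, mul_one]

noncomputable def gS (l : ℕ) : ℝ := (l : ℝ)⁻¹ * ∏ p ∈ l.primeFactors, (1 - (p : ℝ)⁻¹)⁻¹

def bP (q R : ℕ) : ℕ := ∏ p ∈ (Icc 1 R).filter (fun p => p.Prime ∧ ¬ p ∣ q), p

lemma bP_dvd {q R l : ℕ} (hl : Squarefree l) : l ∣ bP q R ↔ ∀ p, p.Prime → p ∣ l → p ≤ R ∧ ¬ p ∣ q := by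
  constructor
  · intro h p hp hpl
    have := (hp.prime.dvd_finsetProd_iff _).1 (hpl.trans h)
    obtain ⟨p', hp', hd⟩ := this
    simp only [mem_filter, mem_Icc] at hp'
    rw [(Nat.prime_dvd_prime_iff_eq hp hp'.2.1).1 hd]
    exact ⟨hp'.1.2, hp'.2.2⟩
  · intro h
    rw [← Nat.prod_primeFactors_of_squarefree hl]
    refine prod_dvd_prod_of_subset _ _ _ fun p hp => ?_
    have hp1 := Nat.prime_of_mem_primeFactors hp
    have := h p hp1 (Nat.dvd_of_mem_primeFactors hp)
    simp only [mem_filter, mem_Icc]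
    exact ⟨⟨hp1.one_le, this.1⟩, hp1, this.2⟩

lemma bP_sqf (q R : ℕ) : Squarefree (bP q R) := by
  unfold bP
  refine Finset.squarefree_prod_of_pairwise_isCoprime ?_ ?_
  · intro a ha b hb hab
    simp only [coe_filter, Set.mem_ofPred_eq] at ha hb
    simp only [Function.onFun]
    rw [← Nat.coprime_iff_isRelPrime]
    exact (Nat.coprime_primes ha.2.1 hb.2.1).2 hab
  · intro p hp
    simp only [mem_filter] at hp
    exact hp.2.1.prime.squarefree

lemma S_lower {q : ℕ} (hq : 0 < q) (R : ℕ) :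
    Real.log R ≤ (q / q.totient : ℝ) * ∑ l ∈ (bP q R).divisors.filter (· ≤ R), gS l := by
  have hlog : Real.log R ≤ ∑ n ∈ Icc 1 R, (n : ℝ)⁻¹ := by
    rcases Nat.eq_zero_or_pos R with rfl | hR
    · simp
    have := log_add_one_le_harmonic R
    rw [harmonic_eq_sum_Icc] at this
    push_cast at this
    refine le_trans (Real.log_le_log (by exact_mod_cast hR) (by simp)) this
  refine hlog.trans ?_
  set L : ℕ → ℕ := fun n => ∏ p ∈ n.primeFactors.filter (fun p => ¬ p ∣ q), p with hL
  have hLd : ∀ n, L n ∣ n := fun n => 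
    (prod_dvd_prod_of_subset _ _ _ (filter_subset _ _)).trans (Nat.prod_primeFactors_dvd n)
  have hLpf : ∀ n, (L n).primeFactors = n.primeFactors.filter (fun p => ¬ p ∣ q) := fun n =>
    Nat.primeFactors_prod fun p hp => Nat.prime_of_mem_primeFactors (mem_filter.1 hp).1
  have hLsq : ∀ n, Squarefree (L n) := fun n => by
    refine Finset.squarefree_prod_of_pairwise_isCoprime ?_ ?_
    · intro a ha b hb hab
      simp only [coe_filter, Set.mem_ofPred_eq] at ha hb
      simp only [Function.onFun]
      rw [← Nat.coprime_iff_isRelPrime]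
      exact (Nat.coprime_primes (Nat.prime_of_mem_primeFactors ha.1) (Nat.prime_of_mem_primeFactors hb.1)).2 hab
    · intro p hp
      simp only [mem_filter] at hp
      exact (Nat.prime_of_mem_primeFactors hp.1).prime.squarefree
  have hmaps : ∀ n ∈ Icc 1 R, L n ∈ (bP q R).divisors.filter (· ≤ R) := by
    intro n hn
    rw [mem_Icc] at hn
    rw [mem_filter, Nat.mem_divisors]
    refine ⟨⟨(bP_dvd (hLsq n)).2 fun p hp hpl => ?_, (bP_sqf q R).ne_zero⟩, (Nat.le_of_dvd hn.1 (hLd n)).trans hn.2⟩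
    have : p ∈ (L n).primeFactors := Nat.mem_primeFactors.2 ⟨hp, hpl, (hLsq n).ne_zero⟩
    rw [hLpf, mem_filter] at this
    exact ⟨(Nat.le_of_mem_primeFactors this.1).trans hn.2, this.2⟩
  rw [← sum_fiberwise_of_maps_to hmaps, mul_sum]
  refine sum_le_sum fun l hl => ?_
  rw [mem_filter, Nat.mem_divisors] at hl
  have hlsq := (bP_sqf q R).squarefree_of_dvd hl.1.1
  have hl0 : l ≠ 0 := hlsq.ne_zero
  have hl0' : (l : ℝ) ≠ 0 := by exact_mod_cast hl0
  have hlq : Disjoint l.primeFactors q.primeFactors := by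
    rw [Finset.disjoint_left]
    intro p hp hp2
    exact ((bP_dvd hlsq).1 hl.1.1 p (Nat.prime_of_mem_primeFactors hp) (Nat.dvd_of_mem_primeFactors hp)).2
      (Nat.dvd_of_mem_primeFactors hp2)
  set F := (Icc 1 R).filter (fun n => L n = l)
  have hinj : Set.InjOn (fun n => n / l) F := by
    intro a ha b hb hab
    simp only [F, coe_filter, Set.mem_ofPred_eq] at ha hb
    have h1 : l ∣ a := ha.2 ▸ hLd a
    have h2 : l ∣ b := hb.2 ▸ hLd b
    simp only at hab
    rw [← Nat.div_mul_cancel h1, ← Nat.div_mul_cancel h2, hab]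
  have e1 : ∑ n ∈ F, (n : ℝ)⁻¹ = (l : ℝ)⁻¹ * ∑ m ∈ F.image (fun n => n / l), (m : ℝ)⁻¹ := by
    rw [sum_image hinj, mul_sum]
    refine sum_congr rfl fun n hn => ?_
    simp only [F, mem_filter] at hn
    have h1 : l ∣ n := hn.2 ▸ hLd n
    rw [Nat.cast_div h1 hl0', inv_div, div_eq_mul_inv, ← mul_assoc, inv_mul_cancel₀ hl0', one_mul]
  rw [e1, gS, ← phi_prod hq]
  have := fac_sum (l.primeFactors ∪ q.primeFactors) (F.image (fun n => n / l)) ?_ ?_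
  · rw [prod_union hlq] at this
    calc _ ≤ (l : ℝ)⁻¹ * ((∏ p ∈ l.primeFactors, (1 - (p:ℝ)⁻¹)⁻¹) * ∏ p ∈ q.primeFactors, (1 - (p:ℝ)⁻¹)⁻¹) := by gcongr
      _ = _ := by ring
  · intro p hp
    rcases mem_union.1 hp with h | h <;> exact Nat.prime_of_mem_primeFactors h
  · intro m hm
    rw [mem_image] at hm
    obtain ⟨n, hn, rfl⟩ := hm
    simp only [F, mem_filter, mem_Icc] at hn
    have h1 : l ∣ n := hn.2 ▸ hLd n
    have hn0 : n ≠ 0 := by omega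
    refine Nat.mem_factoredNumbers_of_dvd (k := n / l) (m := n) ?_ (Nat.div_dvd_of_dvd h1)
    refine Nat.mem_factoredNumbers_of_primeFactors_subset hn0 fun p hp => ?_
    rw [mem_union, ← hn.2, hLpf]
    by_cases hpq : p ∣ q
    · right; exact Nat.mem_primeFactors.2 ⟨Nat.prime_of_mem_primeFactors hp, hpq, hq.ne'⟩
    · left; exact mem_filter.2 ⟨hp, hpq⟩

end BT
end PP

namespace PP
section BT2
open BoundingSieve

noncomputable def nuI : ArithmeticFunction ℝ := ⟨fun n => (n : ℝ)⁻¹, by simp⟩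

lemma nuI_apply (n : ℕ) : nuI n = (n : ℝ)⁻¹ := rfl

noncomputable def bS (x y q r R : ℕ) : BoundingSieve where
  support := (Ioc x (x + y)).filter (fun n => n ≡ r [MOD q])
  prodPrimes := bP q R
  prodPrimes_squarefree := bP_sqf q R
  weights := fun _ => 1
  weights_nonneg := fun _ => zero_le_one
  totalMass := (y : ℝ) / q
  nu := nuI
  nu_mult := by
    refine ⟨by simp [nuI_apply], fun {m n} _ => by simp [nuI_apply, mul_comm]⟩
  nu_pos_of_prime := fun p hp _ => by
    have := hp.pos
    rw [nuI_apply]; positivity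
  nu_lt_one_of_prime := fun p hp _ => by
    rw [nuI_apply]; exact inv_lt_one_of_one_lt₀ (by exact_mod_cast hp.one_lt)

lemma card_ap (x y m v : ℕ) (hm : 0 < m) :
    |(((Ioc x (x + y)).filter (fun n => n ≡ v [MOD m])).card : ℝ) - (y : ℝ) / m| ≤ 1 := by
  have h := Nat.Ioc_filter_modEq_card x (x + y) hm v
  have h2 : ((((Ioc x (x + y)).filter (fun n => n ≡ v [MOD m])).card : ℤ) : ℝ) =
    ((max (⌊(((x + y : ℕ) : ℚ) - v) / m⌋ - ⌊((x : ℚ) - v) / m⌋) 0 : ℤ) : ℝ) := by rw [← h]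
  have hle : ⌊((x : ℚ) - v) / m⌋ ≤ ⌊(((x + y : ℕ) : ℚ) - v) / m⌋ := by
    apply Int.floor_mono; gcongr; simp
  rw [max_eq_left (by linarith)] at h2
  rw [Int.cast_natCast] at h2
  rw [h2]
  have a1 := Int.floor_le ((((x + y : ℕ) : ℚ) - v) / m)
  have a2 := Int.lt_floor_add_one ((((x + y : ℕ) : ℚ) - v) / m)
  have b1 := Int.floor_le (((x : ℚ) - v) / m)
  have b2 := Int.lt_floor_add_one (((x : ℚ) - v) / m)
  have e : (((x + y : ℕ) : ℚ) - v) / m - ((x : ℚ) - v) / m = (y : ℚ) / m := by push_cast; ring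
  generalize ⌊(((x + y : ℕ) : ℚ) - v) / m⌋ = A at *
  generalize ⌊((x : ℚ) - v) / m⌋ = B at *
  have k1 : (A : ℚ) - B - (y : ℚ) / m ≤ 1 := by linarith
  have k2 : -1 ≤ (A : ℚ) - B - (y : ℚ) / m := by linarith
  have l1 := (Rat.cast_le (K := ℝ)).2 k1
  have l2 := (Rat.cast_le (K := ℝ)).2 k2
  push_cast at l1 l2 ⊢
  rw [abs_le]
  exact ⟨l2, l1⟩

lemma bS_rem {x y q r R d : ℕ} (hq : 0 < q) (hd : d ∣ bP q R) : |(bS x y q r R).rem d| ≤ 1 := by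
  have hdsq := (bP_sqf q R).squarefree_of_dvd hd
  have hd0 : 0 < d := Nat.pos_of_ne_zero hdsq.ne_zero
  have hcop : d.Coprime q := by
    refine Nat.coprime_of_dvd fun p hp h1 h2 => ?_
    exact ((bP_dvd hdsq).1 hd p hp h1).2 h2
  obtain ⟨c, hc1, hc2⟩ := Nat.chineseRemainder hcop 0 r
  simp only [BoundingSieve.rem, BoundingSieve.multSum, bS]
  have := card_ap x y (d * q) c (Nat.mul_pos hd0 hq)
  convert this using 2
  rw [← Finset.sum_filter, Finset.sum_const, nsmul_eq_mul, mul_one, filter_filter, nuI_apply]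
  have e : ∀ n, (n ≡ r [MOD q] ∧ d ∣ n) ↔ n ≡ c [MOD d * q] := by
    intro n
    rw [← Nat.modEq_and_modEq_iff_modEq_mul hcop, ← Nat.modEq_zero_iff_dvd]
    constructor
    · rintro ⟨h1, h2⟩; exact ⟨h2.trans hc1.symm, h1.trans hc2.symm⟩
    · rintro ⟨h1, h2⟩; exact ⟨h2.trans hc2, h1.trans hc1⟩
  simp_rw [e]
  push_cast
  congr 1
  field_simp

lemma bS_g (x y q r R l : ℕ) : (bS x y q r R).selbergTerms l = gS l := by
  rw [BoundingSieve.selbergTerms_apply]; rfl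

lemma sum_mu_between {l m : ℕ} (hm : Squarefree m) (P : ℕ) (hP : P ≠ 0) (hmP : m ∣ P) (hl : l ∣ m) :
    ∑ d ∈ P.divisors.filter (fun d => l ∣ d ∧ d ∣ m), (ArithmeticFunction.moebius d : ℝ) =
      if l = m then (ArithmeticFunction.moebius l : ℝ) else 0 := by
  obtain ⟨k, rfl⟩ := hl
  have hm0 := hm.ne_zero
  have hl0 : l ≠ 0 := left_ne_zero_of_mul hm0
  have hk0 : k ≠ 0 := right_ne_zero_of_mul hm0
  have hset : P.divisors.filter (fun d => l ∣ d ∧ d ∣ l * k) = k.divisors.image (fun e => l * e) := by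
    ext d
    simp only [mem_filter, Nat.mem_divisors, mem_image]
    constructor
    · rintro ⟨_, ⟨e, rfl⟩, h⟩
      exact ⟨e, ⟨(Nat.mul_dvd_mul_iff_left (Nat.pos_of_ne_zero hl0)).1 h, hk0⟩, rfl⟩
    · rintro ⟨e, ⟨he, _⟩, rfl⟩
      exact ⟨⟨(Nat.mul_dvd_mul_left l he).trans hmP, hP⟩, dvd_mul_right _ _, Nat.mul_dvd_mul_left l he⟩
  rw [hset, sum_image fun a _ b _ h => Nat.eq_of_mul_eq_mul_left (Nat.pos_of_ne_zero hl0) h]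
  have hcop : l.Coprime k := Nat.coprime_of_squarefree_mul hm
  have e1 : ∀ e ∈ k.divisors, (ArithmeticFunction.moebius (l * e) : ℝ) =
      ArithmeticFunction.moebius l * ArithmeticFunction.moebius e := by
    intro e he
    rw [ArithmeticFunction.isMultiplicative_moebius.map_mul_of_coprime
      (hcop.coprime_dvd_right (Nat.dvd_of_mem_divisors he))]
    push_cast; rfl
  rw [sum_congr rfl e1, ← mul_sum]
  have e2 : ∑ e ∈ k.divisors, (ArithmeticFunction.moebius e : ℝ) = if k = 1 then 1 else 0 := by
    have := congrArg (fun f => f k) ArithmeticFunction.moebius_mul_coe_zeta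
    simp only [ArithmeticFunction.coe_mul_zeta_apply, ArithmeticFunction.one_apply] at this
    exact_mod_cast this
  rw [e2]
  by_cases hk : k = 1
  · simp [hk]
  · have : l ≠ l * k := fun h => hk (Nat.eq_of_mul_eq_mul_left (Nat.pos_of_ne_zero hl0) (by rw [← h, mul_one]))
    simp [hk, this]

lemma gS_pos (x y q r : ℕ) {R l : ℕ} (hl : l ∣ bP q R) : 0 < gS l := by
  rw [← bS_g x y q r R]; exact BoundingSieve.selbergTerms_pos hl

lemma mu_le (d : ℕ) : |(ArithmeticFunction.moebius d : ℝ)| ≤ 1 := by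
  have := ArithmeticFunction.abs_moebius_le_one (n := d)
  rw [← Int.cast_abs]; exact_mod_cast this

noncomputable def tT (q R : ℕ) : Finset ℕ := (bP q R).divisors.filter (· ≤ R)
noncomputable def sS (q R : ℕ) : ℝ := ∑ l ∈ tT q R, gS l
noncomputable def wS (q R d : ℕ) : ℝ :=
  (sS q R)⁻¹ * ArithmeticFunction.moebius d * d * ∑ l ∈ (tT q R).filter (fun l => d ∣ l), gS l

lemma tT_pos {q R l : ℕ} (hl : l ∈ tT q R) : 0 < gS l :=
  gS_pos 0 0 q 0 (Nat.dvd_of_mem_divisors (mem_filter.1 hl).1)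

lemma sS_pos {q R : ℕ} (hq : 0 < q) (hR : 2 ≤ R) : 0 < sS q R := by
  have hlogR : 0 < Real.log R := Real.log_pos (by exact_mod_cast hR)
  have hlow := S_lower hq R
  have : 0 < (q / q.totient : ℝ) * sS q R := hlogR.trans_le hlow
  exact pos_of_mul_pos_right this (by positivity)

lemma wS_one {q R : ℕ} (hS : 0 < sS q R) : wS q R 1 = 1 := by
  simp only [wS, one_dvd, Finset.filter_true]
  rw [← sS]; simp [hS.ne']

lemma wS_gt {q R d : ℕ} (hd : R < d) : wS q R d = 0 := by
  rw [wS, Finset.filter_false_of_mem, sum_empty, mul_zero]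
  intro l hl h
  rw [tT, mem_filter] at hl
  have := Nat.le_of_dvd (Nat.pos_of_mem_divisors hl.1) h
  omega

lemma wS_le {q R : ℕ} (hS : 0 < sS q R) (d : ℕ) : |wS q R d| ≤ d := by
  have h2 : |∑ l ∈ (tT q R).filter (fun l => d ∣ l), gS l| ≤ sS q R := by
    rw [abs_of_nonneg (sum_nonneg fun l hl => (tT_pos (mem_filter.1 hl).1).le)]
    exact sum_le_sum_of_subset_of_nonneg (filter_subset _ _) fun l hl _ => (tT_pos hl).le
  rw [wS, abs_mul, abs_mul, abs_mul, Nat.abs_cast, abs_of_pos (inv_pos.2 hS)]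
  have h1 := mu_le d
  generalize (∑ l ∈ (tT q R).filter (fun l => d ∣ l), gS l) = X at *
  calc _ ≤ (sS q R)⁻¹ * 1 * d * sS q R := by gcongr
      _ = d := by field_simp

lemma wS_inner {q R l : ℕ} (hl : l ∈ (bP q R).divisors) :
    (∑ d ∈ (bP q R).divisors, if l ∣ d then nuI d * wS q R d else 0) =
        if l ≤ R then (sS q R)⁻¹ * gS l * ArithmeticFunction.moebius l else 0 := by
  have hP0 : bP q R ≠ 0 := (bP_sqf q R).ne_zero
  have hlP := Nat.dvd_of_mem_divisors hl
  have e1 : ∀ d ∈ (bP q R).divisors, (if l ∣ d then nuI d * wS q R d else 0) =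
      ∑ m ∈ tT q R, if l ∣ d ∧ d ∣ m then (sS q R)⁻¹ * gS m * ArithmeticFunction.moebius d else 0 := by
    intro d hd
    have hd0 : (d : ℝ) ≠ 0 := by exact_mod_cast (Nat.pos_of_mem_divisors hd).ne'
    by_cases h : l ∣ d
    · simp only [h, true_and, if_true, wS, nuI_apply, sum_filter, mul_sum]
      refine sum_congr rfl fun m _ => ?_
      split_ifs
      · field_simp
      · simp
    · simp [h]
  rw [sum_congr rfl e1, sum_comm]
  have e2 : ∀ m ∈ tT q R, (∑ d ∈ (bP q R).divisors, if l ∣ d ∧ d ∣ m then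
      (sS q R)⁻¹ * gS m * (ArithmeticFunction.moebius d : ℝ) else 0) =
      if l = m then (sS q R)⁻¹ * gS m * ArithmeticFunction.moebius l else 0 := by
    intro m hm
    have hmP := Nat.dvd_of_mem_divisors (mem_filter.1 hm).1
    rw [← sum_filter, ← mul_sum]
    by_cases hlm : l ∣ m
    · rw [sum_mu_between ((bP_sqf q R).squarefree_of_dvd hmP) _ hP0 hmP hlm]
      split_ifs <;> simp
    · rw [Finset.filter_false_of_mem, sum_empty, mul_zero, if_neg]
      · rintro rfl; exact hlm dvd_rfl
      · rintro d _ ⟨h1, h2⟩; exact hlm (h1.trans h2)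
  rw [sum_congr rfl e2, sum_ite_eq]
  simp only [tT, mem_filter, hl, true_and]

lemma wS_val {q R : ℕ} (hS : 0 < sS q R) : ∑ l ∈ (bP q R).divisors, (gS l)⁻¹ *
    (∑ d ∈ (bP q R).divisors, if l ∣ d then nuI d * wS q R d else 0) ^ 2 ≤ (sS q R)⁻¹ := by
  calc _ = ∑ l ∈ (bP q R).divisors, if l ≤ R then (gS l)⁻¹ * ((sS q R)⁻¹ * gS l * ArithmeticFunction.moebius l) ^ 2 else 0 := by
        refine sum_congr rfl fun l hl => ?_
        rw [wS_inner hl]; split_ifs <;> simp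
    _ = ∑ l ∈ tT q R, (gS l)⁻¹ * ((sS q R)⁻¹ * gS l * ArithmeticFunction.moebius l) ^ 2 := by rw [tT, sum_filter]
    _ ≤ ∑ l ∈ tT q R, (sS q R)⁻¹ * (sS q R)⁻¹ * gS l := by
        refine sum_le_sum fun l hl => ?_
        have h1 : (ArithmeticFunction.moebius l : ℝ) ^ 2 ≤ 1 := by
          rw [sq_le_one_iff_abs_le_one]; exact mu_le l
        have h2 := tT_pos hl
        generalize gS l = g at *
        generalize (ArithmeticFunction.moebius l : ℝ) = m at *
        calc g⁻¹ * ((sS q R)⁻¹ * g * m) ^ 2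
            = (sS q R)⁻¹ * (sS q R)⁻¹ * g * m ^ 2 := by field_simp
          _ ≤ (sS q R)⁻¹ * (sS q R)⁻¹ * g * 1 := by gcongr
          _ = _ := mul_one _
    _ = (sS q R)⁻¹ := by
        rw [← mul_sum, ← sS]; field_simp

lemma bS_err (x y q r R : ℕ) (hq : 0 < q) (hS : 0 < sS q R) :
    (bS x y q r R).errSum (BoundingSieve.lambdaSquared (wS q R)) ≤ R ^ 4 := by
  have hP0 : bP q R ≠ 0 := (bP_sqf q R).ne_zero
  have h1 : (bS x y q r R).errSum (BoundingSieve.lambdaSquared (wS q R)) ≤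
      ∑ d ∈ (bP q R).divisors, ∑ d1 ∈ (bP q R).divisors, ∑ d2 ∈ (bP q R).divisors,
        if d = Nat.lcm d1 d2 then |wS q R d1| * |wS q R d2| else 0 := by
    unfold BoundingSieve.errSum
    refine sum_le_sum fun d hd => ?_
    have hdP : d ∣ bP q R := Nat.dvd_of_mem_divisors hd
    have hsub : d.divisors ⊆ (bP q R).divisors := Nat.divisors_subset_of_dvd hP0 hdP
    have hnn : ∀ d1 d2, 0 ≤ if d = Nat.lcm d1 d2 then |wS q R d1| * |wS q R d2| else 0 := by
      intro d1 d2; split_ifs <;> positivity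
    calc _ ≤ |BoundingSieve.lambdaSquared (wS q R) d| * 1 :=
          mul_le_mul_of_nonneg_left (bS_rem hq hdP) (abs_nonneg _)
      _ ≤ ∑ d1 ∈ d.divisors, ∑ d2 ∈ d.divisors, if d = Nat.lcm d1 d2 then |wS q R d1| * |wS q R d2| else 0 := by
          rw [mul_one, BoundingSieve.lambdaSquared]
          refine (abs_sum_le_sum_abs _ _).trans (sum_le_sum fun d1 _ => (abs_sum_le_sum_abs _ _).trans
            (sum_le_sum fun d2 _ => le_of_eq ?_))
          split_ifs <;> simp [abs_mul]
      _ ≤ _ := (sum_le_sum fun d1 _ => sum_le_sum_of_subset_of_nonneg hsub fun d2 _ _ => hnn d1 d2).trans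
          (sum_le_sum_of_subset_of_nonneg hsub fun d1 _ _ => sum_nonneg fun d2 _ => hnn d1 d2)
  have h2 : ∑ d ∈ (bP q R).divisors, |wS q R d| ≤ (R : ℝ) ^ 2 := by
    calc ∑ d ∈ (bP q R).divisors, |wS q R d| = ∑ d ∈ tT q R, |wS q R d| := by
          rw [tT]; symm; apply sum_filter_of_ne
          intro d _ h
          by_contra hd
          exact h (by rw [wS_gt (not_le.1 hd), abs_zero])
      _ ≤ ∑ d ∈ Icc 1 R, |wS q R d| := by
          refine sum_le_sum_of_subset_of_nonneg (fun d hd => ?_) fun _ _ _ => abs_nonneg _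
          rw [tT, mem_filter] at hd
          exact mem_Icc.2 ⟨Nat.pos_of_mem_divisors hd.1, hd.2⟩
      _ ≤ ∑ d ∈ Icc 1 R, (R : ℝ) := sum_le_sum fun d hd => (wS_le hS d).trans (by exact_mod_cast (mem_Icc.1 hd).2)
      _ = _ := by simp [sq]
  refine h1.trans ?_
  rw [sum_comm]
  calc _ ≤ ∑ d1 ∈ (bP q R).divisors, ∑ d2 ∈ (bP q R).divisors, |wS q R d1| * |wS q R d2| := by
        refine sum_le_sum fun d1 _ => ?_
        rw [sum_comm]
        refine sum_le_sum fun d2 _ => ?_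
        rw [sum_ite_eq']; split_ifs
        · exact le_rfl
        · positivity
    _ = (∑ d ∈ (bP q R).divisors, |wS q R d|) ^ 2 := by rw [sq, sum_mul_sum]
    _ ≤ ((R : ℝ) ^ 2) ^ 2 := pow_le_pow_left₀ (sum_nonneg fun _ _ => abs_nonneg _) h2 2
    _ = _ := by ring

lemma bt_count (x y q r R : ℕ) (hq : 0 < q) (hR : 2 ≤ R) :
    (((Ioc x (x + y)).filter (fun n => n ≡ r [MOD q] ∧ (bP q R).Coprime n)).card : ℝ) ≤
      y / (q.totient * Real.log R) + R ^ 4 := by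
  have hS := sS_pos hq hR
  have hlogR : 0 < Real.log R := Real.log_pos (by exact_mod_cast hR)
  have hlow : _ ≤ _ * sS q R := S_lower hq R
  have hφ : (0:ℝ) < q.totient := by exact_mod_cast Nat.totient_pos.2 hq
  have hq' : (0:ℝ) < q := by exact_mod_cast hq
  have hmain := BoundingSieve.siftedSum_le_mainSum_errSum_of_upperMoebius (s := bS x y q r R) _
    (BoundingSieve.upperMoebius_lambdaSquared (wS q R) (wS_one hS))
  have hsift : (bS x y q r R).siftedSum =
      (((Ioc x (x + y)).filter (fun n => n ≡ r [MOD q] ∧ (bP q R).Coprime n)).card : ℝ) := by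
    have h0 : (bS x y q r R).siftedSum = ∑ d ∈ (Ioc x (x + y)).filter (fun n => n ≡ r [MOD q]),
      if (bP q R).Coprime d then (1 : ℝ) else 0 := rfl
    rw [h0, ← Finset.sum_filter, Finset.sum_const, nsmul_eq_mul, mul_one, filter_filter]
  rw [hsift] at hmain
  refine hmain.trans (add_le_add ?_ (bS_err x y q r R hq hS))
  rw [BoundingSieve.mainSum_lambdaSquared_eq_sum_mul_sum_sq]
  have hval : ∑ l ∈ (bS x y q r R).prodPrimes.divisors, ((bS x y q r R).selbergTerms l)⁻¹ *
      (∑ d ∈ (bS x y q r R).prodPrimes.divisors, if l ∣ d then (bS x y q r R).nu d * wS q R d else 0) ^ 2 ≤ (sS q R)⁻¹ := by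
    refine le_trans (le_of_eq ?_) (wS_val hS)
    refine sum_congr rfl fun l _ => ?_
    rw [bS_g]; rfl
  refine (mul_le_mul_of_nonneg_left hval (by simp only [bS]; positivity)).trans ?_
  change (y : ℝ) / q * (sS q R)⁻¹ ≤ _
  rw [div_mul_eq_mul_div, ← div_eq_mul_inv, div_div]
  refine div_le_div_of_nonneg_left (by positivity) (by positivity) ?_
  calc q.totient * Real.log R ≤ q.totient * (q / q.totient * sS q R) := by gcongr
    _ = _ := by field_simp

end BT2
end PP

namespace PP
section BT3
open ArithmeticFunction

lemma brun_titchmarsh : ∃ C : ℝ, 0 < C ∧ ∀ X x y q r : ℕ, 256 ≤ X → x + y ≤ X → X ^ 3 ≤ y ^ 4 → 1 ≤ q →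
    q ^ 8 ≤ X → ∑ n ∈ (Ioc x (x + y)).filter (fun n => n ≡ r [MOD q]), vonMangoldt n ≤
      C * (y / q.totient) := by
  refine ⟨16 + 8 * (2 + (Real.log 4 + 4) + 1), by positivity, fun X x y q r hX hxy hy hq hqX => ?_⟩
  obtain ⟨R, hR1, hR2⟩ : ∃ R : ℕ, R ^ 8 ≤ X ∧ X < (R + 1) ^ 8 := by
    have hex : ∃ n, X < (n + 1) ^ 8 := ⟨X, by
      calc X < X + 1 := by omega
        _ = (X + 1) ^ 1 := by ring
        _ ≤ (X + 1) ^ 8 := Nat.pow_le_pow_right (by omega) (by omega)⟩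
    refine ⟨Nat.find hex, ?_, Nat.find_spec hex⟩
    by_cases h : Nat.find hex = 0
    · rw [h]; simp
    · have := Nat.find_min hex (m := Nat.find hex - 1) (by omega)
      rwa [Nat.sub_add_cancel (by omega), not_lt] at this
  have hRge : 2 ≤ R := by
    by_contra h
    have : (R + 1) ^ 8 ≤ 2 ^ 8 := Nat.pow_le_pow_left (by omega) 8
    omega
  have hX0 : (0:ℝ) < X := by positivity
  have hX1 : (1:ℝ) ≤ X := by exact_mod_cast (by omega : 1 ≤ X)
  have hlogX : 0 ≤ Real.log X := Real.log_nonneg hX1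
  have hlogR : 0 < Real.log R := Real.log_pos (by exact_mod_cast hRge)
  have hφ : (0:ℝ) < q.totient := by exact_mod_cast Nat.totient_pos.2 hq
  have hlog : Real.log X ≤ 16 * Real.log R := by
    have : (X : ℝ) ≤ (R : ℝ) ^ 16 := by
      have : X ≤ R ^ 16 := by
        calc X ≤ (R + 1) ^ 8 := hR2.le
          _ ≤ (R ^ 2) ^ 8 := Nat.pow_le_pow_left (by nlinarith) 8
          _ = _ := by ring
      exact_mod_cast this
    calc Real.log X ≤ Real.log ((R : ℝ) ^ 16) := Real.log_le_log hX0 this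
      _ = _ := by rw [Real.log_pow]; norm_num
  have hR4 : (R : ℝ) ^ 4 ≤ √X := by
    apply Real.le_sqrt_of_sq_le
    rw [← pow_mul]; exact_mod_cast hR1
  have hRs : (R : ℝ) ≤ √X := by
    refine le_trans ?_ hR4
    exact_mod_cast (Nat.le_self_pow (by norm_num) R)
  -- key size
  have hsize : √X * Real.log X ≤ 8 * (y / q.totient) := by
    have h1 : Real.log X ≤ (X : ℝ) ^ (1/8 : ℝ) / (1/8) := Real.log_le_rpow_div hX0.le (by norm_num)
    have h2 : (q.totient : ℝ) ≤ (X : ℝ) ^ (1/8 : ℝ) := by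
      have : (q : ℝ) ^ 8 ≤ X := by exact_mod_cast hqX
      calc (q.totient : ℝ) ≤ q := by exact_mod_cast Nat.totient_le q
        _ = ((q : ℝ) ^ 8) ^ (1/8 : ℝ) := by
            rw [← Real.rpow_natCast, ← Real.rpow_mul (by positivity)]; norm_num
        _ ≤ _ := Real.rpow_le_rpow (by positivity) this (by norm_num)
    have h3 : (X : ℝ) ^ (3/4 : ℝ) ≤ y := by
      have : (X : ℝ) ^ 3 ≤ (y : ℝ) ^ 4 := by exact_mod_cast hy
      calc (X : ℝ) ^ (3/4 : ℝ) = ((X : ℝ) ^ 3) ^ (1/4 : ℝ) := by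
            rw [← Real.rpow_natCast, ← Real.rpow_mul (by positivity)]; norm_num
        _ ≤ ((y : ℝ) ^ 4) ^ (1/4 : ℝ) := Real.rpow_le_rpow (by positivity) this (by norm_num)
        _ = y := by
            rw [← Real.rpow_natCast, ← Real.rpow_mul (by positivity)]; norm_num
    have h4 : √X * ((X : ℝ) ^ (1/8 : ℝ)) * (X : ℝ) ^ (1/8 : ℝ) = (X : ℝ) ^ (3/4 : ℝ) := by
      rw [Real.sqrt_eq_rpow, ← Real.rpow_add hX0, ← Real.rpow_add hX0]; norm_num
    have h5 : √X * Real.log X * q.totient ≤ 8 * y := by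
      calc _ ≤ √X * ((X : ℝ) ^ (1/8 : ℝ) / (1/8)) * (X : ℝ) ^ (1/8 : ℝ) := by gcongr
        _ = 8 * (X : ℝ) ^ (3/4 : ℝ) := by rw [← h4]; ring
        _ ≤ _ := by gcongr
    rw [mul_div_assoc', le_div_iff₀ hφ]; exact h5
  have hlogX1 : 1 ≤ Real.log X := by
    rw [Real.le_log_iff_exp_le hX0]
    have := Real.exp_one_lt_d9
    have : (256 : ℝ) ≤ X := by exact_mod_cast hX
    linarith
  set I := (Ioc x (x + y)).filter (fun n => n ≡ r [MOD q]) with hI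
  have hsub : I ⊆ Ioc 0 X := fun n hn => by
    rw [hI, mem_filter, mem_Ioc] at hn; rw [mem_Ioc]; omega
  have s1 : ∑ n ∈ I, vonMangoldt n ≤ ∑ n ∈ I, ((if n.Prime then 0 else vonMangoldt n) +
      (if n ≤ R then vonMangoldt n else 0) + (if n.Prime ∧ R < n then Real.log X else 0)) := by
    refine sum_le_sum fun n hn => ?_
    have hn0 := vonMangoldt_nonneg (n := n)
    have hnX := mem_Ioc.1 (hsub hn)
    have h0 : (0:ℝ) < n := by exact_mod_cast hnX.1
    have hnX2 : (n:ℝ) ≤ X := by exact_mod_cast hnX.2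
    have hl : vonMangoldt n ≤ Real.log X := vonMangoldt_le_log.trans (Real.log_le_log h0 hnX2)
    by_cases hp : n.Prime <;> by_cases hr : n ≤ R
    · simp [hp, hr, not_lt.2 hr]
    · simp [hp, hr, not_le.1 hr, hl]
    · simp [hp, hr, hn0]
    · simp [hp, hr]
  have s2 : ∑ n ∈ I, (if n.Prime then 0 else vonMangoldt n) ≤ 2 * √X * Real.log X := by
    have h := Chebyshev.abs_psi_sub_theta_le_sqrt_mul_log hX1
    refine le_trans ?_ ((le_abs_self _).trans h)
    calc _ ≤ ∑ n ∈ Ioc 0 X, (if n.Prime then 0 else vonMangoldt n) :=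
          sum_le_sum_of_subset_of_nonneg hsub fun n _ _ => by split_ifs <;> simp [vonMangoldt_nonneg]
      _ = Chebyshev.psi X - Chebyshev.theta X := by
          rw [Chebyshev.psi, Chebyshev.theta, Nat.floor_natCast, sum_filter, ← sum_sub_distrib]
          refine sum_congr rfl fun n _ => ?_
          split_ifs with h
          · rw [vonMangoldt_apply_prime h, sub_self]
          · simp
  have s3 : ∑ n ∈ I, (if n ≤ R then vonMangoldt n else 0) ≤ (Real.log 4 + 4) * R := by
    refine le_trans ?_ (Chebyshev.psi_le_const_mul_self (Nat.cast_nonneg R))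
    rw [← sum_filter, Chebyshev.psi, Nat.floor_natCast]
    refine sum_le_sum_of_subset_of_nonneg (fun n hn => ?_) fun _ _ _ => vonMangoldt_nonneg
    rw [mem_filter] at hn
    exact mem_Ioc.2 ⟨(mem_Ioc.1 (hsub hn.1)).1, hn.2⟩
  have s4 : ∑ n ∈ I, (if n.Prime ∧ R < n then Real.log X else 0) ≤
      Real.log X * (y / (q.totient * Real.log R) + R ^ 4) := by
    rw [← sum_filter, sum_const, nsmul_eq_mul, mul_comm]
    refine mul_le_mul_of_nonneg_left (le_trans ?_ (bt_count x y q r R hq hRge)) hlogX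
    gcongr
    intro n hn
    rw [hI, mem_filter, mem_filter] at hn
    rw [mem_filter]
    refine ⟨hn.1.1, hn.1.2, ?_⟩
    have hp := hn.2.1
    refine ((Nat.Prime.coprime_iff_not_dvd hp).2 fun h => ?_).symm
    have := ((bP_dvd hp.prime.squarefree).1 h n hp dvd_rfl).1
    omega
  rw [sum_add_distrib, sum_add_distrib] at s1
  have s5 : Real.log X * (y / (q.totient * Real.log R)) ≤ 16 * (y / q.totient) := by
    calc _ ≤ (16 * Real.log R) * (y / (q.totient * Real.log R)) := by gcongr
      _ = _ := by field_simp
  have s6 : (Real.log 4 + 4) * R ≤ (Real.log 4 + 4) * (√X * Real.log X) := by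
    have : (R:ℝ) ≤ √X * Real.log X := hRs.trans (le_mul_of_one_le_right (Real.sqrt_nonneg _) hlogX1)
    have : 0 < Real.log 4 := Real.log_pos (by norm_num)
    gcongr
  have s7 : Real.log X * R ^ 4 ≤ √X * Real.log X := by rw [mul_comm]; gcongr
  calc _ ≤ _ := s1
    _ ≤ 2 * √X * Real.log X + (Real.log 4 + 4) * (√X * Real.log X) + (16 * (y / q.totient) + √X * Real.log X) := by
        rw [mul_add] at s4; linarith
    _ = 16 * (y / q.totient) + (2 + (Real.log 4 + 4) + 1) * (√X * Real.log X) := by ring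
    _ ≤ 16 * (y / q.totient) + (2 + (Real.log 4 + 4) + 1) * (8 * (y / q.totient)) := by gcongr
    _ = _ := by ring

end BT3
end PP

namespace PP
section EE

noncomputable def ee (x : ℝ) : ℂ := Complex.exp (Complex.I * ((2 * Real.pi * x : ℝ) : ℂ))

lemma ee_add (x y : ℝ) : ee (x + y) = ee x * ee y := by
  rw [ee, ee, ee, ← Complex.exp_add]; congr 1; push_cast; ring

lemma ee_zero : ee 0 = 1 := by simp [ee]

lemma ee_int (n : ℤ) : ee n = 1 := by
  rw [ee, Complex.exp_eq_one_iff]; exact ⟨n, by push_cast; ring⟩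

lemma ee_nat (n : ℕ) : ee n = 1 := by simpa using ee_int n

lemma ee_nat_mul (n : ℕ) (x : ℝ) : ee (n * x) = ee x ^ n := by
  rw [ee, ee, ← Complex.exp_nat_mul]; congr 1; push_cast; ring

lemma norm_ee (x : ℝ) : ‖ee x‖ = 1 := by rw [ee, mul_comm]; exact Complex.norm_exp_ofReal_mul_I _

lemma ee_neg (x : ℝ) : ee (-x) = (starRingEnd ℂ) (ee x) := by
  rw [ee, ee, ← Complex.exp_conj, map_mul, Complex.conj_I, Complex.conj_ofReal]; congr 1; push_cast; ring

lemma ee_sub_le (x : ℝ) : ‖ee x - 1‖ ≤ 2 * Real.pi * |x| := by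
  have := Real.norm_exp_I_mul_ofReal_sub_one_le (x := 2 * Real.pi * x)
  rwa [Real.norm_eq_abs, abs_mul, abs_of_pos Real.two_pi_pos] at this

lemma ee_sub_neg (x : ℝ) : ‖ee (-x) - 1‖ = ‖ee x - 1‖ := by
  rw [ee_neg, ← RCLike.norm_conj (ee x - 1)]; simp

lemma ee_sub_sub (x y : ℝ) : ‖ee x - ee y‖ = ‖ee (x - y) - 1‖ := by
  have : ee x - ee y = ee y * (ee (x - y) - 1) := by
    rw [mul_sub, ← ee_add]; simp
  rw [this, norm_mul, norm_ee, one_mul]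

lemma ee_sub_ge {x : ℝ} (hx : |x| ≤ 1 / 2) : 4 * |x| ≤ ‖ee x - 1‖ := by
  have h := Complex.norm_exp_I_mul_ofReal_sub_one (2 * Real.pi * x)
  rw [ee, h, norm_mul, Real.norm_eq_abs, Real.norm_eq_abs, abs_two]
  have hpi := Real.pi_pos
  have := Real.mul_abs_le_abs_sin (x := 2 * Real.pi * x / 2) (by
    rw [abs_div, abs_mul, abs_mul, abs_two, abs_of_pos hpi]; nlinarith)
  rw [abs_div, abs_mul, abs_mul, abs_two, abs_of_pos hpi] at this
  have e : 2 / Real.pi * (2 * Real.pi * |x| / 2) = 2 * |x| := by field_simp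
  linarith

lemma geom_ee (a b : ℕ) (x : ℝ) : ‖∑ n ∈ Ioc a b, ee (n * x)‖ * ‖ee x - 1‖ ≤ 2 := by
  rcases le_or_gt b a with h | h
  · rw [Ioc_eq_empty_of_le h]; simp
  rw [← norm_mul, sum_mul]
  have : ∑ n ∈ Ioc a b, ee (n * x) * (ee x - 1) = ee ((b + 1 : ℕ) * x) - ee ((a + 1 : ℕ) * x) := by
    rw [← Ico_add_one_add_one_eq_Ioc, ← sum_Ico_sub (fun n : ℕ => ee (n * x)) (by omega : a + 1 ≤ b + 1)]
    refine sum_congr rfl fun n _ => ?_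
    rw [mul_sub, ← ee_add]; push_cast; ring_nf
  rw [this]
  refine (norm_sub_le _ _).trans ?_
  rw [norm_ee, norm_ee]; norm_num

lemma geom_ee_triv (a b : ℕ) (x : ℝ) : ‖∑ n ∈ Ioc a b, ee (n * x)‖ ≤ (b - a : ℕ) := by
  refine (norm_sum_le _ _).trans ?_
  simp [norm_ee]

/-- residue lower bound -/
lemma ee_res {q r : ℕ} (h0 : 0 < r) (hq : r < q) :
    4 / q * (min (r : ℝ) (q - r : ℕ)) ≤ ‖ee ((r : ℝ) / q) - 1‖ := by
  have hq0 : (0:ℝ) < q := by exact_mod_cast (by omega : 0 < q)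
  rcases le_total (2 * r) q with h | h
  · have h' : (2 * r : ℝ) ≤ q := by exact_mod_cast h
    have := ee_sub_ge (x := (r : ℝ) / q) (by
      rw [abs_of_nonneg (by positivity), div_le_iff₀ hq0]; linarith)
    rw [abs_of_nonneg (by positivity)] at this
    refine le_trans ?_ this
    calc 4 / q * (min (r : ℝ) (q - r : ℕ)) ≤ 4 / q * r := by gcongr; exact min_le_left _ _
      _ = _ := by ring
  · have h' : (q : ℝ) ≤ 2 * r := by exact_mod_cast h
    have hq' : (r : ℝ) < q := by exact_mod_cast hq
    have e : ee ((r : ℝ) / q) = ee (-(((q - r : ℕ) : ℝ) / q)) := by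
      have : (r : ℝ) / q = -(((q - r : ℕ) : ℝ) / q) + (1 : ℤ) := by
        rw [Nat.cast_sub hq.le]; field_simp; push_cast; ring
      rw [this, ee_add, ee_int, mul_one]
    rw [e, ee_sub_neg]
    have := ee_sub_ge (x := ((q - r : ℕ) : ℝ) / q) (by
      rw [abs_of_nonneg (by positivity), div_le_iff₀ hq0, Nat.cast_sub hq.le]; linarith)
    rw [abs_of_nonneg (by positivity)] at this
    refine le_trans ?_ this
    calc 4 / q * (min (r : ℝ) (q - r : ℕ)) ≤ 4 / q * (q - r : ℕ) := by gcongr; exact min_le_right _ _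
      _ = _ := by ring

/-- residue of `h a` mod `q` as a natural number -/
noncomputable def resi (q : ℕ) (a : ℤ) (h : ℕ) : ℕ := ((h * a) % (q : ℤ)).toNat

lemma resi_cast {q : ℕ} (hq : 0 < q) (a : ℤ) (h : ℕ) : (resi q a h : ℤ) = (h * a) % (q : ℤ) :=
  Int.toNat_of_nonneg (Int.emod_nonneg _ (by omega))

lemma resi_mem {q : ℕ} (hq : 0 < q) {a : ℤ} (ha : IsCoprime a q) {h : ℕ} (hh : ¬ q ∣ h) :
    0 < resi q a h ∧ resi q a h < q := by
  have h1 := resi_cast hq a h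
  constructor
  · rw [Nat.pos_iff_ne_zero]
    intro h0
    rw [h0] at h1
    have : (q : ℤ) ∣ h * a := Int.dvd_of_emod_eq_zero (by simpa using h1.symm)
    have := ha.symm.dvd_of_dvd_mul_right this
    exact hh (by exact_mod_cast this)
  · have := Int.emod_lt_of_pos (h * a) (by exact_mod_cast hq : (0:ℤ) < q)
    omega

lemma ee_resi {q : ℕ} (hq : 0 < q) (a : ℤ) (h : ℕ) :
    ee (h * (a / q)) = ee ((resi q a h : ℝ) / q) := by
  have h1 := resi_cast hq a h
  have h2 := Int.emod_add_mul_ediv (h * a) q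
  rw [← h1] at h2
  have h3 : ((resi q a h : ℝ) + q * ((h * a / q : ℤ) : ℝ)) = h * a := by exact_mod_cast h2
  have hq0 : (q : ℝ) ≠ 0 := by exact_mod_cast hq.ne'
  have : (h : ℝ) * (a / q) = (resi q a h : ℝ) / q + ((h * a / q : ℤ) : ℝ) := by
    field_simp; linarith
  rw [this, ee_add, ee_int, mul_one]

lemma ee_pt {q : ℕ} (hq : 0 < q) {a : ℤ} (ha : IsCoprime a q) {h : ℕ} (hh : ¬ q ∣ h) {β : ℝ}
    (hβ : h * |β| ≤ 1 / (4 * q)) :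
    2 / q * (min (resi q a h : ℝ) (q - resi q a h : ℕ)) ≤ ‖ee (h * (a / q + β)) - 1‖ := by
  obtain ⟨h0, h1⟩ := resi_mem hq ha hh
  have k1 := ee_res h0 h1
  have hq0 : (0:ℝ) < q := by exact_mod_cast hq
  have k2 : ‖ee ((resi q a h : ℝ) / q) - 1‖ ≤ ‖ee (h * (a / q + β)) - 1‖ + ‖ee (h * β) - 1‖ := by
    rw [← ee_resi hq]
    have : ee (h * (a / q)) - 1 = (ee (h * (a / q + β)) - 1) + (ee (h * (a / q)) - ee (h * (a / q + β))) := by ring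
    rw [this]
    refine (norm_add_le _ _).trans (le_of_eq ?_)
    rw [ee_sub_sub, ← ee_sub_neg (h * β)]; congr 4; ring
  have k3 : ‖ee (h * β) - 1‖ ≤ 2 / q := by
    refine (ee_sub_le _).trans ?_
    rw [abs_mul, Nat.abs_cast]
    calc 2 * Real.pi * (h * |β|) ≤ 2 * 4 * (1 / (4 * q)) := by
          gcongr; exact Real.pi_le_four
      _ = _ := by field_simp
  have k4 : (1:ℝ) ≤ min (resi q a h : ℝ) (q - resi q a h : ℕ) :=
    le_min (by exact_mod_cast h0) (by exact_mod_cast (by omega : 1 ≤ q - resi q a h))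
  have k5 : 2 / q * 1 ≤ 2 / q * (min (resi q a h : ℝ) (q - resi q a h : ℕ)) := by gcongr
  have : 4 / q * (min (resi q a h : ℝ) (q - resi q a h : ℕ)) =
    2 / q * (min (resi q a h : ℝ) (q - resi q a h : ℕ)) + 2 / q * (min (resi q a h : ℝ) (q - resi q a h : ℕ)) := by ring
  linarith

lemma ee_pt2 {q : ℕ} (hq : 0 < q) {a : ℤ} (ha : IsCoprime a q) {h : ℕ} (hh : ¬ q ∣ h) {β : ℝ}
    (hβ : h * |β| ≤ 1 / (4 * q)) : 2 / q ≤ ‖ee (h * (a / q + β)) - 1‖ := by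
  obtain ⟨h0, h1⟩ := resi_mem hq ha hh
  refine le_trans ?_ (ee_pt hq ha hh hβ)
  have k4 : (1:ℝ) ≤ min (resi q a h : ℝ) (q - resi q a h : ℕ) :=
    le_min (by exact_mod_cast h0) (by exact_mod_cast (by omega : 1 ≤ q - resi q a h))
  exact le_mul_of_one_le_right (by positivity) k4

lemma harm_le (q : ℕ) : ∑ r ∈ Icc 1 q, (r : ℝ)⁻¹ ≤ 1 + Real.log q := by
  have := harmonic_le_one_add_log q
  rw [harmonic_eq_sum_Icc] at this
  push_cast at this; exact this

lemma block {q : ℕ} (hq : 0 < q) {a : ℤ} (ha : IsCoprime a q) {β : ℝ} {H : ℕ}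
    (hβ : H * |β| ≤ 1 / (4 * q)) :
    ∑ h ∈ (Icc 1 H).filter (fun h => ¬ q ∣ h), ‖ee (h * (a / q + β)) - 1‖⁻¹ ≤
      ((H : ℝ) / q + 1) * (q * (1 + Real.log q)) := by
  have hq0 : (0:ℝ) < q := by exact_mod_cast hq
  set f : ℕ → ℝ := fun r => q / 2 * ((r : ℝ)⁻¹ + ((q - r : ℕ) : ℝ)⁻¹) with hf
  have hf0 : ∀ r, 0 ≤ f r := fun r => by simp only [hf]; positivity
  have s1 : ∑ h ∈ (Icc 1 H).filter (fun h => ¬ q ∣ h), ‖ee (h * (a / q + β)) - 1‖⁻¹ ≤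
      ∑ h ∈ (Icc 1 H).filter (fun h => ¬ q ∣ h), f (resi q a h) := by
    refine sum_le_sum fun h hh => ?_
    rw [mem_filter, mem_Icc] at hh
    obtain ⟨h0, h1⟩ := resi_mem hq ha hh.2
    have hb : h * |β| ≤ 1 / (4 * q) := by
      refine le_trans ?_ hβ
      have : (h:ℝ) ≤ H := by exact_mod_cast hh.1.2
      gcongr
    have k := ee_pt hq ha hh.2 hb
    have r0 : (0:ℝ) < resi q a h := by exact_mod_cast h0
    have r1 : (0:ℝ) < (q - resi q a h : ℕ) := by exact_mod_cast (by omega : 0 < q - resi q a h)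
    have hm := lt_min r0 r1
    refine (inv_anti₀ (by positivity) k).trans ?_
    rw [mul_inv, inv_div, hf]
    simp only
    gcongr
    rcases min_choice (resi q a h : ℝ) (q - resi q a h : ℕ) with e | e <;> rw [e]
    · exact le_add_of_nonneg_right (by positivity)
    · exact le_add_of_nonneg_left (by positivity)
  refine s1.trans ?_
  have hmap : ∀ h ∈ (Icc 1 H).filter (fun h => ¬ q ∣ h), resi q a h ∈ Ico 1 q := by
    intro h hh
    obtain ⟨h0, h1⟩ := resi_mem hq ha (mem_filter.1 hh).2
    exact mem_Ico.2 ⟨h0, h1⟩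
  rw [← sum_fiberwise_of_maps_to hmap]
  calc _ ≤ ∑ r ∈ Ico 1 q, ((H : ℝ) / q + 1) * f r := by
        refine sum_le_sum fun r _ => ?_
        rw [sum_congr rfl (g := fun _ => f r) (fun h hh => by rw [(mem_filter.1 hh).2]), sum_const, nsmul_eq_mul]
        refine mul_le_mul_of_nonneg_right ?_ (hf0 r)
        rcases (filter (fun h => resi q a h = r) ((Icc 1 H).filter (fun h => ¬ q ∣ h))).eq_empty_or_nonempty with h | ⟨h0, hh0⟩
        · rw [h]; simp; positivity
        · have := (abs_le.1 (card_ap 0 H q h0 hq)).2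
          refine le_trans ?_ (by linarith : ((((Ioc 0 (0 + H)).filter (fun n => n ≡ h0 [MOD q])).card : ℝ)) ≤ H / q + 1)
          gcongr
          intro h hh
          rw [mem_filter, mem_filter, mem_Icc] at hh hh0
          rw [mem_filter, mem_Ioc]
          refine ⟨⟨by omega, by omega⟩, ?_⟩
          have e1 : ((h * a) % (q : ℤ)) = (h0 * a) % (q : ℤ) := by
            rw [← resi_cast hq, ← resi_cast hq, hh.2, hh0.2]
          have e2 : (q : ℤ) ∣ ((h0 : ℤ) - h) * a := by
            have := (Int.ModEq.dvd e1 : (q:ℤ) ∣ h0 * a - h * a)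
            rwa [← sub_mul] at this
          have e3 := ha.symm.dvd_of_dvd_mul_right e2
          exact (Nat.modEq_iff_dvd.2 e3)
    _ = ((H : ℝ) / q + 1) * (q / 2 * (∑ r ∈ Ico 1 q, (r : ℝ)⁻¹ + ∑ r ∈ Ico 1 q, ((q - r : ℕ) : ℝ)⁻¹)) := by
        rw [← mul_sum]; congr 1; rw [hf, ← mul_sum, sum_add_distrib]
    _ = ((H : ℝ) / q + 1) * (q * ∑ r ∈ Ico 1 q, (r : ℝ)⁻¹) := by
        have : ∑ r ∈ Ico 1 q, ((q - r : ℕ) : ℝ)⁻¹ = ∑ r ∈ Ico 1 q, (r : ℝ)⁻¹ := by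
          refine sum_nbij' (fun r => q - r) (fun r => q - r) ?_ ?_ ?_ ?_ ?_
          · intro r; simp only [mem_Ico]; omega
          · intro r; simp only [mem_Ico]; omega
          · intro r; simp only [mem_Ico]; omega
          · intro r; simp only [mem_Ico]; omega
          · intro r _; rfl
        rw [this]; ring
    _ ≤ _ := by
        gcongr
        refine le_trans ?_ (harm_le q)
        exact sum_le_sum_of_subset_of_nonneg (fun r hr => by
          rw [mem_Ico] at hr; rw [mem_Icc]; omega) fun _ _ _ => by positivity

end EE
end PP

namespace PP
section Sel
open ArithmeticFunction

open scoped ArithmeticFunction.Moebius ArithmeticFunction.zeta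

lemma hyper {M : Type*} [AddCommMonoid M] (N : ℕ) (F : ℕ → ℕ → M) :
    ∑ n ∈ Icc 1 N, ∑ d ∈ n.divisors, F d (n / d) = ∑ d ∈ Icc 1 N, ∑ m ∈ Icc 1 (N / d), F d m := by
  rw [sum_sigma', sum_sigma']
  refine sum_nbij' (fun p => ⟨p.2, p.1 / p.2⟩) (fun p => ⟨p.1 * p.2, p.1⟩) ?_ ?_ ?_ ?_ ?_
  · rintro ⟨n, d⟩ h
    simp only [mem_sigma, mem_Icc, Nat.mem_divisors] at h ⊢
    obtain ⟨⟨h1, h2⟩, h3, h4⟩ := h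
    have := Nat.pos_of_dvd_of_pos h3 h1
    have := Nat.le_of_dvd h1 h3
    refine ⟨⟨by omega, by omega⟩, Nat.div_pos this (by omega), Nat.div_le_div_right h2⟩
  · rintro ⟨d, m⟩ h
    simp only [mem_sigma, mem_Icc, Nat.mem_divisors] at h ⊢
    obtain ⟨⟨h1, h2⟩, h3, h4⟩ := h
    have : 0 < d * m := by positivity
    have h5 := Nat.mul_le_of_le_div _ _ _ h4
    refine ⟨⟨this, by rwa [mul_comm]⟩, dvd_mul_right _ _, by omega⟩
  · rintro ⟨n, d⟩ h
    simp only [mem_sigma, mem_Icc, Nat.mem_divisors] at h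
    simp [Nat.mul_div_cancel' h.2.1]
  · rintro ⟨d, m⟩ h
    simp only [mem_sigma, mem_Icc] at h
    simp [Nat.mul_div_cancel_left m (by omega : 0 < d)]
  · rintro ⟨n, d⟩ h; rfl

lemma pmul_deriv (f g : ArithmeticFunction ℝ) :
    (f * g).pmul log = f.pmul log * g + f * g.pmul log := by
  ext n
  simp only [pmul_apply, mul_apply, ArithmeticFunction.add_apply, sum_mul]
  rw [← sum_add_distrib]
  refine sum_congr rfl fun p hp => ?_
  obtain ⟨h1, h2⟩ := Nat.mem_divisorsAntidiagonal.1 hp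
  have h3 : (p.1 : ℝ) ≠ 0 := by
    have := left_ne_zero_of_mul (h1 ▸ h2); exact_mod_cast this
  have h4 : (p.2 : ℝ) ≠ 0 := by
    have := right_ne_zero_of_mul (h1 ▸ h2); exact_mod_cast this
  rw [← h1, log_apply, log_apply, log_apply]
  push_cast
  rw [Real.log_mul h3 h4]; ring

lemma mu_log_sq : ((μ : ArithmeticFunction ℝ).pmul log).pmul log * ζ + pmul Λ log = Λ * Λ := by
  have hz : (ζ : ArithmeticFunction ℝ).pmul log = log := by
    ext n; rcases Nat.eq_zero_or_pos n with rfl | h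
    · simp
    · simp [pmul_apply, natCoe_apply, zeta_apply, h.ne']
  have hmz : (μ : ArithmeticFunction ℝ) * ζ = 1 := coe_moebius_mul_coe_zeta
  have h1 : (1 : ArithmeticFunction ℝ).pmul log = 0 := by
    ext n; by_cases h : n = 1
    · simp [h]
    · simp [pmul_apply, one_apply, h]
  have hd : (μ : ArithmeticFunction ℝ).pmul log = - (μ * Λ) := by
    have := pmul_deriv (μ : ArithmeticFunction ℝ) ζ
    rw [hmz, h1, hz] at this
    have h2 : ((μ : ArithmeticFunction ℝ).pmul log + μ * Λ) * ζ = 0 := by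
      rw [add_mul, mul_assoc, vonMangoldt_mul_zeta]; exact this.symm
    have h3 : ((μ : ArithmeticFunction ℝ).pmul log + μ * Λ) * (ζ * μ) = 0 := by
      rw [← mul_assoc, h2, zero_mul]
    rw [coe_zeta_mul_coe_moebius, mul_one] at h3
    exact eq_neg_of_add_eq_zero_left h3
  have hneg : ∀ f : ArithmeticFunction ℝ, (-f).pmul log = -(f.pmul log) := by
    intro f; ext n; simp [pmul_apply]
  rw [hd, hneg, pmul_deriv, hd, neg_mul, add_mul]
  have : ∀ X : ArithmeticFunction ℝ, (μ : ArithmeticFunction ℝ) * X * ζ = X := by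
    intro X; rw [mul_right_comm, hmz, one_mul]
  rw [this, mul_assoc, neg_mul, mul_assoc, ← mul_assoc, ← mul_assoc, mul_assoc (μ : ArithmeticFunction ℝ), this]
  ring

noncomputable def sel (x : ℝ) (n : ℕ) : ℝ := ∑ d ∈ n.divisors, (μ d : ℝ) * Real.log (x / d) ^ 2

lemma sel_eq {x : ℝ} (hx : 0 < x) {n : ℕ} (hn : 0 < n) : sel x n =
    Λ n * (2 * Real.log x - Real.log n) + ∑ d ∈ n.divisors, Λ d * Λ (n / d) +
      if n = 1 then Real.log x ^ 2 else 0 := by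
  have h1 : ∑ d ∈ n.divisors, (μ d : ℝ) = if n = 1 then 1 else 0 := by
    have := congrArg (fun f => f n) moebius_mul_coe_zeta
    simp only [coe_mul_zeta_apply, one_apply] at this
    exact_mod_cast this
  have h2 : (∑ d ∈ n.divisors, (μ d : ℝ) * Real.log d) = -Λ n := sum_moebius_mul_log_eq
  have h3 : ∑ d ∈ n.divisors, (μ d : ℝ) * Real.log d ^ 2 =
      ∑ d ∈ n.divisors, Λ d * Λ (n / d) - Λ n * Real.log n := by
    have := congrArg (fun f => f n) mu_log_sq
    rw [ArithmeticFunction.add_apply, coe_mul_zeta_apply, mul_apply] at this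
    simp only [pmul_apply] at this
    rw [Nat.sum_divisorsAntidiagonal (fun i j => Λ i * Λ j)] at this
    rw [← log_apply (n := n), ← this, add_sub_cancel_right]
    refine sum_congr rfl fun d _ => ?_
    rw [log_apply, intCoe_apply]; ring
  have e : ∀ d ∈ n.divisors, (μ d : ℝ) * Real.log (x / d) ^ 2 = Real.log x ^ 2 * (μ d : ℝ) -
      2 * Real.log x * ((μ d : ℝ) * Real.log d) + (μ d : ℝ) * Real.log d ^ 2 := by
    intro d hd
    have : (d : ℝ) ≠ 0 := by exact_mod_cast (Nat.pos_of_mem_divisors hd).ne'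
    rw [Real.log_div hx.ne' this]; ring
  rw [sel, sum_congr rfl e, sum_add_distrib, sum_sub_distrib, ← mul_sum, ← mul_sum, h1, h2, h3]
  split_ifs <;> ring

lemma psiN (N : ℕ) : ∑ n ∈ Icc 1 N, Λ n ≤ 6 * N := by
  have := Chebyshev.psi_le_const_mul_self (Nat.cast_nonneg N : (0:ℝ) ≤ N)
  rw [Chebyshev.psi, Nat.floor_natCast] at this
  have h4 : Real.log 4 ≤ 2 := by
    have : Real.log 4 = 2 * Real.log 2 := by
      rw [show (4:ℝ) = 2 ^ 2 by norm_num, Real.log_pow]; norm_num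
    have := Real.log_two_lt_d9
    linarith
  refine le_trans this ?_
  gcongr; linarith

lemma mertens (N : ℕ) (hN : 0 < N) : ∑ n ∈ Icc 1 N, Λ n / n ≤ Real.log N + 6 := by
  have hN0 : (0:ℝ) < N := by exact_mod_cast hN
  have h := hyper N (fun d _ => Λ d)
  simp only [vonMangoldt_sum, sum_const, Nat.card_Icc, Nat.add_sub_cancel, nsmul_eq_mul] at h
  have h1 : ∑ n ∈ Icc 1 N, Real.log n ≤ N * Real.log N := by
    calc _ ≤ ∑ n ∈ Icc 1 N, Real.log N := sum_le_sum fun n hn => by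
          rw [mem_Icc] at hn
          exact Real.log_le_log (by exact_mod_cast hn.1) (by exact_mod_cast hn.2)
      _ = _ := by simp
  have h2 : N * ∑ n ∈ Icc 1 N, Λ n / n - ∑ n ∈ Icc 1 N, Λ n ≤ ∑ d ∈ Icc 1 N, ((N / d : ℕ) : ℝ) * Λ d := by
    rw [mul_sum, ← sum_sub_distrib]
    refine sum_le_sum fun d hd => ?_
    have : (N : ℝ) / d - 1 ≤ (N / d : ℕ) := by
      have := Nat.lt_floor_add_one ((N : ℝ) / d)
      rw [Nat.floor_div_eq_div] at this; linarith
    calc N * (Λ d / d) - Λ d = ((N : ℝ) / d - 1) * Λ d := by ring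
      _ ≤ _ := mul_le_mul_of_nonneg_right this vonMangoldt_nonneg
  have h3 := psiN N
  rw [← mul_le_mul_iff_right₀ hN0]
  linarith

lemma sum_rpow_le (M : ℕ) : ∑ d ∈ Icc 1 M, (d : ℝ) ^ (-(23/24) : ℝ) ≤ 24 * (M : ℝ) ^ (1/24 : ℝ) := by
  induction M with
  | zero => simp
  | succ M ih =>
    rw [sum_Icc_succ_top (by omega)]
    have h0 : (0:ℝ) < (M + 1 : ℕ) := by positivity
    have := rpow_one_add_le_one_add_mul_self (s := -(1 / ((M + 1 : ℕ) : ℝ))) (p := 1/24)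
      (by rw [neg_le_neg_iff, div_le_one h0]; push_cast; linarith [Nat.cast_nonneg (α := ℝ) M]) (by norm_num) (by norm_num)
    have e1 : 1 + -(1 / ((M + 1 : ℕ) : ℝ)) = M / (M + 1 : ℕ) := by field_simp; push_cast; ring
    rw [e1, Real.div_rpow (by positivity) (by positivity), div_le_iff₀ (by positivity)] at this
    have e2 : ((M + 1 : ℕ) : ℝ) ^ (-(23/24) : ℝ) = ((M + 1 : ℕ) : ℝ) ^ (1/24 : ℝ) / (M + 1 : ℕ) := by
      rw [← Real.rpow_sub_one h0.ne']; norm_num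
    rw [e2]
    have e3 : (1 + 1/24 * -(1 / ((M + 1 : ℕ) : ℝ))) * ((M + 1 : ℕ) : ℝ) ^ (1/24 : ℝ) =
      ((M + 1 : ℕ) : ℝ) ^ (1/24 : ℝ) - 1/24 * (((M + 1 : ℕ) : ℝ) ^ (1/24 : ℝ) / (M + 1 : ℕ)) := by ring
    linarith

/-- the universal error-term lemma -/
lemma Lmin {x K : ℝ} (hx : 1 ≤ x) (hK : 1 ≤ K) :
    ∑ d ∈ Icc 1 ⌊x⌋₊, Real.log (x / d) ^ 2 * min (x / d) K ≤ 60000 * x * K ^ (1/12 : ℝ) := by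
  have hx0 : 0 < x := by linarith
  have key : ∀ d ∈ Icc 1 ⌊x⌋₊, Real.log (x / d) ^ 2 * min (x / d) K ≤
      (2304 * x ^ (23/24 : ℝ) * K ^ (1/12 : ℝ)) * (d : ℝ) ^ (-(23/24) : ℝ) := by
    intro d hd
    rw [mem_Icc] at hd
    have hd0 : (0:ℝ) < d := by exact_mod_cast hd.1
    have hdx : (d:ℝ) ≤ x := (Nat.le_floor_iff hx0.le).1 hd.2
    set u := x / d with hu
    have hu1 : 1 ≤ u := (one_le_div hd0).2 hdx
    have hu0 : 0 < u := by linarith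
    have h1 : Real.log u ≤ u ^ (1/48 : ℝ) / (1/48) := Real.log_le_rpow_div hu0.le (by norm_num)
    have h2 : Real.log u ^ 2 ≤ 2304 * u ^ (1/24 : ℝ) := by
      calc Real.log u ^ 2 ≤ (u ^ (1/48 : ℝ) / (1/48)) ^ 2 := pow_le_pow_left₀ (Real.log_nonneg hu1) h1 2
        _ = 2304 * (u ^ (1/48 : ℝ)) ^ 2 := by ring
        _ = _ := by rw [← Real.rpow_natCast (u ^ (1/48 : ℝ)), ← Real.rpow_mul hu0.le]; norm_num
    have hm0 : 0 ≤ min u K := le_min hu0.le (by linarith)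
    have h3 : min u K ≤ u ^ (11/12 : ℝ) * K ^ (1/12 : ℝ) := by
      calc min u K = (min u K) ^ (11/12 : ℝ) * (min u K) ^ (1/12 : ℝ) := by
            rw [← Real.rpow_add_of_nonneg hm0 (by norm_num) (by norm_num)]; norm_num
        _ ≤ _ := by gcongr; exacts [min_le_left _ _, min_le_right _ _]
    calc _ ≤ (2304 * u ^ (1/24 : ℝ)) * (u ^ (11/12 : ℝ) * K ^ (1/12 : ℝ)) := by gcongr
      _ = 2304 * u ^ (23/24 : ℝ) * K ^ (1/12 : ℝ) := by
          have : u ^ (23/24 : ℝ) = u ^ (1/24 : ℝ) * u ^ (11/12 : ℝ) := by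
            rw [← Real.rpow_add hu0]; norm_num
          rw [this]; ring
      _ = _ := by
          rw [hu, Real.div_rpow hx0.le hd0.le, Real.rpow_neg hd0.le]; ring
  refine (sum_le_sum key).trans ?_
  rw [← mul_sum]
  have hM : ((⌊x⌋₊ : ℕ) : ℝ) ^ (1/24 : ℝ) ≤ x ^ (1/24 : ℝ) := by
    gcongr; exact Nat.floor_le hx0.le
  calc _ ≤ (2304 * x ^ (23/24 : ℝ) * K ^ (1/12 : ℝ)) * (24 * x ^ (1/24 : ℝ)) := by
        have := sum_rpow_le ⌊x⌋₊
        gcongr; linarith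
    _ = 2304 * 24 * (x ^ (23/24 : ℝ) * x ^ (1/24 : ℝ)) * K ^ (1/12 : ℝ) := by ring
    _ = 2304 * 24 * x * K ^ (1/12 : ℝ) := by rw [← Real.rpow_add hx0]; norm_num
    _ ≤ _ := by gcongr; norm_num

lemma cop_count (q M : ℕ) (hq : 0 < q) (y : ℝ) (h1 : (M : ℝ) ≤ y) (h2 : y ≤ M + 1) :
    |(((Icc 1 M).filter (fun m => q.Coprime m)).card : ℝ) - q.totient / q * y| ≤ 2 * min y q := by
  have hq0 : (0:ℝ) < q := by exact_mod_cast hq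
  have hy : 0 ≤ y := le_trans (by positivity) h1
  have hφ : (q.totient : ℝ) ≤ q := by exact_mod_cast Nat.totient_le q
  have hφ1 : (q.totient : ℝ) / q ≤ 1 := (div_le_one hq0).2 hφ
  have hc : (((Icc 1 M).filter (fun m => q.Coprime m)).card : ℝ) ≤ y := by
    refine le_trans ?_ h1
    have := card_filter_le (Icc 1 M) (fun m => q.Coprime m)
    rw [Nat.card_Icc] at this
    exact_mod_cast this
  have b1 : |(((Icc 1 M).filter (fun m => q.Coprime m)).card : ℝ) - q.totient / q * y| ≤ y := by
    have : (q.totient : ℝ) / q * y ≤ y := mul_le_of_le_one_left hy hφ1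
    rw [abs_le]; constructor
    · have : (0:ℝ) ≤ (((Icc 1 M).filter (fun m => q.Coprime m)).card : ℝ) := by positivity
      linarith
    · have : 0 ≤ (q.totient : ℝ) / q * y := by positivity
      linarith
  have b2 : |(((Icc 1 M).filter (fun m => q.Coprime m)).card : ℝ) - q.totient / q * M| ≤ q.totient := by
    have hmap : ∀ m ∈ (Icc 1 M).filter (fun m => q.Coprime m), m % q ∈ (range q).filter (fun a => q.Coprime a) := by
      intro m hm
      rw [mem_filter] at hm ⊢
      refine ⟨mem_range.2 (Nat.mod_lt _ hq), ?_⟩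
      have := hm.2
      rw [Nat.Coprime, Nat.gcd_comm, ← Nat.gcd_rec]; exact this
    rw [card_eq_sum_card_fiberwise hmap]
    have e : (q.totient : ℝ) / q * M = ∑ r ∈ (range q).filter (fun a => q.Coprime a), (M : ℝ) / q := by
      rw [sum_const, ← Nat.totient_eq_card_coprime, nsmul_eq_mul]; ring
    have e' : (q.totient : ℝ) = ∑ r ∈ (range q).filter (fun a => q.Coprime a), (1 : ℝ) := by
      rw [sum_const, ← Nat.totient_eq_card_coprime]; simp
    rw [e]
    conv_rhs => rw [e']
    push_cast
    rw [← sum_sub_distrib]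
    refine (abs_sum_le_sum_abs _ _).trans (sum_le_sum fun r hr => ?_)
    have := card_ap 0 M q r hq
    have hset : filter (fun a => a % q = r) ((Icc 1 M).filter (fun m => q.Coprime m)) =
        (Ioc 0 (0 + M)).filter (fun n => n ≡ r [MOD q]) := ?_
    · rw [hset]; exact this
    ext m
    simp only [mem_filter, mem_Icc, mem_Ioc, mem_range] at hr ⊢
    constructor
    · rintro ⟨⟨h, _⟩, h'⟩; exact ⟨⟨by omega, by omega⟩, by rw [Nat.ModEq, h', Nat.mod_eq_of_lt hr.1]⟩
    · rintro ⟨h, h'⟩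
      rw [Nat.ModEq, Nat.mod_eq_of_lt hr.1] at h'
      refine ⟨⟨⟨by omega, by omega⟩, ?_⟩, h'⟩
      have := hr.2
      rw [Nat.Coprime, ← h', Nat.gcd_comm, ← Nat.gcd_rec] at this
      exact this
  have b3 : |(((Icc 1 M).filter (fun m => q.Coprime m)).card : ℝ) - q.totient / q * y| ≤ 2 * q := by
    have : |(q.totient : ℝ) / q * M - q.totient / q * y| ≤ 1 := by
      rw [← mul_sub, abs_mul, abs_of_nonneg (by positivity : (0:ℝ) ≤ (q.totient : ℝ) / q)]
      have : |(M : ℝ) - y| ≤ 1 := by rw [abs_le]; constructor <;> linarith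
      exact mul_le_one₀ hφ1 (abs_nonneg _) this
    have h1q : (1:ℝ) ≤ q := by exact_mod_cast hq
    have := abs_sub_le (((Icc 1 M).filter (fun m => q.Coprime m)).card : ℝ) (q.totient / q * M) (q.totient / q * y)
    linarith
  rw [mul_min_of_nonneg _ _ (by norm_num : (0:ℝ) ≤ 2)]
  exact le_min (by linarith) b3

end Sel
end PP

namespace PP
section TI
open ArithmeticFunction

open scoped ArithmeticFunction.Moebius ArithmeticFunction.zeta

lemma LL_sum (N : ℕ) (hN : 0 < N) : ∑ n ∈ Icc 1 N, ∑ d ∈ n.divisors, Λ d * Λ (n / d) ≤ 6 * N * (Real.log N + 6) := by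
  rw [hyper N (fun d m => Λ d * Λ m)]
  calc _ ≤ ∑ d ∈ Icc 1 N, Λ d * (6 * (N / d)) := sum_le_sum fun d _ => by
        rw [← mul_sum]
        refine mul_le_mul_of_nonneg_left ((psiN _).trans ?_) vonMangoldt_nonneg
        have : ((N / d : ℕ) : ℝ) ≤ N / d := Nat.cast_div_le
        linarith
    _ = 6 * N * ∑ d ∈ Icc 1 N, Λ d / d := by rw [mul_sum]; exact sum_congr rfl fun d _ => by ring
    _ ≤ _ := by gcongr; exact mertens N hN

lemma sel_nonneg {x : ℝ} (hx : 1 ≤ x) {n : ℕ} (hn : n ∈ Icc 1 ⌊x⌋₊) : 0 ≤ sel x n := by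
  rw [mem_Icc] at hn
  have hn0 : (0:ℝ) < n := by exact_mod_cast hn.1
  have hnx : (n:ℝ) ≤ x := (Nat.le_floor_iff (by linarith)).1 hn.2
  rw [sel_eq (by linarith) hn.1]
  have h1 : Real.log n ≤ Real.log x := Real.log_le_log hn0 hnx
  have h2 := Real.log_nonneg hx
  have h3 : 0 ≤ ∑ d ∈ n.divisors, Λ d * Λ (n / d) :=
    sum_nonneg fun d _ => mul_nonneg vonMangoldt_nonneg vonMangoldt_nonneg
  have h4 : 0 ≤ Λ n * (2 * Real.log x - Real.log n) := mul_nonneg vonMangoldt_nonneg (by linarith)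
  have h5 : (0:ℝ) ≤ if n = 1 then Real.log x ^ 2 else 0 := by split_ifs <;> positivity
  linarith

lemma sel_sum {x : ℝ} (hx : 1 ≤ x) : ∑ n ∈ Icc 1 ⌊x⌋₊, sel x n ≤ 36 * x * (1 + Real.log x) := by
  have hx0 : 0 < x := by linarith
  set N := ⌊x⌋₊ with hN
  have hN1 : 1 ≤ N := Nat.le_floor (by simpa using hx)
  have hNx : (N:ℝ) ≤ x := Nat.floor_le hx0.le
  have hl := Real.log_nonneg hx
  have hlN : Real.log N ≤ Real.log x := Real.log_le_log (by exact_mod_cast hN1) hNx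
  have hlN0 : 0 ≤ Real.log N := Real.log_nonneg (by exact_mod_cast hN1)
  have h1 : ∑ n ∈ Icc 1 N, sel x n ≤ ∑ n ∈ Icc 1 N, (Λ n * (2 * Real.log x) +
      ∑ d ∈ n.divisors, Λ d * Λ (n / d) + if n = 1 then Real.log x ^ 2 else 0) := by
    refine sum_le_sum fun n hn => ?_
    rw [mem_Icc] at hn
    rw [sel_eq hx0 hn.1]
    have : 0 ≤ Real.log n := Real.log_nonneg (by exact_mod_cast hn.1)
    gcongr
    linarith
  refine h1.trans ?_
  rw [sum_add_distrib, sum_add_distrib, ← sum_mul, sum_ite_eq' _ 1 (fun _ => Real.log x ^ 2),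
    if_pos (mem_Icc.2 ⟨le_rfl, hN1⟩)]
  have h2 := psiN N
  have h3 := LL_sum N hN1
  have h4 : Real.log x ≤ x := Real.log_le_self hx0.le
  have h5 : 6 * N * (Real.log N + 6) ≤ 6 * x * (Real.log x + 6) := by gcongr
  have h6 : (∑ n ∈ Icc 1 N, Λ n) * (2 * Real.log x) ≤ 6 * x * (2 * Real.log x) := by
    gcongr; linarith
  nlinarith

noncomputable def Mq (q : ℕ) (x : ℝ) : ℝ :=
  ∑ d ∈ (Icc 1 ⌊x⌋₊).filter (fun d => q.Coprime d), (μ d : ℝ) / d * Real.log (x / d) ^ 2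

lemma Mq_le {q : ℕ} (hq : 0 < q) {x : ℝ} (hx : 1 ≤ x) :
    (q.totient : ℝ) / q * |Mq q x| ≤ 36 * (1 + Real.log x) + 120000 * (q : ℝ) ^ (1/12 : ℝ) := by
  have hx0 : 0 < x := by linarith
  set N := ⌊x⌋₊ with hN
  have hNx : (N:ℝ) ≤ x := Nat.floor_le hx0.le
  set F : ℕ → ℕ → ℝ := fun d m => if q.Coprime d ∧ q.Coprime m then (μ d : ℝ) * Real.log (x / d) ^ 2 else 0 with hF
  have e1 : ∑ n ∈ (Icc 1 N).filter (fun d => q.Coprime d), sel x n = ∑ n ∈ Icc 1 N, ∑ d ∈ n.divisors, F d (n / d) := by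
    rw [sum_filter]
    refine sum_congr rfl fun n _ => ?_
    rw [sel]
    have : ∀ d ∈ n.divisors, F d (n / d) = if q.Coprime n then (μ d : ℝ) * Real.log (x / d) ^ 2 else 0 := by
      intro d hd
      have h := Nat.coprime_mul_iff_right (k := q) (m := d) (n := n / d)
      rw [Nat.mul_div_cancel' (Nat.dvd_of_mem_divisors hd)] at h
      simp only [hF, ← h]
    rw [sum_congr rfl this]
    split_ifs <;> simp
  have e2 : ∑ d ∈ Icc 1 N, ∑ m ∈ Icc 1 (N / d), F d m = ∑ d ∈ (Icc 1 N).filter (fun d => q.Coprime d),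
      (μ d : ℝ) * Real.log (x / d) ^ 2 * ((Icc 1 (N / d)).filter (fun m => q.Coprime m)).card := by
    rw [sum_filter]
    refine sum_congr rfl fun d _ => ?_
    simp only [hF]
    by_cases h : q.Coprime d
    · have h' : (q.Coprime d) = True := eq_true h
      simp only [h', true_and, if_true]; rw [← sum_filter, sum_const, nsmul_eq_mul, mul_comm]
    · have h' : (q.Coprime d) = False := eq_false h
      simp only [h', false_and, if_false, sum_const_zero]
  have h0 : 0 ≤ ∑ n ∈ (Icc 1 N).filter (fun d => q.Coprime d), sel x n :=
    sum_nonneg fun n hn => sel_nonneg hx (mem_filter.1 hn).1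
  have h1 : ∑ n ∈ (Icc 1 N).filter (fun d => q.Coprime d), sel x n ≤ 36 * x * (1 + Real.log x) :=
    (sum_le_sum_of_subset_of_nonneg (filter_subset _ _) fun n hn _ => sel_nonneg hx hn).trans (sel_sum hx)
  have h2 : |∑ n ∈ (Icc 1 N).filter (fun d => q.Coprime d), sel x n - (q.totient : ℝ) / q * x * Mq q x|
      ≤ 2 * (60000 * x * (q : ℝ) ^ (1/12 : ℝ)) := by
    rw [e1, hyper, e2, Mq, mul_sum, ← sum_sub_distrib]
    refine (abs_sum_le_sum_abs _ _).trans ?_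
    refine le_trans ?_ (mul_le_mul_of_nonneg_left (Lmin hx (K := q) (by exact_mod_cast hq)) (by norm_num : (0:ℝ) ≤ 2))
    rw [mul_sum]
    refine le_trans (sum_le_sum fun d hd => ?_) (sum_le_sum_of_subset_of_nonneg (filter_subset _ _) fun d hd _ => ?_)
    · rw [mem_filter, mem_Icc] at hd
      have hc := cop_count q (N / d) hq (x / d) (by
        rw [hN, ← Nat.floor_div_natCast]; exact Nat.floor_le (by positivity)) (by
        rw [hN, ← Nat.floor_div_natCast]; exact (Nat.lt_floor_add_one _).le)
      calc _ = |(μ d : ℝ) * Real.log (x / d) ^ 2 * ((((Icc 1 (N / d)).filter (fun m => q.Coprime m)).card : ℝ)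
            - q.totient / q * (x / d))| := by congr 1; ring
        _ = |(μ d : ℝ)| * Real.log (x / d) ^ 2 * |(((Icc 1 (N / d)).filter (fun m => q.Coprime m)).card : ℝ)
            - q.totient / q * (x / d)| := by rw [abs_mul, abs_mul, abs_of_nonneg (sq_nonneg (Real.log _))]
        _ ≤ 1 * Real.log (x / d) ^ 2 * (2 * min (x / d) q) := by
            gcongr; exact mu_le d
        _ = _ := by ring
    · have : 0 ≤ min (x / d) (q:ℝ) := le_min (by positivity) (by positivity)
      positivity
  have h3 : x * ((q.totient : ℝ) / q * |Mq q x|) = |(q.totient : ℝ) / q * x * Mq q x| := by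
    rw [abs_mul, abs_of_nonneg (by positivity : 0 ≤ (q.totient : ℝ) / q * x)]; ring
  have h4 : x * ((q.totient : ℝ) / q * |Mq q x|) ≤ x * (36 * (1 + Real.log x) + 120000 * (q : ℝ) ^ (1/12 : ℝ)) := by
    rw [h3]; rw [abs_le] at h2 ⊢
    constructor <;> linarith
  exact le_of_mul_le_mul_left h4 hx0

lemma riem (N : ℕ) (hN : 0 < N) (β : ℝ) : ∃ I : ℂ, ‖I‖ ≤ 1 ∧ ‖I‖ * (N * |β|) ≤ 1 ∧ ∀ d : ℕ, 0 < d →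
    ‖∑ m ∈ Icc 1 (N / d), ee (m * (d * β)) - ((N / d : ℝ) : ℂ) * I‖ ≤ min (2 * (N / d) : ℝ) (1 + 19 * (N * |β|)) := by
  have hN0 : (0:ℝ) < N := by exact_mod_cast hN
  have triv : ∀ I : ℂ, ‖I‖ ≤ 1 → ∀ d : ℕ, 0 < d →
    ‖∑ m ∈ Icc 1 (N / d), ee (m * (d * β)) - ((N / d : ℝ) : ℂ) * I‖ ≤ 2 * (N / d) := by
    intro I hI d hd
    refine (norm_sub_le _ _).trans ?_
    have h1 : ‖∑ m ∈ Icc 1 (N / d), ee (m * (d * β))‖ ≤ N / d := by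
      refine (norm_sum_le _ _).trans ?_
      simp only [norm_ee]
      simpa using (Nat.cast_div_le : ((N / d : ℕ) : ℝ) ≤ N / d)
    have h2 : ‖((N / d : ℝ) : ℂ) * I‖ ≤ N / d := by
      rw [norm_mul, Complex.norm_real, Real.norm_of_nonneg (by positivity)]
      exact mul_le_of_le_one_right (by positivity) hI
    linarith
  by_cases hβ : β = 0
  · subst hβ
    refine ⟨1, by simp, by simp, fun d hd => le_min (triv 1 (by simp) d hd) ?_⟩
    simp only [mul_zero, ee_zero, mul_one, abs_zero, add_zero, sum_const, Nat.card_Icc, Nat.add_sub_cancel, nsmul_eq_mul]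
    rw [← Complex.ofReal_natCast, ← Complex.ofReal_sub, Complex.norm_real, Real.norm_eq_abs, abs_le]
    have h1 := (Nat.cast_div_le : ((N / d : ℕ) : ℝ) ≤ N / d)
    have h2 := Nat.lt_floor_add_one ((N : ℝ) / d)
    rw [Nat.floor_div_eq_div] at h2
    constructor <;> linarith
  have hπ := Real.pi_gt_three
  have hπ' := Real.pi_lt_d2
  have hb : 0 < |β| := abs_pos.2 hβ
  have nI : ∀ t : ℝ, ‖(Complex.I * (2 * Real.pi * t : ℝ))‖ = 2 * Real.pi * |t| := by
    intro t; rw [norm_mul, Complex.norm_I, Complex.norm_real, Real.norm_eq_abs, abs_mul, abs_of_pos (by positivity)]; ring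
  set I : ℂ := (ee (N * β) - 1) / (Complex.I * (2 * Real.pi * (N * β) : ℝ)) with hI
  have hNb : |(N:ℝ) * β| = N * |β| := by rw [abs_mul, abs_of_pos hN0]
  have hnI : ‖I‖ = ‖ee (N * β) - 1‖ / (2 * Real.pi * (N * |β|)) := by rw [hI, norm_div, nI, hNb]
  have hI1 : ‖I‖ ≤ 1 := by
    rw [hnI, div_le_one (by positivity)]
    have := ee_sub_le (N * β); rwa [hNb] at this
  refine ⟨I, hI1, ?_, fun d hd => le_min (triv I hI1 d hd) ?_⟩
  · rw [hnI]
    have : ‖ee (N * β) - 1‖ ≤ 2 := (norm_sub_le _ _).trans (by rw [norm_ee]; norm_num)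
    rw [div_mul_eq_mul_div, div_le_one (by positivity)]
    nlinarith [mul_pos hN0 hb]
  have hd0 : (0:ℝ) < d := by exact_mod_cast hd
  set γ := d * β with hγ
  have hγ0 : γ ≠ 0 := mul_ne_zero hd0.ne' hβ
  have hγa : 0 < |γ| := abs_pos.2 hγ0
  set w : ℂ := Complex.I * (2 * Real.pi * γ : ℝ) with hw
  have nw : ‖w‖ = 2 * Real.pi * |γ| := nI γ
  have w0 : w ≠ 0 := by rw [← norm_pos_iff, nw]; positivity
  have step : ‖1 - (1 - ee (-γ)) / w‖ ≤ 3 * ‖w‖ := by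
    have e : ee (-γ) = Complex.exp (-w) := by rw [ee, hw]; congr 1; push_cast; ring
    have e2 : 1 - (1 - ee (-γ)) / w = (Complex.exp (-w) - 1 - (-w)) / w := by rw [e]; field_simp; ring
    by_cases h1 : ‖w‖ ≤ 1
    · rw [e2, norm_div, div_le_iff₀ (norm_pos_iff.2 w0)]
      have := Complex.norm_exp_sub_one_sub_id_le (x := -w) (by rwa [norm_neg])
      rw [norm_neg] at this
      nlinarith [sq_nonneg ‖w‖]
    · push Not at h1
      have : ‖(1 - ee (-γ)) / w‖ ≤ 2 := by
        rw [norm_div, div_le_iff₀ (by linarith)]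
        have : ‖1 - ee (-γ)‖ ≤ 2 := (norm_sub_le _ _).trans (by rw [norm_ee]; norm_num)
        linarith
      have := norm_sub_le (1 : ℂ) ((1 - ee (-γ)) / w)
      rw [norm_one] at this; linarith
  have ind : ∀ M : ℕ, ‖∑ m ∈ Icc 1 M, ee (m * γ) - (ee (M * γ) - 1) / w‖ ≤ M * (3 * ‖w‖) := by
    intro M
    induction M with
    | zero => simp [ee_zero]
    | succ M ih =>
      rw [sum_Icc_succ_top (by omega)]
      have e : ∑ m ∈ Icc 1 M, ee (m * γ) + ee ((M + 1 : ℕ) * γ) - (ee ((M + 1 : ℕ) * γ) - 1) / w =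
          (∑ m ∈ Icc 1 M, ee (m * γ) - (ee (M * γ) - 1) / w) + ee ((M + 1 : ℕ) * γ) * (1 - (1 - ee (-γ)) / w) := by
        have : ee (M * γ) = ee ((M + 1 : ℕ) * γ) * ee (-γ) := by rw [← ee_add]; congr 1; push_cast; ring
        rw [this]; ring
      rw [e]
      refine (norm_add_le _ _).trans ?_
      rw [norm_mul, norm_ee, one_mul]
      push_cast; linarith
  have hM := ind (N / d)
  have e3 : ((N / d : ℝ) : ℂ) * I = (ee (N * β) - 1) / w := by
    rw [hI, hw, hγ]; push_cast
    have h1 : (d : ℂ) ≠ 0 := by exact_mod_cast hd0.ne'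
    have h2 : (N : ℂ) ≠ 0 := by exact_mod_cast hN0.ne'
    have h3 : (β : ℂ) ≠ 0 := by exact_mod_cast hβ
    have h4 : (Real.pi : ℂ) ≠ 0 := by exact_mod_cast Real.pi_ne_zero
    field_simp
  have hdm : (N:ℝ) = d * (N / d : ℕ) + (N % d : ℕ) := by exact_mod_cast (Nat.div_add_mod N d).symm
  have hdm2 : ((N % d : ℕ) : ℝ) ≤ d := by exact_mod_cast (Nat.mod_lt N hd).le
  have h5 : ‖(ee ((N / d : ℕ) * γ) - 1) / w - (ee (N * β) - 1) / w‖ ≤ 1 := by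
    rw [← sub_div, norm_div, div_le_one (norm_pos_iff.2 w0), nw, sub_sub_sub_cancel_right, ee_sub_sub]
    refine (ee_sub_le _).trans ?_
    have : (N / d : ℕ) * γ - N * β = -((N % d : ℕ) * β) := by rw [hγ, hdm]; push_cast; ring
    rw [this, abs_neg, abs_mul, hγ, abs_mul, abs_of_nonneg (Nat.cast_nonneg _), abs_of_pos hd0]
    gcongr
  rw [e3]
  have h6 : ((N / d : ℕ) : ℝ) * (3 * ‖w‖) ≤ 19 * (N * |β|) := by
    rw [nw, hγ, abs_mul, abs_of_pos hd0]
    have : ((N / d : ℕ) : ℝ) * d ≤ N := by exact_mod_cast Nat.div_mul_le_self N d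
    calc _ = (((N / d : ℕ) : ℝ) * d) * |β| * (6 * Real.pi) := by ring
      _ ≤ N * |β| * 19 := by gcongr; linarith
      _ = _ := by ring
  have := norm_sub_le_norm_sub_add_norm_sub (∑ m ∈ Icc 1 (N / d), ee (m * γ)) ((ee ((N / d : ℕ) * γ) - 1) / w) ((ee (N * β) - 1) / w)
  linarith

end TI
end PP

namespace PP
section TI2
open ArithmeticFunction

open scoped ArithmeticFunction.Moebius ArithmeticFunction.zeta

lemma rpow_twelfth {c L : ℝ} (hc : 0 ≤ c) (hc2 : c ≤ 4096) (hL : 0 ≤ L) : (c * L ^ 6) ^ (1/12 : ℝ) ≤ 2 * √L := by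
  rw [Real.mul_rpow hc (by positivity), Real.sqrt_eq_rpow, ← Real.rpow_natCast L 6, ← Real.rpow_mul hL]
  have : c ^ (1/12 : ℝ) ≤ 2 := by
    calc c ^ (1/12 : ℝ) ≤ (4096 : ℝ) ^ (1/12 : ℝ) := by gcongr
      _ = ((2:ℝ) ^ (12:ℝ)) ^ (1/12 : ℝ) := by norm_num
      _ = 2 := by rw [← Real.rpow_mul (by norm_num)]; norm_num
  norm_num
  gcongr

set_option maxHeartbeats 2000000 in
lemma T1_le (N q : ℕ) (a : ℤ) (β ι : ℝ) (hL : 1 ≤ Real.log N) (hq : 0 < q) (hqN : q * Real.log N ^ 6 ≤ N)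
    (hβ : |β| * q * N ≤ Real.log N ^ 6) (ha : IsCoprime a (q:ℤ)) (hι : 0 ≤ ι) (hι2 : 1 ≤ ι ∨ 1 ≤ ι * (N * |β|)) :
    ‖∑ n ∈ Icc 1 N, ee (n * (a / q + β)) * (sel N n : ℂ)‖ ≤
      1000000 * (N * √(Real.log N) + N * Real.log N * ι / q.totient) := by
  set L := Real.log N with hLdef
  set θ := (a / q + β : ℝ) with hθ
  have hL0 : 0 < L := by linarith
  have hN : 0 < N := by
    rcases Nat.eq_zero_or_pos N with h | h
    · subst h; simp at hLdef; linarith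
    · exact h
  have hN0 : (0:ℝ) < N := by exact_mod_cast hN
  have hN1 : (1:ℝ) ≤ N := by exact_mod_cast hN
  have hq0 : (0:ℝ) < q := by exact_mod_cast hq
  have hq1 : (1:ℝ) ≤ q := by exact_mod_cast hq
  have hL6 : 1 ≤ L ^ 6 := one_le_pow₀ hL
  have hqN' : (q:ℝ) ≤ N := by nlinarith
  have hlogq : Real.log q ≤ L := Real.log_le_log hq0 hqN'
  have hlogq0 : 0 ≤ Real.log q := Real.log_nonneg hq1
  have hs1 : 1 ≤ √L := by rw [Real.one_le_sqrt]; exact hL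
  set V : ℕ → ℂ := fun d => ∑ m ∈ Icc 1 (N / d), ee (m * (d * θ)) with hV
  set g : ℕ → ℂ := fun d => ((μ d * Real.log (N / d) ^ 2 : ℝ) : ℂ) * V d with hg
  have e1 : ∑ n ∈ Icc 1 N, ee (n * θ) * (sel N n : ℂ) = ∑ d ∈ Icc 1 N, g d := by
    have h := hyper N (fun d m => ((μ d * Real.log (N / d) ^ 2 : ℝ) : ℂ) * ee (m * (d * θ)))
    simp only [← mul_sum] at h
    rw [hg, ← h]
    refine sum_congr rfl fun n _ => ?_
    rw [sel, Complex.ofReal_sum, mul_sum]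
    refine sum_congr rfl fun d hd => ?_
    have : (n:ℝ) = (n / d : ℕ) * d := by exact_mod_cast (Nat.div_mul_cancel (Nat.dvd_of_mem_divisors hd)).symm
    rw [mul_comm]; congr 2; conv_lhs => rw [this]
    ring
  have hlog : ∀ d ∈ Icc 1 N, 0 ≤ Real.log (N / d) ∧ Real.log (N / d) ≤ L := by
    intro d hd
    rw [mem_Icc] at hd
    have hd1 : (1:ℝ) ≤ d := by exact_mod_cast hd.1
    have hdN : (d:ℝ) ≤ N := by exact_mod_cast hd.2
    refine ⟨Real.log_nonneg ((one_le_div (by linarith)).2 hdN), Real.log_le_log (by positivity) (div_le_self hN0.le hd1)⟩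
  have hVt : ∀ d, ‖V d‖ ≤ N / d := by
    intro d
    refine (norm_sum_le _ _).trans ?_
    simp only [norm_ee]
    simpa using (Nat.cast_div_le : ((N / d : ℕ) : ℝ) ≤ N / d)
  have hgn : ∀ d, ‖g d‖ ≤ Real.log (N / d) ^ 2 * ‖V d‖ := by
    intro d
    rw [hg]; simp only []
    rw [norm_mul, Complex.norm_real, Real.norm_eq_abs, abs_mul, abs_of_nonneg (sq_nonneg (Real.log _))]
    gcongr
    exact mul_le_of_le_one_left (sq_nonneg _) (mu_le d)
  -- non-multiples
  set D0 := ⌊N / (4 * L ^ 6)⌋₊ with hD0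
  have hD0le : (D0 : ℝ) ≤ N / (4 * L ^ 6) := Nat.floor_le (by positivity)
  have hDβ : D0 * |β| ≤ 1 / (4 * q) := by
    calc D0 * |β| ≤ N / (4 * L ^ 6) * |β| := by gcongr
      _ = (|β| * q * N) / (4 * q * L ^ 6) := by field_simp
      _ ≤ L ^ 6 / (4 * q * L ^ 6) := by gcongr
      _ = _ := by field_simp
  have hD0N : D0 ≤ N := by
    have : (D0:ℝ) ≤ N := hD0le.trans (div_le_self hN0.le (by linarith))
    exact_mod_cast this
  have hA : ∑ d ∈ (Icc 1 D0).filter (fun d => ¬ q ∣ d), ‖g d‖ ≤ 5 * N := by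
    calc _ ≤ ∑ d ∈ (Icc 1 D0).filter (fun d => ¬ q ∣ d), L ^ 2 * 2 * ‖ee (d * θ) - 1‖⁻¹ := by
          refine sum_le_sum fun d hd => (hgn d).trans ?_
          rw [mem_filter] at hd
          have hd' := hd.1
          rw [mem_Icc] at hd'
          have hl := hlog d (mem_Icc.2 ⟨hd'.1, hd'.2.trans hD0N⟩)
          rw [mul_assoc]
          gcongr
          · exact hl.1
          · exact hl.2
          have hpt := ee_pt2 (h := d) hq ha hd.2 (β := β) (le_trans (by gcongr; exact hd'.2) hDβ)
          have hpos : 0 < ‖ee (d * θ) - 1‖ := lt_of_lt_of_le (by positivity) hpt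
          rw [← div_eq_mul_inv, le_div_iff₀ hpos]
          exact geom_ee 0 (N / d) (d * θ)
      _ = L ^ 2 * 2 * ∑ d ∈ (Icc 1 D0).filter (fun d => ¬ q ∣ d), ‖ee (d * θ) - 1‖⁻¹ := by rw [mul_sum]
      _ ≤ L ^ 2 * 2 * ((D0 / q + 1) * (q * (1 + Real.log q))) := by
          gcongr; exact block hq ha hDβ
      _ = L ^ 2 * 2 * ((D0 + q) * (1 + Real.log q)) := by field_simp
      _ ≤ L ^ 2 * 2 * ((N / (4 * L ^ 6) + N / L ^ 6) * (L + L)) := by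
          gcongr
          rw [le_div_iff₀ (by positivity)]; exact hqN
      _ = 5 * N / L ^ 3 := by field_simp; ring
      _ ≤ 5 * N := div_le_self (by positivity) (one_le_pow₀ hL)
  have hB : ∑ d ∈ (Icc 1 N).filter (fun d => D0 < d), ‖g d‖ ≤ 120000 * N * √L := by
    have h := Lmin hN1 (K := 4 * L ^ 6) (by linarith)
    rw [Nat.floor_natCast] at h
    have h2 := rpow_twelfth (c := 4) (by norm_num) (by norm_num) hL0.le
    calc _ ≤ ∑ d ∈ (Icc 1 N).filter (fun d => D0 < d), Real.log (N / d) ^ 2 * min ((N:ℝ) / d) (4 * L ^ 6) := by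
          refine sum_le_sum fun d hd => (hgn d).trans ?_
          rw [mem_filter] at hd
          gcongr
          refine le_min (hVt d) ((hVt d).trans ?_)
          have : N / (4 * L ^ 6) < d := (Nat.floor_lt (by positivity)).1 hd.2
          have hd0 : (0:ℝ) < d := lt_of_le_of_lt (by positivity) this
          rw [div_lt_iff₀ (by positivity)] at this
          rw [div_le_iff₀ hd0]; linarith
      _ ≤ ∑ d ∈ Icc 1 N, Real.log (N / d) ^ 2 * min ((N:ℝ) / d) (4 * L ^ 6) :=
          sum_le_sum_of_subset_of_nonneg (filter_subset _ _) fun d _ _ =>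
            mul_nonneg (sq_nonneg _) (le_min (by positivity) (by positivity))
      _ ≤ _ := h
      _ ≤ 60000 * N * (2 * √L) := by gcongr
      _ = _ := by ring
  have hAB : ∑ d ∈ (Icc 1 N).filter (fun d => ¬ q ∣ d), ‖g d‖ ≤ 5 * N + 120000 * N * √L := by
    refine le_trans ?_ (add_le_add hA hB)
    rw [← sum_filter_add_sum_filter_not ((Icc 1 N).filter (fun d => ¬ q ∣ d)) (fun d => d ≤ D0)]
    gcongr ?_ + ?_
    · refine sum_le_sum_of_subset_of_nonneg (fun d hd => ?_) fun _ _ _ => norm_nonneg _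
      simp only [mem_filter, mem_Icc] at hd ⊢
      exact ⟨⟨hd.1.1.1, hd.2⟩, hd.1.2⟩
    · refine sum_le_sum_of_subset_of_nonneg (fun d hd => ?_) fun _ _ _ => norm_nonneg _
      simp only [mem_filter, mem_Icc] at hd ⊢
      exact ⟨hd.1.1, by omega⟩
  -- multiples
  have hmul : ∑ d ∈ (Icc 1 N).filter (fun d => q ∣ d), g d = ∑ d ∈ Icc 1 (N / q), g (q * d) := by
    symm
    refine sum_nbij' (fun d => q * d) (fun d => d / q) ?_ ?_ ?_ ?_ ?_
    · intro d hd
      simp only [mem_Icc, mem_filter] at hd ⊢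
      refine ⟨⟨Nat.mul_pos hq hd.1, ?_⟩, dvd_mul_right _ _⟩
      rw [mul_comm]; exact (Nat.le_div_iff_mul_le hq).1 hd.2
    · intro d hd
      simp only [mem_Icc, mem_filter] at hd ⊢
      exact ⟨Nat.div_pos (Nat.le_of_dvd hd.1.1 hd.2) hq, Nat.div_le_div_right hd.1.2⟩
    · intro d _; exact Nat.mul_div_cancel_left d hq
    · intro d hd
      simp only [mem_Icc, mem_filter] at hd
      exact Nat.mul_div_cancel' hd.2
    · intro d _; rfl
  have hxfl : ⌊(N / q : ℝ)⌋₊ = N / q := Nat.floor_div_eq_div N q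
  set x : ℝ := N / q with hx
  have hx0 : 0 < x := by positivity
  have hxL : L ^ 6 ≤ x := by rw [hx, le_div_iff₀ hq0]; linarith
  have hx1 : 1 ≤ x := hL6.trans hxL
  have hxN : x ≤ N := div_le_self hN0.le hq1
  have hφ1 : (1:ℝ) ≤ q.totient := by exact_mod_cast Nat.totient_pos.2 hq
  have hC : ‖∑ d ∈ Icc 1 (N / q), g (q * d)‖ ≤ 500000 * N * √L + 72 * (N * L * ι / q.totient) := by
    have hpn : 0 ≤ N * L * ι / q.totient := by positivity
    by_cases hq6 : L ^ 6 < q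
    · calc ‖∑ d ∈ Icc 1 (N / q), g (q * d)‖ ≤ ∑ d ∈ Icc 1 (N / q), L ^ 2 * x * (d:ℝ)⁻¹ := by
            refine (norm_sum_le _ _).trans (sum_le_sum fun d hd => (hgn _).trans ?_)
            rw [mem_Icc] at hd
            have hl := hlog (q * d) (mem_Icc.2 ⟨Nat.mul_pos hq hd.1, by
              rw [mul_comm]; exact (Nat.le_div_iff_mul_le hq).1 hd.2⟩)
            rw [mul_assoc]
            gcongr
            · exact hl.1
            · exact hl.2
            refine (hVt _).trans (le_of_eq ?_)
            rw [hx]; push_cast; rw [div_mul_eq_div_div, div_eq_mul_inv (_ / _)]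
        _ = L ^ 2 * x * ∑ d ∈ Icc 1 (N / q), (d:ℝ)⁻¹ := by rw [mul_sum]
        _ ≤ L ^ 2 * x * (1 + Real.log (N / q : ℕ)) := by gcongr; exact harm_le _
        _ ≤ L ^ 2 * x * (L + L) := by
            gcongr
            rcases Nat.eq_zero_or_pos (N / q) with h | h
            · rw [h]; simp; exact hL0.le
            · exact Real.log_le_log (by exact_mod_cast h) (by exact_mod_cast Nat.div_le_self N q)
        _ = 2 * N * (L ^ 3 / q) := by rw [hx]; ring
        _ ≤ 2 * N * 1 := by
            gcongr
            rw [div_le_one hq0]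
            have : L ^ 3 ≤ L ^ 6 := pow_le_pow_right₀ hL (by norm_num)
            linarith
        _ ≤ _ := by nlinarith
    push Not at hq6
    obtain ⟨I, hI1, hI2, hI3⟩ := riem N hN β
    have hIι : ‖I‖ ≤ ι := by
      rcases hι2 with h | h
      · linarith
      · have : 0 < N * |β| := by
          by_contra h'
          have : N * |β| = 0 := le_antisymm (not_lt.1 h') (by positivity)
          rw [this] at h; simp at h; linarith
        exact le_of_mul_le_mul_right (hI2.trans h) this
    have hVq : ∀ d, V (q * d) = ∑ m ∈ Icc 1 (N / (q * d)), ee (m * ((q * d : ℕ) * β)) := by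
      intro d
      refine sum_congr rfl fun m _ => ?_
      have : (m * ((q * d : ℕ) * θ) : ℝ) = ((m * d * a : ℤ) : ℝ) + m * ((q * d : ℕ) * β) := by
        rw [hθ]; push_cast; field_simp
      rw [this, ee_add, ee_int, one_mul]
    set err : ℕ → ℂ := fun d => V (q * d) - ((x / d : ℝ) : ℂ) * I with herr
    have hNβ : 1 + 19 * (N * |β|) ≤ 20 * L ^ 6 := by
      have : N * |β| ≤ |β| * q * N := by
        have : 0 ≤ |β| * N := by positivity
        nlinarith
      linarith
    have herr1 : ∀ d ∈ Icc 1 (N / q), ‖err d‖ ≤ 2 * min (x / d) (20 * L ^ 6) := by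
      intro d hd
      rw [mem_Icc] at hd
      have h := hI3 (q * d) (Nat.mul_pos hq hd.1)
      rw [← hVq] at h
      have e : (N / (q * d : ℕ) : ℝ) = x / d := by rw [hx]; push_cast; rw [div_mul_eq_div_div]
      rw [e] at h
      refine h.trans ?_
      rw [mul_min_of_nonneg _ _ (by norm_num : (0:ℝ) ≤ 2)]
      exact min_le_min le_rfl (by nlinarith)
    have hsplit : ∑ d ∈ Icc 1 (N / q), g (q * d) =
        (((μ q : ℝ) * x * Mq q x : ℝ) : ℂ) * I + ∑ d ∈ Icc 1 (N / q), ((μ (q * d) * Real.log (x / d) ^ 2 : ℝ) : ℂ) * err d := by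
      rw [Mq, hxfl, sum_filter, mul_sum, Complex.ofReal_sum, sum_mul, ← sum_add_distrib]
      refine sum_congr rfl fun d hd => ?_
      rw [mem_Icc] at hd
      have hd0 : (d:ℝ) ≠ 0 := by exact_mod_cast (by omega : d ≠ 0)
      have e : (N / (q * d : ℕ) : ℝ) = x / d := by rw [hx]; push_cast; rw [div_mul_eq_div_div]
      have e2 : ((μ (q * d) : ℤ) : ℝ) = if q.Coprime d then (μ q : ℝ) * μ d else 0 := by
        split_ifs with h
        · rw [isMultiplicative_moebius.map_mul_of_coprime h]; push_cast; rfl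
        · rw [moebius_eq_zero_of_not_squarefree]; · simp
          intro hs; exact h (Nat.coprime_of_squarefree_mul hs)
      have e3 : g (q * d) = ((μ (q * d) * Real.log (x / d) ^ 2 : ℝ) : ℂ) * V (q * d) := by
        simp only [hg]; rw [e]
      have e4 : V (q * d) = err d + ((x / d : ℝ) : ℂ) * I := by simp only [herr]; ring
      rw [e3, e4, mul_add, add_comm]
      congr 1
      rw [← mul_assoc, ← Complex.ofReal_mul, e2]
      congr 2
      split_ifs
      · field_simp
      · simp
    rw [hsplit]
    refine (norm_add_le _ _).trans ?_
    have hE : ‖∑ d ∈ Icc 1 (N / q), ((μ (q * d) * Real.log (x / d) ^ 2 : ℝ) : ℂ) * err d‖ ≤ 240000 * N * √L := by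
      have h := Lmin hx1 (K := 20 * L ^ 6) (by linarith)
      rw [hxfl] at h
      have h2 := rpow_twelfth (c := 20) (by norm_num) (by norm_num) hL0.le
      calc _ ≤ ∑ d ∈ Icc 1 (N / q), 2 * (Real.log (x / d) ^ 2 * min (x / d) (20 * L ^ 6)) := by
            refine (norm_sum_le _ _).trans (sum_le_sum fun d hd => ?_)
            rw [norm_mul, Complex.norm_real, Real.norm_eq_abs, abs_mul, abs_of_nonneg (sq_nonneg (Real.log _))]
            calc _ ≤ 1 * Real.log (x / d) ^ 2 * (2 * min (x / d) (20 * L ^ 6)) := by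
                  gcongr; exacts [mu_le _, herr1 d hd]
              _ = _ := by ring
        _ ≤ 2 * (60000 * x * (20 * L ^ 6) ^ (1/12 : ℝ)) := by rw [← mul_sum]; gcongr
        _ ≤ 2 * (60000 * N * (2 * √L)) := by gcongr
        _ = _ := by ring
    have hMM : ‖(((μ q : ℝ) * x * Mq q x : ℝ) : ℂ) * I‖ ≤ 240000 * N * √L + 72 * (N * L * ι / q.totient) := by
      have h := Mq_le hq hx1
      have hlx : Real.log x ≤ L := Real.log_le_log hx0 hxN
      have hq12 : (q:ℝ) ^ (1/12 : ℝ) ≤ 2 * √L := by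
        have := rpow_twelfth (c := 1) (by norm_num) (by norm_num) hL0.le
        rw [one_mul] at this
        exact le_trans (by gcongr) this
      have h2 : x * |Mq q x| ≤ N / q.totient * (72 * L + 240000 * √L) := by
        have : x * |Mq q x| = N / q.totient * (q.totient / q * |Mq q x|) := by rw [hx]; field_simp
        rw [this]; gcongr; linarith
      rw [norm_mul, Complex.norm_real, Real.norm_eq_abs, abs_mul, abs_mul, abs_of_pos hx0]
      calc _ ≤ 1 * x * |Mq q x| * ‖I‖ := by gcongr; exact mu_le _
        _ = (x * |Mq q x|) * ‖I‖ := by ring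
        _ ≤ (N / q.totient * (72 * L + 240000 * √L)) * ‖I‖ := by gcongr
        _ = 72 * (N * L * ‖I‖ / q.totient) + 240000 * N * √L * (‖I‖ / q.totient) := by ring
        _ ≤ 72 * (N * L * ι / q.totient) + 240000 * N * √L * 1 := by
            gcongr
            exact div_le_one_of_le₀ (by linarith) (by positivity)
        _ = _ := by ring
    nlinarith [mul_nonneg hN0.le (Real.sqrt_nonneg L)]
  rw [e1, ← sum_filter_add_sum_filter_not (Icc 1 N) (fun d => q ∣ d), hmul]
  have h1 := norm_add_le (∑ d ∈ Icc 1 (N / q), g (q * d)) (∑ d ∈ (Icc 1 N).filter (fun d => ¬ q ∣ d), g d)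
  have h2 := norm_sum_le ((Icc 1 N).filter (fun d => ¬ q ∣ d)) g
  have hpn : 0 ≤ N * L * ι / q.totient := by positivity
  nlinarith [mul_le_mul_of_nonneg_left hs1 hN0.le]

end TI2
end PP

namespace PP
section Bil
open ArithmeticFunction

open scoped ArithmeticFunction.Moebius ArithmeticFunction.zeta

noncomputable def FF (θ : ℝ) (N a : ℕ) : ℂ := ∑ b ∈ Icc 1 (N / a), (Λ b : ℂ) * ee (a * (b * θ))

lemma FF_le (θ : ℝ) (N a : ℕ) : ‖FF θ N a‖ ≤ 6 * (N / a : ℕ) := by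
  refine (norm_sum_le _ _).trans (le_trans (le_of_eq ?_) (psiN _))
  refine sum_congr rfl fun b _ => ?_
  rw [norm_mul, norm_ee, mul_one, Complex.norm_real, Real.norm_of_nonneg vonMangoldt_nonneg]

lemma disp (θ : ℝ) (N B : ℕ) (hB : 0 < B) (K : ℕ → ℕ → ℝ)
    (hK : ∀ b1 ∈ Icc 1 (N / B), ∀ b2 ∈ Icc 1 (N / B), ∀ c ≤ 4 * B,
      ‖∑ a ∈ Ioc B c, ee (a * (((b1:ℝ) - b2) * θ))‖ ≤ K b1 b2) :
    ∑ a ∈ Ioc B (4 * B), ‖FF θ N a‖ ^ 2 ≤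
      ∑ b1 ∈ Icc 1 (N / B), ∑ b2 ∈ Icc 1 (N / B), Λ b1 * Λ b2 * K b1 b2 := by
  set Y := N / B with hY
  have e1 : ∀ a ∈ Ioc B (4 * B), ((‖FF θ N a‖ ^ 2 : ℝ) : ℂ) = ∑ b1 ∈ Icc 1 Y, ∑ b2 ∈ Icc 1 Y,
      if a * max b1 b2 ≤ N then (Λ b1 : ℂ) * Λ b2 * ee (a * (((b1:ℝ) - b2) * θ)) else 0 := by
    intro a ha
    rw [mem_Ioc] at ha
    have ha0 : 0 < a := by omega
    have hF : FF θ N a = ∑ b ∈ Icc 1 Y, if a * b ≤ N then (Λ b : ℂ) * ee (a * (b * θ)) else 0 := by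
      rw [FF, ← sum_filter]
      refine sum_congr ?_ fun _ _ => rfl
      ext b
      simp only [mem_Icc, mem_filter]
      rw [Nat.le_div_iff_mul_le ha0, mul_comm b a]
      constructor
      · rintro ⟨h1, h2⟩
        refine ⟨⟨h1, ?_⟩, h2⟩
        rw [hY, Nat.le_div_iff_mul_le hB]
        nlinarith [Nat.mul_le_mul_right b ha.1.le]
      · rintro ⟨⟨h1, _⟩, h2⟩; exact ⟨h1, h2⟩
    rw [Complex.ofReal_pow, ← Complex.mul_conj', hF, map_sum, sum_mul_sum]
    refine sum_congr rfl fun b1 _ => sum_congr rfl fun b2 _ => ?_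
    have hm : a * max b1 b2 ≤ N ↔ a * b1 ≤ N ∧ a * b2 ≤ N := by
      rcases le_total b1 b2 with h | h
      · rw [max_eq_right h]; exact ⟨fun h' => ⟨(Nat.mul_le_mul_left a h).trans h', h'⟩, fun h' => h'.2⟩
      · rw [max_eq_left h]; exact ⟨fun h' => ⟨h', (Nat.mul_le_mul_left a h).trans h'⟩, fun h' => h'.1⟩
    have hc : ee (a * (((b1:ℝ) - b2) * θ)) = ee (a * (b1 * θ)) * (starRingEnd ℂ) (ee (a * (b2 * θ))) := by
      rw [← ee_neg, ← ee_add]; congr 1; ring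
    rw [hc]
    by_cases h1 : a * b1 ≤ N <;> by_cases h2 : a * b2 ≤ N <;> simp [hm, h1, h2]
    ring
  have e2 : ((∑ a ∈ Ioc B (4 * B), ‖FF θ N a‖ ^ 2 : ℝ) : ℂ) = ∑ b1 ∈ Icc 1 Y, ∑ b2 ∈ Icc 1 Y,
      (Λ b1 : ℂ) * Λ b2 * ∑ a ∈ Ioc B (min (4 * B) (N / max b1 b2)), ee (a * (((b1:ℝ) - b2) * θ)) := by
    rw [Complex.ofReal_sum, sum_congr rfl e1, sum_comm]
    refine sum_congr rfl fun b1 hb1 => ?_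
    rw [sum_comm]
    refine sum_congr rfl fun b2 hb2 => ?_
    rw [mem_Icc] at hb1 hb2
    rw [← sum_filter, mul_sum]
    refine sum_congr ?_ fun _ _ => rfl
    ext a
    have : 0 < max b1 b2 := by omega
    simp only [mem_filter, mem_Ioc, le_min_iff, Nat.le_div_iff_mul_le this]
    tauto
  have e3 : ∑ a ∈ Ioc B (4 * B), ‖FF θ N a‖ ^ 2 = ‖((∑ a ∈ Ioc B (4 * B), ‖FF θ N a‖ ^ 2 : ℝ) : ℂ)‖ := by
    rw [Complex.norm_real, Real.norm_of_nonneg (sum_nonneg fun _ _ => sq_nonneg _)]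
  rw [e3, e2]
  refine (norm_sum_le _ _).trans (sum_le_sum fun b1 hb1 => (norm_sum_le _ _).trans (sum_le_sum fun b2 hb2 => ?_))
  rw [norm_mul, norm_mul, Complex.norm_real, Complex.norm_real, Real.norm_of_nonneg vonMangoldt_nonneg,
    Real.norm_of_nonneg vonMangoldt_nonneg]
  exact mul_le_mul_of_nonneg_left (hK b1 hb1 b2 hb2 _ (min_le_left _ _)) (mul_nonneg vonMangoldt_nonneg vonMangoldt_nonneg)

lemma slide (B q h : ℕ) (hqh : q * h ≤ B) (u : ℕ → ℝ) (hu : ∀ a, 0 ≤ u a) (S Δ : ℝ) (hΔ : 0 ≤ Δ)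
    (hS : ∀ a ∈ Ioc B (4 * B), ∑ j ∈ range h, Λ (a + q * j) ≤ S)
    (hd : ∀ a ∈ Ioc B (4 * B), ∀ j < h, u (a + q * j) ≤ u a + Δ) :
    h * ∑ a ∈ Ioc (2 * B) (4 * B), Λ a * u a ≤ S * (∑ a ∈ Ioc B (4 * B), u a + 3 * B * Δ) := by
  have h1 : ∀ j ∈ range h, ∑ a ∈ Ioc (2 * B) (4 * B), Λ a * u a ≤ ∑ a ∈ Ioc B (4 * B), Λ (a + q * j) * (u a + Δ) := by
    intro j hj
    rw [mem_range] at hj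
    have hqj : q * j ≤ B := (Nat.mul_le_mul_left q hj.le).trans hqh
    calc ∑ a ∈ Ioc (2 * B) (4 * B), Λ a * u a = ∑ a ∈ Ioc (2 * B - q * j) (4 * B - q * j), Λ (a + q * j) * u (a + q * j) := by
          rw [← sum_image (s := Ioc (2 * B - q * j) (4 * B - q * j)) (g := fun a => a + q * j) (f := fun a => Λ a * u a)
            (fun x _ y _ hxy => by simpa using hxy), image_add_right_Ioc]
          congr 2 <;> omega
      _ ≤ ∑ a ∈ Ioc (2 * B - q * j) (4 * B - q * j), Λ (a + q * j) * (u a + Δ) := by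
          refine sum_le_sum fun a ha => mul_le_mul_of_nonneg_left (hd a ?_ j hj) vonMangoldt_nonneg
          rw [mem_Ioc] at ha ⊢; omega
      _ ≤ _ := by
          refine sum_le_sum_of_subset_of_nonneg (fun a ha => ?_) fun a _ _ => mul_nonneg vonMangoldt_nonneg (add_nonneg (hu a) hΔ)
          rw [mem_Ioc] at ha ⊢; omega
  calc h * ∑ a ∈ Ioc (2 * B) (4 * B), Λ a * u a = ∑ j ∈ range h, ∑ a ∈ Ioc (2 * B) (4 * B), Λ a * u a := by simp
    _ ≤ ∑ j ∈ range h, ∑ a ∈ Ioc B (4 * B), Λ (a + q * j) * (u a + Δ) := sum_le_sum h1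
    _ = ∑ a ∈ Ioc B (4 * B), (∑ j ∈ range h, Λ (a + q * j)) * (u a + Δ) := by rw [sum_comm]; simp only [sum_mul]
    _ ≤ ∑ a ∈ Ioc B (4 * B), S * (u a + Δ) := sum_le_sum fun a ha =>
        mul_le_mul_of_nonneg_right (hS a ha) (add_nonneg (hu a) hΔ)
    _ = _ := by
        rw [← mul_sum, sum_add_distrib, sum_const, Nat.card_Ioc, nsmul_eq_mul,
          show 4 * B - B = 3 * B by omega]; push_cast; ring

lemma fdiff (N B q W j a : ℕ) (A : ℤ) (β : ℝ) (hq : 0 < q) (hB : 0 < B) (ha : B < a) (hj : q * j ≤ W) :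
    ‖FF (A / q + β) N (a + q * j)‖ ≤ ‖FF (A / q + β) N a‖ +
      (2 * Real.pi * (W * (N / B : ℕ) * |β|) * (6 * (N / B : ℕ)) + Real.log N * (N * W / B ^ 2 + 1)) := by
  set θ := (A / q + β : ℝ) with hθ
  set Y := N / B with hY
  set a2 := a + q * j with ha2
  have hq0 : (0:ℝ) < q := by exact_mod_cast hq
  have hB0 : (0:ℝ) < B := by exact_mod_cast hB
  have haB : (B:ℝ) < a := by exact_mod_cast ha
  have ha0 : 0 < a := by omega
  have haa : a ≤ a2 := by omega
  have hYY : N / a2 ≤ N / a := Nat.div_le_div_left haa ha0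
  have hYY2 : N / a2 ≤ Y := Nat.div_le_div_left (by omega) hB
  have e : FF θ N a2 = FF θ N a + (∑ b ∈ Icc 1 (N / a2), (Λ b : ℂ) * (ee (a2 * (b * θ)) - ee (a * (b * θ)))
      - ∑ b ∈ Ioc (N / a2) (N / a), (Λ b : ℂ) * ee (a * (b * θ))) := by
    have hs : FF θ N a = ∑ b ∈ Icc 1 (N / a2), (Λ b : ℂ) * ee (a * (b * θ)) +
        ∑ b ∈ Ioc (N / a2) (N / a), (Λ b : ℂ) * ee (a * (b * θ)) := by
      rw [FF]
      exact (sum_Ioc_consecutive (fun b : ℕ => (Λ b : ℂ) * ee (a * (b * θ))) (Nat.zero_le (N / a2)) hYY).symm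
    rw [hs, FF]; simp only [mul_sub, sum_sub_distrib]; ring
  rw [e]
  refine (norm_add_le _ _).trans ?_
  gcongr
  refine (norm_sub_le _ _).trans ?_
  gcongr
  · calc _ ≤ ∑ b ∈ Icc 1 (N / a2), 2 * Real.pi * (W * Y * |β|) * Λ b := by
          refine (norm_sum_le _ _).trans (sum_le_sum fun b hb => ?_)
          rw [mem_Icc] at hb
          rw [norm_mul, Complex.norm_real, Real.norm_of_nonneg vonMangoldt_nonneg, mul_comm]
          refine mul_le_mul_of_nonneg_right ?_ vonMangoldt_nonneg
          rw [ee_sub_sub]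
          have h1 : (a2 * (b * θ) - a * (b * θ) : ℝ) = ((j * b * A : ℤ) : ℝ) + q * j * b * β := by
            rw [ha2, hθ]; push_cast; field_simp; ring
          rw [h1, ee_add, ee_int, one_mul]
          refine (ee_sub_le _).trans ?_
          rw [abs_mul, abs_of_nonneg (by positivity : (0:ℝ) ≤ q * j * b)]
          have h2 : (q:ℝ) * j ≤ W := by exact_mod_cast hj
          have h3 : (b:ℝ) ≤ Y := by exact_mod_cast hb.2.trans hYY2
          gcongr
      _ = 2 * Real.pi * (W * Y * |β|) * ∑ b ∈ Icc 1 (N / a2), Λ b := by rw [mul_sum]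
      _ ≤ 2 * Real.pi * (W * Y * |β|) * (6 * Y) := by
          gcongr
          refine (psiN _).trans ?_
          gcongr
  · calc _ ≤ ∑ b ∈ Ioc (N / a2) (N / a), Real.log N := by
          refine (norm_sum_le _ _).trans (sum_le_sum fun b hb => ?_)
          rw [mem_Ioc] at hb
          rw [norm_mul, norm_ee, mul_one, Complex.norm_real, Real.norm_of_nonneg vonMangoldt_nonneg]
          refine vonMangoldt_le_log.trans (Real.log_le_log ?_ ?_)
          · exact_mod_cast (lt_of_le_of_lt (Nat.zero_le _) hb.1 : 0 < b)
          · exact_mod_cast hb.2.trans (Nat.div_le_self N a)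
      _ = Real.log N * ((N / a : ℕ) - (N / a2 : ℕ)) := by
          rw [sum_const, Nat.card_Ioc, nsmul_eq_mul, Nat.cast_sub hYY, mul_comm]
      _ ≤ _ := by
          have hlog : 0 ≤ Real.log N := Real.log_natCast_nonneg N
          gcongr
          have h1 : ((N / a : ℕ) : ℝ) ≤ N / a := Nat.cast_div_le
          have h2 := Nat.lt_floor_add_one ((N : ℝ) / a2)
          rw [Nat.floor_div_eq_div] at h2
          have ha20 : (B:ℝ) ≤ a2 := by exact_mod_cast (by omega : B ≤ a2)
          have hr : (0:ℝ) < a := by linarith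
          have hr2 : (0:ℝ) < a2 := by linarith
          have h3 : (N : ℝ) / a - N / a2 ≤ N * W / B ^ 2 := by
            have h4 : (N : ℝ) / a - N / a2 = N * (a2 - a : ℝ) / (a * a2) := by field_simp
            have h5 : (a2 - a : ℝ) ≤ W := by
              rw [ha2]; push_cast
              have h2 : (q:ℝ) * j ≤ W := by exact_mod_cast hj
              linarith
            have h6 : (0:ℝ) ≤ a2 - a := by
              have : (a:ℝ) ≤ a2 := by exact_mod_cast haa
              linarith
            rw [h4, sq]
            gcongr
          linarith

lemma card_le_phi (s : Finset ℕ) (hs : ∀ p ∈ s, 2 ≤ p) : (∏ p ∈ s, (1 - (p:ℝ)⁻¹))⁻¹ ≤ s.card + 1 := by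
  induction s using Finset.induction_on_max with
  | empty => simp
  | insert m s hm ih =>
    have hms : m ∉ s := fun h => (hm m h).false
    rw [prod_insert hms, card_insert_of_notMem hms, mul_inv]
    have ih' := ih fun p hp => hs p (mem_insert_of_mem hp)
    have hm2 : 2 ≤ m := hs m (mem_insert_self _ _)
    have hcard : s.card + 2 ≤ m := by
      have : s ⊆ Ico 2 m := fun p hp => mem_Ico.2 ⟨hs p (mem_insert_of_mem hp), hm p hp⟩
      have := card_le_card this
      rw [Nat.card_Ico] at this; omega
    have hc : (s.card : ℝ) + 2 ≤ m := by exact_mod_cast hcard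
    have hk : (0:ℝ) ≤ s.card := by positivity
    have h1 : (1 - (m:ℝ)⁻¹)⁻¹ ≤ (s.card + 2) / (s.card + 1) := by
      rw [inv_le_comm₀ (by rw [sub_pos]; exact inv_lt_one_of_one_lt₀ (by linarith)) (by positivity), inv_div]
      have : (m:ℝ)⁻¹ ≤ (s.card + 2 : ℝ)⁻¹ := inv_anti₀ (by positivity) hc
      have e : (s.card + 1 : ℝ) / (s.card + 2) = 1 - (s.card + 2 : ℝ)⁻¹ := by field_simp; ring
      rw [e]; linarith
    have h2 : 0 ≤ (∏ p ∈ s, (1 - (p:ℝ)⁻¹))⁻¹ := inv_nonneg.2 (prod_nonneg fun p hp => by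
      rw [sub_nonneg]; exact inv_le_one_of_one_le₀ (by
        have := hs p (mem_insert_of_mem hp)
        exact_mod_cast (by omega : 1 ≤ p)))
    calc _ ≤ ((s.card + 2) / (s.card + 1) : ℝ) * (s.card + 1) := by gcongr
      _ = _ := by field_simp; push_cast; ring

lemma qphi (q : ℕ) (hq : 0 < q) : (q : ℝ) / q.totient ≤ 25 * (q:ℝ) ^ (1/16 : ℝ) := by
  have hq0 : (0:ℝ) < q := by exact_mod_cast hq
  have hq1 : (1:ℝ) ≤ q := by exact_mod_cast hq
  have h1 : (q:ℝ) / q.totient = (∏ p ∈ q.primeFactors, (1 - (p:ℝ)⁻¹))⁻¹ := by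
    have := Nat.totient_eq_mul_prod_factors q
    have h : (q.totient : ℝ) = q * ∏ p ∈ q.primeFactors, (1 - (p:ℝ)⁻¹) := by
      have h' := congrArg (fun x : ℚ => (x:ℝ)) this
      push_cast at h'; exact h'
    rw [h, div_mul_eq_div_div, div_self hq0.ne', one_div]
  rw [h1]
  refine (card_le_phi _ fun p hp => (Nat.prime_of_mem_primeFactors hp).two_le).trans ?_
  have h2 : 2 ^ q.primeFactors.card ≤ q := by
    calc 2 ^ q.primeFactors.card ≤ ∏ p ∈ q.primeFactors, p :=
          pow_card_le_prod _ _ _ fun p hp => (Nat.prime_of_mem_primeFactors hp).two_le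
      _ ≤ q := Nat.le_of_dvd hq (Nat.prod_primeFactors_dvd q)
  have h3 : (q.primeFactors.card : ℝ) * Real.log 2 ≤ Real.log q := by
    rw [← Real.log_pow]
    exact Real.log_le_log (by positivity) (by exact_mod_cast h2)
  have h4 : Real.log q ≤ (q:ℝ) ^ (1/16 : ℝ) / (1/16) := Real.log_le_rpow_div hq0.le (by norm_num)
  have h5 := Real.log_two_gt_d9
  have h6 : 1 ≤ (q:ℝ) ^ (1/16 : ℝ) := Real.one_le_rpow hq1 (by norm_num)
  have : (q.primeFactors.card : ℝ) * 0.69 ≤ 16 * (q:ℝ) ^ (1/16 : ℝ) := by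
    have : (0:ℝ) ≤ q.primeFactors.card := by positivity
    nlinarith
  linarith

lemma hyperb (θ : ℝ) (N s : ℕ) (hs1 : s * s ≤ N) (hs2 : N < (s + 1) * (s + 1)) :
    ‖∑ n ∈ Icc 1 N, ee (n * θ) * ((∑ d ∈ n.divisors, Λ d * Λ (n / d) : ℝ) : ℂ)‖ ≤
      2 * ∑ a ∈ Icc 1 s, Λ a * ‖FF θ N a‖ + 36 * N := by
  set f : ℕ → ℕ → ℂ := fun a b => (Λ a : ℂ) * ((Λ b : ℂ) * ee (a * (b * θ))) with hf
  have hsym : ∀ a b, f a b = f b a := by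
    intro a b; simp only [hf]
    rw [show (a * (b * θ) : ℝ) = b * (a * θ) by ring]; ring
  have e1 : ∑ n ∈ Icc 1 N, ee (n * θ) * ((∑ d ∈ n.divisors, Λ d * Λ (n / d) : ℝ) : ℂ) =
      ∑ a ∈ Icc 1 N, ∑ b ∈ Icc 1 (N / a), f a b := by
    rw [← hyper N f]
    refine sum_congr rfl fun n _ => ?_
    rw [Complex.ofReal_sum, mul_sum]
    refine sum_congr rfl fun d hd => ?_
    have : (n:ℝ) = d * (n / d : ℕ) := by exact_mod_cast (Nat.mul_div_cancel' (Nat.dvd_of_mem_divisors hd)).symm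
    simp only [hf]
    conv_lhs => rw [this]
    push_cast; rw [mul_assoc]; ring
  have hsN : s ≤ N := by
    rcases Nat.eq_zero_or_pos s with h | h
    · omega
    · nlinarith
  have e2 : ∑ a ∈ Icc 1 N, ∑ b ∈ Icc 1 (N / a), f a b = ∑ a ∈ Icc 1 s, ∑ b ∈ Icc 1 (N / a), f a b +
      ∑ b ∈ Icc 1 s, ∑ a ∈ Ioc s (N / b), f a b := by
    have h1 : ∑ a ∈ Icc 1 N, ∑ b ∈ Icc 1 (N / a), f a b = ∑ a ∈ Icc 1 s, ∑ b ∈ Icc 1 (N / a), f a b +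
        ∑ a ∈ Ioc s N, ∑ b ∈ Icc 1 (N / a), f a b :=
      (sum_Ioc_consecutive (fun a : ℕ => ∑ b ∈ Icc 1 (N / a), f a b) (Nat.zero_le s) hsN).symm
    rw [h1]
    congr 1
    refine sum_comm' fun a b => ?_
    simp only [mem_Ioc, mem_Icc]
    constructor
    · rintro ⟨⟨h1, h2⟩, h3, h4⟩
      rw [Nat.le_div_iff_mul_le (by omega)] at h4
      refine ⟨⟨h1, ?_⟩, h3, ?_⟩
      · rw [Nat.le_div_iff_mul_le (by omega), mul_comm]; exact h4
      · by_contra hc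
        push Not at hc
        have : (s + 1) * (s + 1) ≤ b * a := Nat.mul_le_mul hc h1
        omega
    · rintro ⟨⟨h1, h2⟩, h3, h4⟩
      rw [Nat.le_div_iff_mul_le (by omega)] at h2
      have : a ≤ N := by nlinarith
      exact ⟨⟨h1, this⟩, h3, by rw [Nat.le_div_iff_mul_le (by omega), mul_comm]; exact h2⟩
  have e3 : ∀ b ∈ Icc 1 s, ∑ a ∈ Ioc s (N / b), f a b = (Λ b : ℂ) * FF θ N b - ∑ a ∈ Icc 1 s, f a b := by
    intro b hb
    rw [mem_Icc] at hb
    have hsb : s ≤ N / b := by rw [Nat.le_div_iff_mul_le (by omega)]; nlinarith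
    have h1 : ∑ a ∈ Icc 1 (N / b), f a b = ∑ a ∈ Icc 1 s, f a b + ∑ a ∈ Ioc s (N / b), f a b :=
      (sum_Ioc_consecutive (fun a : ℕ => f a b) (Nat.zero_le s) hsb).symm
    have h2 : ∑ a ∈ Icc 1 (N / b), f a b = (Λ b : ℂ) * FF θ N b := by
      rw [FF, mul_sum]; exact sum_congr rfl fun a _ => hsym a b
    rw [← h2, h1]; ring
  have e4 : ∀ a, ∑ b ∈ Icc 1 (N / a), f a b = (Λ a : ℂ) * FF θ N a := fun a => by rw [FF, mul_sum]
  rw [e1, e2, sum_congr rfl e3, sum_congr rfl fun a _ => e4 a, sum_sub_distrib]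
  have n1 : ‖∑ a ∈ Icc 1 s, (Λ a : ℂ) * FF θ N a‖ ≤ ∑ a ∈ Icc 1 s, Λ a * ‖FF θ N a‖ := by
    refine (norm_sum_le _ _).trans (le_of_eq (sum_congr rfl fun a _ => ?_))
    rw [norm_mul, Complex.norm_real, Real.norm_of_nonneg vonMangoldt_nonneg]
  have n2 : ‖∑ b ∈ Icc 1 s, ∑ a ∈ Icc 1 s, f a b‖ ≤ 36 * N := by
    calc _ ≤ ∑ b ∈ Icc 1 s, ∑ a ∈ Icc 1 s, Λ b * Λ a := by
          refine (norm_sum_le _ _).trans (sum_le_sum fun b _ => (norm_sum_le _ _).trans (sum_le_sum fun a _ => ?_))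
          simp only [hf]
          rw [norm_mul, norm_mul, norm_ee, Complex.norm_real, Complex.norm_real, Real.norm_of_nonneg vonMangoldt_nonneg,
            Real.norm_of_nonneg vonMangoldt_nonneg, mul_one, mul_comm]
      _ = (∑ b ∈ Icc 1 s, Λ b) * ∑ a ∈ Icc 1 s, Λ a := by rw [sum_mul_sum]
      _ ≤ (6 * s) * (6 * s) := by
          have := psiN s
          have h0 : 0 ≤ ∑ a ∈ Icc 1 s, Λ a := sum_nonneg fun _ _ => vonMangoldt_nonneg
          gcongr
      _ = 36 * (s * s : ℕ) := by push_cast; ring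
      _ ≤ _ := by gcongr
  refine (norm_add_le _ _).trans ?_
  have := norm_sub_le (∑ a ∈ Icc 1 s, (Λ a : ℂ) * FF θ N a) (∑ b ∈ Icc 1 s, ∑ a ∈ Icc 1 s, f a b)
  linarith

end Bil
end PP

namespace PP
section Bil2
open ArithmeticFunction

def hd (b1 b2 : ℕ) : ℕ := (b1 - b2) + (b2 - b1)

lemma hd_norm (b1 b2 : ℕ) (θ : ℝ) : ‖ee (((b1:ℝ) - b2) * θ) - 1‖ = ‖ee (hd b1 b2 * θ) - 1‖ := by
  rcases le_total b1 b2 with h | h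
  · have : (hd b1 b2 : ℝ) = b2 - b1 := by rw [hd, Nat.sub_eq_zero_of_le h, zero_add, Nat.cast_sub h]
    rw [this, ← ee_sub_neg]; congr 3; ring
  · have : (hd b1 b2 : ℝ) = b1 - b2 := by rw [hd, Nat.sub_eq_zero_of_le h, add_zero, Nat.cast_sub h]
    rw [this]

lemma hd_dvd {q b1 b2 : ℕ} : q ∣ hd b1 b2 ↔ b2 ≡ b1 [MOD q] := by
  rcases le_total b1 b2 with h | h
  · rw [hd, Nat.sub_eq_zero_of_le h, zero_add, ← Nat.modEq_iff_dvd' h]; exact ⟨Nat.ModEq.symm, Nat.ModEq.symm⟩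
  · rw [hd, Nat.sub_eq_zero_of_le h, add_zero, ← Nat.modEq_iff_dvd' h]

lemma hd_sum (Y b1 : ℕ) (hb : b1 ∈ Icc 1 Y) (g : ℕ → ℝ) (hg : ∀ h, 0 ≤ g h) (P : ℕ → Prop) [DecidablePred P] (hP : ¬ P 0) :
    ∑ b2 ∈ (Icc 1 Y).filter (fun b2 => P (hd b1 b2)), g (hd b1 b2) ≤ 2 * ∑ h ∈ (Icc 1 Y).filter P, g h := by
  rw [mem_Icc] at hb
  rw [← sum_filter_add_sum_filter_not _ (fun b2 => b2 < b1), two_mul]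
  gcongr ?_ + ?_
  · rw [← sum_image (f := g) (g := fun b2 => hd b1 b2)]
    · refine sum_le_sum_of_subset_of_nonneg (fun h hh => ?_) fun _ _ _ => hg _
      simp only [mem_image, mem_filter, mem_Icc] at hh ⊢
      obtain ⟨b2, h1, rfl⟩ := hh
      refine ⟨?_, h1.1.2⟩
      simp only [hd]; omega
    · intro x hx y hy hxy
      simp only [mem_coe, mem_filter, mem_Icc, hd] at hx hy hxy
      omega
  · rw [← sum_image (f := g) (g := fun b2 => hd b1 b2)]
    · refine sum_le_sum_of_subset_of_nonneg (fun h hh => ?_) fun _ _ _ => hg _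
      simp only [mem_image, mem_filter, mem_Icc] at hh ⊢
      obtain ⟨b2, h1, rfl⟩ := hh
      refine ⟨?_, h1.1.2⟩
      have : hd b1 b2 ≠ 0 := fun h0 => hP (h0 ▸ h1.1.2)
      simp only [hd] at this ⊢; omega
    · intro x hx y hy hxy
      simp only [mem_coe, mem_filter, mem_Icc, hd] at hx hy hxy
      omega

lemma ker_triv (θ : ℝ) (B c : ℕ) (hc : c ≤ 4 * B) (x : ℝ) : ‖∑ a ∈ Ioc B c, ee (a * x)‖ ≤ 3 * B := by
  refine (geom_ee_triv B c x).trans ?_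
  exact_mod_cast (by omega : c - B ≤ 3 * B)

lemma ker_geom (θ : ℝ) (B c b1 b2 : ℕ) (hp : 0 < ‖ee (hd b1 b2 * θ) - 1‖) :
    ‖∑ a ∈ Ioc B c, ee (a * (((b1:ℝ) - b2) * θ))‖ ≤ 2 * ‖ee (hd b1 b2 * θ) - 1‖⁻¹ := by
  rw [← div_eq_mul_inv, le_div_iff₀ hp, ← hd_norm]
  exact geom_ee B c _

/-- standing hypotheses -/
structure Std (N q B : ℕ) (a : ℤ) (β : ℝ) : Prop where
  hL : 1 ≤ Real.log N
  hq : 0 < q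
  hqN : q * Real.log N ^ 6 ≤ N
  hβ : |β| * q * N ≤ Real.log N ^ 6
  ha : IsCoprime a (q:ℤ)
  hB : 10000 * Real.log N ^ 48 ≤ B
  hBB : B * B ≤ N

section
variable {N q B : ℕ} {a : ℤ} {β : ℝ}

lemma Std.N0 (S : Std N q B a β) : (0:ℝ) < N := by
  rcases Nat.eq_zero_or_pos N with h | h
  · have := S.hL; rw [h] at this; simp at this; linarith
  · exact_mod_cast h

lemma Std.B0 (S : Std N q B a β) : (10000:ℝ) ≤ B := by
  have := S.hB; have := one_le_pow₀ S.hL (n := 48); linarith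

lemma Std.Y1 (S : Std N q B a β) : B ≤ N / B := by
  have := S.B0
  have hB : 10000 ≤ B := by exact_mod_cast this
  rw [Nat.le_div_iff_mul_le (by omega)]; exact S.hBB

lemma Std.Bpos (S : Std N q B a β) : 0 < B := by
  have := S.B0
  have hB : 10000 ≤ B := by exact_mod_cast this
  omega

lemma Std.Y2 : ((N / B : ℕ) : ℝ) * B ≤ N := by exact_mod_cast Nat.div_mul_le_self N B

lemma Std.Y3 (S : Std N q B a β) : (N:ℝ) ≤ 2 * ((N / B : ℕ) : ℝ) * B := by
  have h1 := S.Y1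
  have h2 := Nat.div_add_mod N B
  have h3 := Nat.mod_lt N S.Bpos
  have h4 : B ≤ B * (N / B) := by have := S.Bpos; nlinarith
  have : N ≤ 2 * (N / B) * B := by nlinarith
  exact_mod_cast this

lemma Std.hβ' (S : Std N q B a β) {h : ℕ} (hh : h ≤ N / B) : h * |β| ≤ 1 / (4 * q) := by
  have hq0 : (0:ℝ) < q := by exact_mod_cast S.hq
  have hB0 : (0:ℝ) < B := by linarith [S.B0]
  have hN0 := S.N0
  have h1 : (h:ℝ) ≤ N / B := (Nat.cast_le.2 hh).trans Nat.cast_div_le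
  have h2 : 4 * Real.log N ^ 6 ≤ B := by
    have := pow_le_pow_right₀ S.hL (show 6 ≤ 48 by norm_num)
    have := S.hB
    have : 0 ≤ Real.log N ^ 48 := by have := S.hL; positivity
    linarith
  calc h * |β| ≤ N / B * |β| := by gcongr
    _ = (|β| * q * N) / (q * B) := by field_simp
    _ ≤ Real.log N ^ 6 / (q * B) := by gcongr; exact S.hβ
    _ ≤ Real.log N ^ 6 / (q * (4 * Real.log N ^ 6)) := by
        have := S.hL
        gcongr
    _ = _ := by have := S.hL; field_simp

lemma hd_le {Y b1 b2 : ℕ} (h1 : b1 ∈ Icc 1 Y) (h2 : b2 ∈ Icc 1 Y) : hd b1 b2 ≤ Y := by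
  rw [mem_Icc] at h1 h2; simp only [hd]; omega

lemma Std.pt (S : Std N q B a β) {b1 b2 : ℕ} (h1 : b1 ∈ Icc 1 (N / B)) (h2 : b2 ∈ Icc 1 (N / B))
    (hn : ¬ b2 ≡ b1 [MOD q]) : 2 / (q:ℝ) ≤ ‖ee (hd b1 b2 * (a / q + β)) - 1‖ :=
  ee_pt2 S.hq S.ha (fun h => hn (hd_dvd.1 h)) (S.hβ' (hd_le h1 h2))

lemma Std.B4 (S : Std N q B a β) : 4 * B ≤ N := by
  have := S.hBB
  have : 10000 ≤ B := by exact_mod_cast S.B0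
  nlinarith

noncomputable def EE (θ : ℝ) (N B : ℕ) : ℝ := ∑ a ∈ Ioc (2 * B) (4 * B), Λ a * ‖FF θ N a‖

lemma Std.big (S : Std N q B a β) (hq6 : Real.log N ^ 6 < q) : EE (a / q + β) N B ^ 2 ≤ 66 * N ^ 2 / Real.log N := by
  set L := Real.log N with hLd
  set θ := (a / q + β : ℝ) with hθ
  set Y := N / B with hY
  have hL := S.hL
  have hq0 : (0:ℝ) < q := by exact_mod_cast S.hq
  have hN0 := S.N0
  have hB0 : (0:ℝ) < B := by linarith [S.B0]
  have hL0 : 0 < L := by linarith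
  have hqN' : (q:ℝ) ≤ N := by have := S.hqN; have := one_le_pow₀ S.hL (n := 6); nlinarith
  have hlogq : Real.log q ≤ L := Real.log_le_log hq0 hqN'
  have h1 : EE θ N B ≤ L * ∑ c ∈ Ioc B (4 * B), ‖FF θ N c‖ := by
    rw [EE, mul_sum]
    refine (sum_le_sum fun c hc => ?_).trans (sum_le_sum_of_subset_of_nonneg (Ioc_subset_Ioc_left (by omega))
      fun _ _ _ => by positivity)
    rw [mem_Ioc] at hc
    gcongr
    refine vonMangoldt_le_log.trans (Real.log_le_log ?_ ?_)
    · exact_mod_cast (by omega : 0 < c)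
    · exact_mod_cast hc.2.trans S.B4
  have hΛ : ∀ b ∈ Icc 1 Y, Λ b ≤ L := by
    intro b hb
    rw [mem_Icc] at hb
    exact vonMangoldt_le_log.trans (Real.log_le_log (by exact_mod_cast hb.1)
      (by exact_mod_cast hb.2.trans (Nat.div_le_self N B)))
  set K : ℕ → ℕ → ℝ := fun b1 b2 => if b2 ≡ b1 [MOD q] then 3 * B else 2 * ‖ee (hd b1 b2 * θ) - 1‖⁻¹ with hK
  have hK0 : ∀ b1 b2, 0 ≤ K b1 b2 := by
    intro b1 b2; simp only [hK]; split_ifs <;> positivity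
  have h2 := disp θ N B S.Bpos K (by
    intro b1 hb1 b2 hb2 c hc
    simp only [hK]
    split_ifs with h
    · exact ker_triv θ B c hc _
    · exact ker_geom θ B c b1 b2 (lt_of_lt_of_le (by positivity) (S.pt hb1 hb2 h)))
  have h3 : ∀ b1 ∈ Icc 1 Y, ∑ b2 ∈ Icc 1 Y, K b1 b2 ≤ (Y / q + 1) * (3 * B) + 8 * L * (Y + q) := by
    intro b1 hb1
    rw [← sum_filter_add_sum_filter_not _ (fun b2 => b2 ≡ b1 [MOD q])]
    gcongr ?_ + ?_
    · calc _ = ∑ b2 ∈ (Icc 1 Y).filter (fun b2 => b2 ≡ b1 [MOD q]), (3 * B : ℝ) := by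
            refine sum_congr rfl fun b2 hb2 => ?_
            simp only [hK, if_pos (mem_filter.1 hb2).2]
        _ = ((Icc 1 Y).filter (fun b2 => b2 ≡ b1 [MOD q])).card * (3 * B : ℝ) := by rw [sum_const, nsmul_eq_mul]
        _ ≤ _ := by
            gcongr
            have := card_ap 0 Y q b1 S.hq
            rw [zero_add, abs_le] at this
            have e : Icc 1 Y = Ioc 0 Y := rfl
            rw [e]; linarith [this.2]
    · calc _ = ∑ b2 ∈ (Icc 1 Y).filter (fun b2 => ¬ q ∣ hd b1 b2), 2 * ‖ee (hd b1 b2 * θ) - 1‖⁻¹ := by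
            simp only [hd_dvd]
            refine sum_congr rfl fun b2 hb2 => ?_
            simp only [hK, if_neg (mem_filter.1 hb2).2]
        _ ≤ 2 * ∑ h ∈ (Icc 1 Y).filter (fun h => ¬ q ∣ h), 2 * ‖ee (h * θ) - 1‖⁻¹ :=
            hd_sum Y b1 hb1 (fun h => 2 * ‖ee (h * θ) - 1‖⁻¹) (fun h => by positivity) (fun h => ¬ q ∣ h) (by simp)
        _ = 4 * ∑ h ∈ (Icc 1 Y).filter (fun h => ¬ q ∣ h), ‖ee (h * θ) - 1‖⁻¹ := by rw [← mul_sum]; ring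
        _ ≤ 4 * ((Y / q + 1) * (q * (1 + Real.log q))) := by
            gcongr; exact block S.hq S.ha (S.hβ' le_rfl)
        _ = 4 * ((Y + q) * (1 + Real.log q)) := by field_simp
        _ ≤ 4 * ((Y + q) * (L + L)) := by gcongr
        _ = _ := by ring
  have h4 : ∑ b1 ∈ Icc 1 Y, ∑ b2 ∈ Icc 1 Y, Λ b1 * Λ b2 * K b1 b2 ≤
      L ^ 2 * (Y * ((Y / q + 1) * (3 * B) + 8 * L * (Y + q))) := by
    calc _ ≤ ∑ b1 ∈ Icc 1 Y, ∑ b2 ∈ Icc 1 Y, L * L * K b1 b2 := by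
          refine sum_le_sum fun b1 hb1 => sum_le_sum fun b2 hb2 => ?_
          have := hΛ b1 hb1
          have := hΛ b2 hb2
          have := hK0 b1 b2
          have : 0 ≤ Λ b2 := vonMangoldt_nonneg
          gcongr
      _ = L ^ 2 * ∑ b1 ∈ Icc 1 Y, ∑ b2 ∈ Icc 1 Y, K b1 b2 := by simp only [← mul_sum]; ring
      _ ≤ L ^ 2 * ∑ b1 ∈ Icc 1 Y, ((Y / q + 1) * (3 * B) + 8 * L * (Y + q)) := by
          gcongr with b1 hb1; exact h3 b1 hb1
      _ = _ := by rw [sum_const, Nat.card_Icc, nsmul_eq_mul, Nat.add_sub_cancel]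
  have h5 : (∑ c ∈ Ioc B (4 * B), ‖FF θ N c‖) ^ 2 ≤ (3 * B) * ∑ c ∈ Ioc B (4 * B), ‖FF θ N c‖ ^ 2 := by
    have := sq_sum_le_card_mul_sum_sq (s := Ioc B (4 * B)) (f := fun c => ‖FF θ N c‖)
    rw [Nat.card_Ioc, show 4 * B - B = 3 * B by omega] at this
    push_cast at this; exact this
  have hYB : (Y:ℝ) * B ≤ N := Std.Y2
  have hYN : (Y:ℝ) ≤ N / B := by rw [le_div_iff₀ hB0]; exact hYB
  have hBL : L ^ 48 ≤ B := by have := S.hB; have : 0 ≤ L ^ 48 := by positivity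
                              linarith
  have hL6 : L ^ 6 ≤ L ^ 48 := pow_le_pow_right₀ hL (by norm_num)
  have hqN : (q:ℝ) ≤ N / L ^ 6 := by rw [le_div_iff₀ (by positivity)]; exact S.hqN
  have hYN6 : (Y:ℝ) ≤ N / L ^ 6 := hYN.trans (by gcongr; linarith)
  have hBN6 : (B:ℝ) ≤ N / L ^ 6 := le_trans (by exact_mod_cast S.Y1) hYN6
  have h6 : (Y:ℝ) * B / q ≤ N / L ^ 6 := by gcongr
  have hE0 : 0 ≤ EE θ N B := sum_nonneg fun _ _ => mul_nonneg vonMangoldt_nonneg (norm_nonneg _)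
  calc EE θ N B ^ 2 ≤ (L * ∑ c ∈ Ioc B (4 * B), ‖FF θ N c‖) ^ 2 := by gcongr
    _ = L ^ 2 * (∑ c ∈ Ioc B (4 * B), ‖FF θ N c‖) ^ 2 := by ring
    _ ≤ L ^ 2 * ((3 * B) * (L ^ 2 * (Y * ((Y / q + 1) * (3 * B) + 8 * L * (Y + q))))) := by
        gcongr; exact h5.trans (by gcongr; exact h2.trans h4)
    _ = 3 * L ^ 4 * (Y * B) * (3 * (Y * B / q) + 3 * B + 8 * L * (Y + q)) := by ring
    _ ≤ 3 * L ^ 4 * N * (3 * (N / L ^ 6) + 3 * (N / L ^ 6) + 8 * L * (N / L ^ 6 + N / L ^ 6)) := by gcongr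
    _ = 18 * N ^ 2 / L ^ 2 + 48 * N ^ 2 / L := by field_simp; ring
    _ ≤ 18 * N ^ 2 / L + 48 * N ^ 2 / L := by gcongr; nlinarith
    _ = _ := by ring

end
end Bil2
end PP

namespace PP
section Bil3
open ArithmeticFunction
variable {N q B : ℕ} {a : ℤ} {β : ℝ}

def BTC (C : ℝ) : Prop := 0 < C ∧ ∀ X x y q r : ℕ, 256 ≤ X → x + y ≤ X → X ^ 3 ≤ y ^ 4 → 1 ≤ q → q ^ 8 ≤ X →
  ∑ n ∈ (Ioc x (x + y)).filter (· ≡ r [MOD q]), Λ n ≤ C * (y / q.totient)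

lemma btc : ∃ C, BTC C := brun_titchmarsh

lemma Std.q8 (S : Std N q B a β) (hq6 : q ≤ Real.log N ^ 6) : q ^ 8 ≤ B := by
  have h : ((q:ℝ)) ^ 8 ≤ B := by
    calc (q:ℝ) ^ 8 ≤ (Real.log N ^ 6) ^ 8 := by gcongr
      _ = Real.log N ^ 48 := by ring
      _ ≤ B := by
        have := S.hB
        have : 0 ≤ Real.log N ^ 48 := by have := S.hL; positivity
        linarith
  exact_mod_cast h

lemma Std.slide1 (S : Std N q B a β) (hq6 : q ≤ Real.log N ^ 6) {C : ℝ} (hC : BTC C) :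
    EE (a / q + β) N B ≤ C * (q / q.totient) * (∑ c ∈ Ioc B (4 * B), ‖FF (a / q + β) N c‖ + 150 * N / Real.log N) := by
  set L := Real.log N with hLd
  set θ := (a / q + β : ℝ) with hθ
  set Y := N / B with hY
  have hL : 1 ≤ L := S.hL
  have hq0 : (0:ℝ) < q := by exact_mod_cast S.hq
  have hN0 := S.N0
  have hB0 : (0:ℝ) < B := by linarith [S.B0]
  have hL0 : 0 < L := by linarith
  have hq1 : (1:ℝ) ≤ q := by exact_mod_cast S.hq
  set h := ⌊B / (q * L ^ 9)⌋₊ with hh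
  have hle : (h:ℝ) ≤ B / (q * L ^ 9) := Nat.floor_le (by positivity)
  have hlt : B / (q * L ^ 9) < h + 1 := Nat.lt_floor_add_one _
  have hqh : (q * h : ℝ) ≤ B / L ^ 9 := by
    calc (q * h : ℝ) ≤ q * (B / (q * L ^ 9)) := by gcongr
      _ = _ := by field_simp
  have hqh2 : (B / L ^ 9 : ℝ) ≤ q * h + q := by
    have : (B / L ^ 9 : ℝ) = q * (B / (q * L ^ 9)) := by field_simp
    rw [this]; nlinarith
  have hB48 : 10000 * L ^ 48 ≤ B := S.hB
  have p1 : L ^ 15 ≤ L ^ 48 := pow_le_pow_right₀ hL (by norm_num)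
  have hqB : (q:ℝ) ≤ B / L ^ 9 / 2 := by
    have : (2:ℝ) * L ^ 15 ≤ B := by
      have : 0 ≤ L ^ 48 := by positivity
      linarith
    calc (q:ℝ) ≤ L ^ 6 := hq6
      _ = 2 * L ^ 15 / L ^ 9 / 2 := by field_simp
      _ ≤ _ := by gcongr
  have hqh3 : (B / L ^ 9 / 2 : ℝ) ≤ q * h := by linarith
  have hh0 : (0:ℝ) < h := by
    have : 0 < (B / L ^ 9 / 2 : ℝ) := by positivity
    exact pos_of_mul_pos_right (lt_of_lt_of_le this hqh3) hq0.le
  have hL9 : 1 ≤ L ^ 9 := one_le_pow₀ hL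
  have hqhB : q * h ≤ B := by
    have : (q * h : ℝ) ≤ B := hqh.trans (div_le_self hB0.le hL9)
    exact_mod_cast this
  have hBT : ∀ c ∈ Ioc B (4 * B), ∑ j ∈ range h, Λ (c + q * j) ≤ C * ((q * h : ℕ) / q.totient) := by
    intro c hc
    rw [mem_Ioc] at hc
    have := hC.2 (8 * B) (c - 1) (q * h) q c (by have : (10000:ℝ) ≤ B := S.B0
                                                 have : 10000 ≤ B := by exact_mod_cast this
                                                 omega) (by omega) ?_ S.hq ((S.q8 hq6).trans (by omega))
    · refine le_trans ?_ this
      rw [← sum_image (s := range h) (g := fun j => c + q * j) (f := fun n => Λ n)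
        (fun x _ y _ hxy => by simpa [S.hq.ne'] using hxy)]
      refine sum_le_sum_of_subset_of_nonneg (fun n hn => ?_) fun _ _ _ => vonMangoldt_nonneg
      simp only [mem_image, mem_range, mem_filter, mem_Ioc] at hn ⊢
      obtain ⟨j, hj, rfl⟩ := hn
      have : q * (j + 1) ≤ q * h := Nat.mul_le_mul_left q hj
      have := S.hq
      refine ⟨⟨by omega, by rw [mul_add] at *; omega⟩, ?_⟩
      simp [Nat.ModEq]
    · have h1 : ((8 * B : ℕ) : ℝ) ^ 3 ≤ ((q * h : ℕ) : ℝ) ^ 4 := by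
        push_cast
        calc (8 * B : ℝ) ^ 3 = 512 * B ^ 3 := by ring
          _ ≤ (B / L ^ 9 / 2) ^ 4 := by
            rw [div_pow, div_pow, ← pow_mul, le_div_iff₀ (by norm_num), le_div_iff₀ (by positivity)]
            have p2 : L ^ 36 ≤ L ^ 48 := pow_le_pow_right₀ hL (by norm_num)
            have : 512 * 16 * L ^ 36 ≤ (B:ℝ) := by
              have : 0 ≤ L ^ 48 := by positivity
              linarith
            calc 512 * (B:ℝ) ^ 3 * 2 ^ 4 * L ^ (9 * 4) = (B:ℝ) ^ 3 * (512 * 16 * L ^ 36) := by norm_num; ring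
              _ ≤ (B:ℝ) ^ 3 * (B:ℝ) := by gcongr
              _ = _ := by ring
          _ ≤ _ := by gcongr
      exact_mod_cast h1
  have hYB : (Y:ℝ) * B ≤ N := Std.Y2
  have hY3 : (N:ℝ) ≤ 2 * Y * B := S.Y3
  have hBY : (B:ℝ) ≤ Y := by exact_mod_cast S.Y1
  have hdf : ∀ c ∈ Ioc B (4 * B), ∀ j < h, ‖FF θ N (c + q * j)‖ ≤ ‖FF θ N c‖ + 50 * Y / L := by
    intro c hc j hj
    rw [mem_Ioc] at hc
    refine (fdiff N B q (q * h) j c a β S.hq S.Bpos hc.1 (Nat.mul_le_mul_left q hj.le)).trans ?_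
    gcongr
    have h1 : ((q * h : ℕ) : ℝ) * Y * |β| ≤ L⁻¹ := by
      push_cast
      have hb : |β| ≤ L ^ 6 / (q * N) := by
        rw [le_div_iff₀ (by positivity)]; linarith [S.hβ]
      have hY' : (Y:ℝ) ≤ N / B := by rw [le_div_iff₀ hB0]; exact hYB
      calc (q * h : ℝ) * Y * |β| ≤ B / L ^ 9 * (N / B) * (L ^ 6 / (q * N)) := by gcongr
        _ = (L ^ 3)⁻¹ / q := by field_simp
        _ ≤ (L ^ 3)⁻¹ := div_le_self (by positivity) hq1
        _ ≤ L⁻¹ := by gcongr; exact le_self_pow₀ hL (by norm_num)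
    have hπ := Real.pi_lt_d2
    have h2 : 2 * Real.pi * (((q * h : ℕ) : ℝ) * Y * |β|) * (6 * Y) ≤ 2 * 3.15 * L⁻¹ * (6 * Y) := by gcongr
    have h3 : L * (N * (q * h : ℕ) / B ^ 2 + 1) ≤ 3 * Y / L := by
      push_cast
      have e1 : (N * (q * h) / B ^ 2 : ℝ) ≤ 2 * Y / L ^ 9 := by
        rw [div_le_iff₀ (by positivity)]
        calc (N * (q * h) : ℝ) ≤ (2 * Y * B) * (B / L ^ 9) := by gcongr
          _ = _ := by ring
      have e2 : L ^ 2 ≤ Y := by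
        have p2 : L ^ 2 ≤ L ^ 48 := pow_le_pow_right₀ hL (by norm_num)
        have : 0 ≤ L ^ 48 := by positivity
        linarith
      have e3 : 2 * Y / L ^ 9 ≤ 2 * Y / L ^ 2 :=
        div_le_div_of_nonneg_left (by positivity) (by positivity) (pow_le_pow_right₀ hL (by norm_num))
      calc L * (N * (q * h) / B ^ 2 + 1) ≤ L * (2 * Y / L ^ 2 + Y / L ^ 2) :=
            mul_le_mul_of_nonneg_left (add_le_add (e1.trans e3) ((one_le_div (by positivity)).2 e2)) hL0.le
        _ = _ := by field_simp; ring
    have e4 : 3 * Y / L = 3 * (Y * L⁻¹) := by ring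
    have e5 : 50 * Y / L = 50 * (Y * L⁻¹) := by ring
    have : 0 ≤ Y * L⁻¹ := by positivity
    rw [e5]; rw [e4] at h3
    nlinarith
  have hs := slide B q h hqhB (fun c => ‖FF θ N c‖) (fun _ => norm_nonneg _) _ (50 * Y / L) (by positivity) hBT hdf
  have hC0 := hC.1
  have hs2 : h * EE θ N B ≤ h * (C * (q / q.totient) * (∑ c ∈ Ioc B (4 * B), ‖FF θ N c‖ + 150 * N / L)) := by
    refine hs.trans ?_
    calc _ = h * (C * (q / q.totient) * (∑ c ∈ Ioc B (4 * B), ‖FF θ N c‖ + 150 * (Y * B) / L)) := by push_cast; ring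
      _ ≤ _ := by gcongr
  exact le_of_mul_le_mul_left hs2 hh0

lemma Std.small (S : Std N q B a β) (hq6 : q ≤ Real.log N ^ 6) {C : ℝ} (hC : BTC C) (k : ℕ → ℕ → ℝ) (κ : ℝ) (hκ : 0 ≤ κ)
    (hk : ∀ b1 ∈ Icc 1 (N / B), ∀ b2 ∈ Icc 1 (N / B), b2 ≡ b1 [MOD q] → ∀ c ≤ 4 * B,
      ‖∑ c ∈ Ioc B c, ee (c * (((b1:ℝ) - b2) * (a / q + β)))‖ ≤ k b1 b2)
    (hk2 : ∑ b1 ∈ Icc 1 (N / B), ∑ b2 ∈ (Icc 1 (N / B)).filter (· ≡ b1 [MOD q]), Λ b1 * Λ b2 * k b1 b2 ≤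
      κ * B * ((N / B : ℕ) : ℝ) ^ 2) :
    EE (a / q + β) N B ≤ C * (q / q.totient) * (2 * √(κ + 36 / Real.log N) + 150 / Real.log N) * N := by
  refine (S.slide1 hq6 hC).trans ?_
  set L := Real.log N with hLd
  set θ := (a / q + β : ℝ) with hθ
  set Y := N / B with hY
  have hL : 1 ≤ L := S.hL
  have hq0 : (0:ℝ) < q := by exact_mod_cast S.hq
  have hN0 := S.N0
  have hB0 : (0:ℝ) < B := by linarith [S.B0]
  have hL0 : 0 < L := by linarith
  have hYB : (Y:ℝ) * B ≤ N := Std.Y2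
  have h2 := disp θ N B S.Bpos (fun b1 b2 => if b2 ≡ b1 [MOD q] then k b1 b2 else q) (by
    intro b1 hb1 b2 hb2 c hc
    beta_reduce
    split_ifs with h
    · exact hk b1 hb1 b2 hb2 h c hc
    · have hp := S.pt hb1 hb2 h
      refine (ker_geom θ B c b1 b2 (lt_of_lt_of_le (by positivity) hp)).trans ?_
      have := inv_anti₀ (by positivity) hp
      rw [inv_div] at this
      linarith)
  have h3 : ∑ b1 ∈ Icc 1 Y, ∑ b2 ∈ Icc 1 Y, Λ b1 * Λ b2 * (if b2 ≡ b1 [MOD q] then k b1 b2 else q) ≤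
      κ * B * Y ^ 2 + 36 * q * Y ^ 2 := by
    have e : ∀ b1 ∈ Icc 1 Y, ∑ b2 ∈ Icc 1 Y, Λ b1 * Λ b2 * (if b2 ≡ b1 [MOD q] then k b1 b2 else q) ≤
        ∑ b2 ∈ (Icc 1 Y).filter (· ≡ b1 [MOD q]), Λ b1 * Λ b2 * k b1 b2 + ∑ b2 ∈ Icc 1 Y, Λ b1 * Λ b2 * q := by
      intro b1 _
      rw [sum_filter, ← sum_add_distrib]
      refine sum_le_sum fun b2 _ => ?_
      have h1 : 0 ≤ Λ b1 * Λ b2 * q := mul_nonneg (mul_nonneg vonMangoldt_nonneg vonMangoldt_nonneg) hq0.le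
      split_ifs <;> linarith
    refine (sum_le_sum e).trans ?_
    rw [sum_add_distrib]
    gcongr
    have hp := psiN Y
    have hp0 : 0 ≤ ∑ b ∈ Icc 1 Y, Λ b := sum_nonneg fun _ _ => vonMangoldt_nonneg
    calc _ = (∑ b ∈ Icc 1 Y, Λ b) * (∑ b ∈ Icc 1 Y, Λ b) * q := by
          rw [sum_mul_sum, sum_mul]; simp only [sum_mul]
      _ ≤ (6 * Y) * (6 * Y) * q := by gcongr
      _ = _ := by ring
  have h5 : (∑ c ∈ Ioc B (4 * B), ‖FF θ N c‖) ^ 2 ≤ (3 * B) * ∑ c ∈ Ioc B (4 * B), ‖FF θ N c‖ ^ 2 := by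
    have := sq_sum_le_card_mul_sum_sq (s := Ioc B (4 * B)) (f := fun c => ‖FF θ N c‖)
    rw [Nat.card_Ioc, show 4 * B - B = 3 * B by omega] at this
    push_cast at this; exact this
  have hqB : (q:ℝ) / B ≤ 1 / L := by
    rw [div_le_div_iff₀ hB0 hL0]
    have p : L ^ 7 ≤ L ^ 48 := pow_le_pow_right₀ hL (by norm_num)
    have : 10000 * L ^ 48 ≤ B := S.hB
    have : 0 ≤ L ^ 48 := by positivity
    calc (q:ℝ) * L ≤ L ^ 6 * L := by gcongr
      _ = L ^ 7 := by ring
      _ ≤ 1 * B := by linarith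
  have h6 : (∑ c ∈ Ioc B (4 * B), ‖FF θ N c‖) ≤ 2 * √(κ + 36 / L) * N := by
    refine le_of_sq_le_sq ?_ (by positivity)
    calc _ ≤ (3 * B) * (κ * B * Y ^ 2 + 36 * q * Y ^ 2) := h5.trans (by gcongr; exact h2.trans h3)
      _ = 3 * (Y * B) ^ 2 * (κ + 36 * (q / B)) := by field_simp
      _ ≤ 4 * N ^ 2 * (κ + 36 * (1 / L)) := by gcongr; norm_num
      _ = (2 * √(κ + 36 / L) * N) ^ 2 := by
          rw [mul_pow, mul_pow, Real.sq_sqrt (by positivity)]; ring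
  have hC0 := hC.1
  calc _ ≤ C * (q / q.totient) * (2 * √(κ + 36 / L) * N + 150 * N / L) := by gcongr
    _ = _ := by ring

lemma Std.small1 (S : Std N q B a β) (hq6 : q ≤ Real.log N ^ 6) {C : ℝ} (hC : BTC C) :
    EE (a / q + β) N B ≤ C * (q / q.totient) * (2 * √(18 * C / q.totient + 36 / Real.log N) + 150 / Real.log N) * N := by
  have hC0 := hC.1
  refine S.small hq6 hC (fun _ _ => 3 * B) _ (by positivity) (fun b1 _ b2 _ _ c hc => ker_triv 0 B c hc _) ?_
  set Y := N / B with hY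
  have hB1 : 10000 ≤ B := by exact_mod_cast S.B0
  have hBY : B ≤ Y := S.Y1
  have hbt : ∀ b1, ∑ b2 ∈ (Icc 1 Y).filter (· ≡ b1 [MOD q]), Λ b2 ≤ C * (Y / q.totient) := by
    intro b1
    have := hC.2 Y 0 Y q b1 (by omega) (by omega) (pow_le_pow_right₀ (by omega) (by norm_num)) S.hq ((S.q8 hq6).trans hBY)
    rw [zero_add] at this; exact this
  calc _ = ∑ b1 ∈ Icc 1 Y, Λ b1 * (∑ b2 ∈ (Icc 1 Y).filter (· ≡ b1 [MOD q]), Λ b2) * (3 * B) := by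
        refine sum_congr rfl fun b1 _ => ?_
        rw [mul_sum, sum_mul]
    _ ≤ ∑ b1 ∈ Icc 1 Y, Λ b1 * (C * (Y / q.totient)) * (3 * B) := by
        gcongr with b1 hb1
        exact hbt b1
    _ = (∑ b1 ∈ Icc 1 Y, Λ b1) * (C * (Y / q.totient) * (3 * B)) := by
        rw [sum_mul]; exact sum_congr rfl fun _ _ => by ring
    _ ≤ (6 * Y) * (C * (Y / q.totient) * (3 * B)) := by gcongr; exact psiN Y
    _ = _ := by ring

lemma Std.small2 (S : Std N q B a β) (hq6 : q ≤ Real.log N ^ 6) {C : ℝ} (hC : BTC C) (δ R : ℝ) (hδ : 0 < δ) (hδ1 : δ ≤ 1)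
    (hR : 0 < R) (hRβ : R ≤ N * |β|) (hδY : 4 / δ ^ 4 ≤ B) :
    EE (a / q + β) N B ≤ C * (q / q.totient) * (2 * √((72 * C * δ + 36 / (δ * R)) + 36 / Real.log N) + 150 / Real.log N) * N := by
  have hC0 := hC.1
  set Y := N / B with hY
  have hB1 : 10000 ≤ B := by exact_mod_cast S.B0
  have hBY : B ≤ Y := S.Y1
  have hB0 : (0:ℝ) < B := by linarith [S.B0]
  have hq0 : (0:ℝ) < q := by exact_mod_cast S.hq
  have hq1 : (1:ℝ) ≤ q := by exact_mod_cast S.hq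
  have hBY' : (B:ℝ) ≤ Y := by exact_mod_cast hBY
  have hY0 : (0:ℝ) < Y := by linarith
  set D := ⌊δ * Y⌋₊ with hD
  have hDle : (D:ℝ) ≤ δ * Y := Nat.floor_le (by positivity)
  have hDlt : δ * Y < D + 1 := Nat.lt_floor_add_one _
  have hY4 : 4 ≤ δ ^ 4 * Y := by
    rw [div_le_iff₀ (by positivity)] at hδY
    have : 0 < δ ^ 4 := by positivity
    nlinarith
  have hδY1 : 1 ≤ δ * Y := by
    have : δ ^ 4 ≤ δ := pow_le_of_le_one hδ.le hδ1 (by norm_num)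
    nlinarith
  have hDY : D ≤ Y := by
    have : (D:ℝ) ≤ Y := by nlinarith
    exact_mod_cast this
  refine S.small hq6 hC (fun b1 b2 => if hd b1 b2 ≤ D then 3 * (B:ℝ) else (B:ℝ) / (δ * R)) _ (by positivity) ?_ ?_
  · intro b1 hb1 b2 hb2 hm c hc
    beta_reduce
    split_ifs with h
    · exact ker_triv 0 B c hc _
    push Not at h
    have hhY := hd_le hb1 hb2
    have e : ee (hd b1 b2 * (a / q + β)) = ee (hd b1 b2 * β) := by
      obtain ⟨t, ht⟩ := hd_dvd.2 hm
      have : (hd b1 b2 * (a / q + β) : ℝ) = ((t * a : ℤ) : ℝ) + hd b1 b2 * β := by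
        rw [ht]; push_cast; field_simp
      rw [this, ee_add, ee_int, one_mul]
    have habs : |(hd b1 b2 : ℝ) * β| = hd b1 b2 * |β| := by rw [abs_mul, abs_of_nonneg (by positivity)]
    have hb := S.hβ' hhY
    have hb2 : |(hd b1 b2 : ℝ) * β| ≤ 1 / 2 := by
      rw [habs]; refine hb.trans ?_
      rw [div_le_div_iff₀ (by positivity) (by norm_num)]; linarith
    have hg := ee_sub_ge hb2
    rw [habs] at hg
    have hhD : δ * Y ≤ hd b1 b2 := by
      have : ((D + 1 : ℕ) : ℝ) ≤ hd b1 b2 := by exact_mod_cast h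
      push_cast at this; linarith
    have hNY : (N:ℝ) ≤ 2 * Y * B := S.Y3
    have hlow : 2 * (δ * R) / B ≤ ‖ee (hd b1 b2 * β) - 1‖ := by
      refine le_trans ?_ hg
      rw [div_le_iff₀ hB0]
      have h1 : R ≤ 2 * Y * B * |β| := hRβ.trans (by gcongr)
      calc 2 * (δ * R) ≤ 2 * (δ * (2 * Y * B * |β|)) := by gcongr
        _ = 4 * (δ * Y * |β|) * B := by ring
        _ ≤ 4 * (hd b1 b2 * |β|) * B := by gcongr
    have hpos : 0 < ‖ee (hd b1 b2 * β) - 1‖ := lt_of_lt_of_le (by positivity) hlow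
    refine (ker_geom _ B c b1 b2 (by rw [e]; exact hpos)).trans ?_
    rw [e]
    have := inv_anti₀ (by positivity) hlow
    calc 2 * ‖ee (hd b1 b2 * β) - 1‖⁻¹ ≤ 2 * (2 * (δ * R) / B)⁻¹ := by gcongr
      _ = _ := by field_simp
  · have hbt : ∀ b1 ∈ Icc 1 Y, ∑ b2 ∈ ((Icc 1 Y).filter (· ≡ b1 [MOD q])).filter (fun b2 => hd b1 b2 ≤ D), Λ b2 ≤ C * (4 * δ * Y) := by
      intro b1 hb1
      rw [mem_Icc] at hb1
      have := hC.2 (4 * Y) (b1 - (D + 1)) (2 * D + 2) q b1 (by omega) (by omega) ?_ S.hq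
        ((S.q8 hq6).trans (by omega))
      · refine (le_trans ?_ this).trans ?_
        · refine sum_le_sum_of_subset_of_nonneg (fun n hn => ?_) fun _ _ _ => vonMangoldt_nonneg
          obtain ⟨hn1, hn2⟩ := mem_filter.1 hn
          obtain ⟨hn3, hn4⟩ := mem_filter.1 hn1
          rw [mem_Icc] at hn3
          rw [mem_filter, mem_Ioc]
          unfold hd at hn2
          exact ⟨by omega, hn4⟩
        · gcongr
          have hφ1 : (1:ℝ) ≤ q.totient := by exact_mod_cast Nat.totient_pos.2 S.hq
          refine (div_le_self (by positivity) hφ1).trans ?_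
          push_cast; linarith
      · have h1 : ((4 * Y : ℕ) : ℝ) ^ 3 ≤ ((2 * D + 2 : ℕ) : ℝ) ^ 4 := by
          push_cast
          calc (4 * Y : ℝ) ^ 3 = 16 * (4 * Y ^ 3) := by ring
            _ ≤ 16 * (δ ^ 4 * Y * Y ^ 3) := by gcongr
            _ = (2 * (δ * Y)) ^ 4 := by ring
            _ ≤ _ := by gcongr; linarith
        exact_mod_cast h1
    have hp := psiN Y
    have hp0 : 0 ≤ ∑ b ∈ Icc 1 Y, Λ b := sum_nonneg fun _ _ => vonMangoldt_nonneg
    have step : ∀ b1 ∈ Icc 1 Y, ∑ b2 ∈ (Icc 1 Y).filter (· ≡ b1 [MOD q]), Λ b1 * Λ b2 * (if hd b1 b2 ≤ D then 3 * (B:ℝ) else (B:ℝ) / (δ * R))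
        ≤ Λ b1 * (C * (4 * δ * Y) * (3 * B) + 6 * Y * (B / (δ * R))) := by
      intro b1 hb1
      have hb := hbt b1 hb1
      have e : ∑ b2 ∈ (Icc 1 Y).filter (· ≡ b1 [MOD q]), Λ b2 * (if hd b1 b2 ≤ D then 3 * (B:ℝ) else (B:ℝ) / (δ * R)) ≤
          (∑ b2 ∈ ((Icc 1 Y).filter (· ≡ b1 [MOD q])).filter (fun b2 => hd b1 b2 ≤ D), Λ b2) * (3 * B)
          + (∑ b2 ∈ Icc 1 Y, Λ b2) * (B / (δ * R)) := by
        rw [← sum_filter_add_sum_filter_not ((Icc 1 Y).filter (· ≡ b1 [MOD q])) (fun b2 => hd b1 b2 ≤ D), sum_mul, sum_mul]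
        gcongr ?_ + ?_
        · exact le_of_eq (sum_congr rfl fun b2 hb2 => by rw [if_pos (mem_filter.1 hb2).2])
        · refine le_trans (le_of_eq (sum_congr rfl fun b2 hb2 => by rw [if_neg (mem_filter.1 hb2).2])) ?_
          exact sum_le_sum_of_subset_of_nonneg ((filter_subset _ _).trans (filter_subset _ _))
            fun _ _ _ => mul_nonneg vonMangoldt_nonneg (by positivity)
      calc _ = Λ b1 * ∑ b2 ∈ (Icc 1 Y).filter (· ≡ b1 [MOD q]), Λ b2 * (if hd b1 b2 ≤ D then 3 * (B:ℝ) else (B:ℝ) / (δ * R)) := by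
            rw [mul_sum]; exact sum_congr rfl fun _ _ => by ring
        _ ≤ _ := by
            refine mul_le_mul_of_nonneg_left (e.trans ?_) vonMangoldt_nonneg
            gcongr
    calc _ ≤ ∑ b1 ∈ Icc 1 Y, Λ b1 * (C * (4 * δ * Y) * (3 * B) + 6 * Y * (B / (δ * R))) := sum_le_sum step
      _ = (∑ b1 ∈ Icc 1 Y, Λ b1) * (C * (4 * δ * Y) * (3 * B) + 6 * Y * (B / (δ * R))) := by rw [sum_mul]
      _ ≤ (6 * Y) * (C * (4 * δ * Y) * (3 * B) + 6 * Y * (B / (δ * R))) := by gcongr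
      _ = _ := by field_simp; ring

end Bil3
end PP

namespace PP
section Bil4
open ArithmeticFunction

lemma EE_fin (ε : ℝ) (hε : 0 < ε) : ∃ Q R L0 B0 : ℝ, 0 < Q ∧ 0 < R ∧ ∀ (N q B : ℕ) (a : ℤ) (β : ℝ), Std N q B a β →
    L0 ≤ Real.log N → B0 ≤ B → (Q ≤ q ∨ R ≤ N * |β|) → EE (a / q + β) N B ≤ ε * N := by
  obtain ⟨C, hC⟩ := btc
  have hC0 := hC.1
  have lim : ∀ c d : ℝ, 0 < c → Tendsto (fun x : ℝ => d * x ^ (-c)) atTop (nhds 0) := fun c d hc => by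
    simpa using (tendsto_rpow_neg_atTop hc).const_mul d
  obtain ⟨Q, hQ'⟩ := (((lim (13/16) (18 * C * 15625) (by norm_num)).eventually_le_const
    (show 0 < (ε / (4 * C)) ^ 2 by positivity)).and (eventually_ge_atTop 1)).exists_forall_of_atTop
  have hQ1 : 1 ≤ Q := (hQ' Q le_rfl).2
  have hQ := fun x hx => (hQ' x hx).1
  obtain ⟨L1, hL1⟩ := ((lim (1/8) (4050 * C) (by norm_num)).eventually_le_const
    (show 0 < ε / 2 by positivity)).exists_forall_of_atTop
  set t := (ε / (4 * C * Q)) ^ 2 / 2 with ht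
  have hQ0 : 0 < Q := by linarith
  have ht0 : 0 < t := by positivity
  set δ := min 1 (t / (72 * C)) with hδ
  have hδ0 : 0 < δ := by positivity
  refine ⟨Q, 36 / (δ * t), max L1 (66 / ε ^ 2), 4 / δ ^ 4, hQ0, by positivity, fun N q B a β S hL hB hor => ?_⟩
  set L := Real.log N with hLd
  have hL1' : 1 ≤ L := S.hL
  have hL0 : 0 < L := by linarith
  have hN0 := S.N0
  have hq0 : (0:ℝ) < q := by exact_mod_cast S.hq
  by_cases hq6 : L ^ 6 < q
  · refine le_of_sq_le_sq ((S.big hq6).trans ?_) (by positivity)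
    have : 66 / ε ^ 2 ≤ L := (le_max_right _ _).trans hL
    rw [div_le_iff₀ (by positivity)] at this
    rw [div_le_iff₀ hL0]
    have : 0 ≤ (N:ℝ) ^ 2 := by positivity
    rw [mul_pow]; nlinarith
  push Not at hq6
  have hφ : (1:ℝ) ≤ q.totient := by exact_mod_cast Nat.totient_pos.2 S.hq
  set u := (q:ℝ) / q.totient with hu
  have hu0 : 0 < u := by positivity
  have huq : u ≤ 25 * (q:ℝ) ^ (1/16 : ℝ) := qphi q S.hq
  have fin : ∀ κ : ℝ, 0 ≤ κ → u ^ 2 * κ ≤ (ε / (4 * C)) ^ 2 →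
      C * u * (2 * √(κ + 36 / L) + 150 / L) * N ≤ ε * N := by
    intro κ hκ h
    gcongr
    have h1 : u * √κ ≤ ε / (4 * C) := by
      refine le_of_sq_le_sq ?_ (by positivity)
      rw [mul_pow, Real.sq_sqrt hκ]; exact h
    have hs1 : 1 ≤ √L := Real.one_le_sqrt.2 hL1'
    have h2 : √(κ + 36 / L) ≤ √κ + 6 / √L := by
      refine Real.sqrt_le_iff.2 ⟨by positivity, ?_⟩
      have : (√κ + 6 / √L) ^ 2 = κ + 36 / L + 2 * √κ * (6 / √L) := by
        rw [add_sq, Real.sq_sqrt hκ, div_pow, Real.sq_sqrt hL0.le]; ring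
      rw [this]
      exact le_add_of_nonneg_right (by positivity)
    have h3 : 150 / L ≤ 150 / √L := by
      gcongr
      nlinarith [Real.mul_self_sqrt hL0.le]
    have h4 : C * u * (162 / √L) ≤ ε / 2 := by
      refine le_trans ?_ (hL1 L ((le_max_left _ _).trans hL))
      have e : (q:ℝ) ^ (1/16 : ℝ) ≤ L ^ (3/8 : ℝ) := by
        calc (q:ℝ) ^ (1/16 : ℝ) ≤ (L ^ 6) ^ (1/16 : ℝ) := by gcongr
          _ = L ^ (3/8 : ℝ) := by rw [← Real.rpow_natCast, ← Real.rpow_mul hL0.le]; norm_num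
      calc C * u * (162 / √L) ≤ C * (25 * L ^ (3/8 : ℝ)) * (162 / √L) := by
            gcongr; exact huq.trans (by gcongr)
        _ = 4050 * C * (L ^ (3/8 : ℝ) / √L) := by ring
        _ = _ := by rw [Real.sqrt_eq_rpow, ← Real.rpow_sub hL0]; norm_num
    calc C * u * (2 * √(κ + 36 / L) + 150 / L) ≤ C * u * (2 * (√κ + 6 / √L) + 150 / √L) := by gcongr
      _ = 2 * C * (u * √κ) + C * u * (162 / √L) := by ring
      _ ≤ 2 * C * (ε / (4 * C)) + ε / 2 := by gcongr
      _ = ε := by field_simp; norm_num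
  by_cases hqQ : Q ≤ q
  · refine (S.small1 hq6 hC).trans (fin _ (by positivity) ?_)
    refine le_trans ?_ (hQ q hqQ)
    have : (q:ℝ) ^ (-(13/16 : ℝ)) = ((q:ℝ) ^ (1/16 : ℝ)) ^ 3 / q := by
      rw [← Real.rpow_natCast, ← Real.rpow_mul hq0.le, ← Real.rpow_sub_one hq0.ne']; norm_num
    calc u ^ 2 * (18 * C / q.totient) = 18 * C * (u ^ 3 / q) := by rw [hu]; field_simp
      _ ≤ 18 * C * ((25 * (q:ℝ) ^ (1/16 : ℝ)) ^ 3 / q) := by gcongr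
      _ = _ := by rw [this]; ring
  · have hR := hor.resolve_left hqQ
    refine (S.small2 hq6 hC δ _ hδ0 (min_le_left _ _) (by positivity) hR hB).trans (fin _ (by positivity) ?_)
    have huQ : u ≤ Q := (div_le_self hq0.le hφ).trans (not_le.1 hqQ).le
    have h1 : 72 * C * δ ≤ t := by
      have : δ ≤ t / (72 * C) := min_le_right _ _
      rw [le_div_iff₀ (by positivity)] at this; linarith
    calc u ^ 2 * (72 * C * δ + 36 / (δ * (36 / (δ * t)))) ≤ Q ^ 2 * (t + t) := by
          gcongr; field_simp; rfl
      _ = _ := by rw [ht]; field_simp; ring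

lemma bil_fin (ε : ℝ) (hε : 0 < ε) : ∃ Q R L0 : ℝ, 0 < Q ∧ 0 < R ∧ ∀ (N q : ℕ) (a : ℤ) (β : ℝ), L0 ≤ Real.log N →
    0 < q → q * Real.log N ^ 6 ≤ N → |β| * q * N ≤ Real.log N ^ 6 → IsCoprime a (q:ℤ) →
    (Q ≤ q ∨ R ≤ N * |β|) → ∑ b ∈ Icc 1 N.sqrt, Λ b * ‖FF (a / q + β) N b‖ ≤ ε * N * Real.log N := by
  obtain ⟨Q, R, L0, B0, hQ, hR, h⟩ := EE_fin (ε / 6) (by positivity)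
  set η := ε / 24 with hη
  have hη0 : 0 < η := by positivity
  have ev : ∀ᶠ x : ℝ in atTop, 10000 * x ^ 48 ≤ Real.exp (η / 2 * x) := by
    filter_upwards [(isLittleO_pow_exp_pos_mul_atTop 48 (show 0 < η / 2 by positivity)).bound
      (show (0:ℝ) < 1 / 10000 by norm_num), eventually_ge_atTop 0] with x hx hx0
    rw [Real.norm_of_nonneg (by positivity), Real.norm_of_nonneg (by positivity)] at hx
    linarith
  have ev2 : ∀ᶠ x : ℝ in atTop, B0 ≤ Real.exp (η / 2 * x) :=
    (Real.tendsto_exp_atTop.comp (tendsto_id.const_mul_atTop (by positivity : 0 < η / 2))).eventually_ge_atTop B0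
  obtain ⟨L1, hL1⟩ := (ev.and (ev2.and ((eventually_ge_atTop (max 1 L0)).and (eventually_ge_atTop (192 / ε))))).exists_forall_of_atTop
  refine ⟨Q, R, L1, hQ, hR, fun N q a β hL hq hqN hβ ha hor => ?_⟩
  obtain ⟨hx1, hx2, hx3, hx4⟩ := hL1 _ hL
  set L := Real.log N with hLd
  have hLo : 1 ≤ L := (le_max_left _ _).trans hx3
  have hL0 : 0 < L := by linarith
  have hN0 : 0 < N := by
    rcases Nat.eq_zero_or_pos N with rfl | h
    · simp [hLd] at hL0
    · exact h
  have hN0' : (0:ℝ) < N := by exact_mod_cast hN0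
  set θ := (a / q + β : ℝ) with hθ
  set k0 := ⌈η * L⌉₊ with hk0
  have hk1 : η * L ≤ k0 := Nat.le_ceil _
  have hk2 : (k0:ℝ) < η * L + 1 := Nat.ceil_lt_add_one (by positivity)
  have l2 := Real.log_two_gt_d9
  have l2' := Real.log_two_lt_d9
  have h2k : Real.exp (η / 2 * L) ≤ 2 ^ k0 := by
    rw [← Real.exp_log (show (0:ℝ) < 2 ^ k0 by positivity), Real.log_pow]
    refine Real.exp_le_exp.2 ?_
    nlinarith [show 0 < η * L by positivity]
  set s := N.sqrt with hs
  have hss : s * s ≤ N := Nat.sqrt_le N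
  have key : ∀ m : ℕ, ∑ b ∈ Icc 1 (min s (2 ^ (k0 + 1 + m))), Λ b * ‖FF θ N b‖ ≤ 6 * N * (η * L + 8) + m * (ε / 6 * N) := by
    intro m
    induction m with
    | zero =>
      calc _ ≤ ∑ b ∈ Icc 1 (2 ^ (k0 + 1)), Λ b * ‖FF θ N b‖ := by
            refine sum_le_sum_of_subset_of_nonneg (Icc_subset_Icc le_rfl (min_le_right _ _))
              fun _ _ _ => mul_nonneg vonMangoldt_nonneg (norm_nonneg _)
        _ ≤ ∑ b ∈ Icc 1 (2 ^ (k0 + 1)), 6 * N * (Λ b / b) := by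
            refine sum_le_sum fun b hb => ?_
            have hb0 : (0:ℝ) < b := by exact_mod_cast (mem_Icc.1 hb).1
            calc Λ b * ‖FF θ N b‖ ≤ Λ b * (6 * (N / b)) :=
                  mul_le_mul_of_nonneg_left ((FF_le θ N b).trans (by gcongr; exact Nat.cast_div_le)) vonMangoldt_nonneg
              _ = _ := by ring
        _ ≤ 6 * N * (Real.log ((2 ^ (k0 + 1) : ℕ)) + 6) := by
            rw [← mul_sum]; gcongr; exact mertens _ (by positivity)
        _ ≤ 6 * N * (η * L + 8) + (0:ℕ) * (ε / 6 * N) := by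
            rw [Nat.cast_zero, zero_mul, add_zero]
            refine mul_le_mul_of_nonneg_left ?_ (by positivity)
            push_cast
            rw [Real.log_pow]
            push_cast
            nlinarith [show (0:ℝ) ≤ k0 by positivity]
    | succ m ih =>
      have e0 : ((m + 1 : ℕ):ℝ) * (ε / 6 * N) = m * (ε / 6 * N) + ε / 6 * N := by push_cast; ring
      rw [e0, ← add_assoc, ← add_assoc]
      rcases le_total s (2 ^ (k0 + 1 + m)) with hle | hle
      · rw [min_eq_left hle] at ih
        have : s ≤ 2 ^ (k0 + 1 + m + 1) := hle.trans (Nat.pow_le_pow_right (by norm_num) (by omega))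
        rw [min_eq_left this]
        have : 0 < ε / 6 * N := by positivity
        linarith
      · rw [min_eq_right hle] at ih
        set B := 2 ^ (k0 + m) with hB
        have e1 : 2 ^ (k0 + 1 + m) = 2 * B := by rw [hB]; ring
        have e2 : 2 ^ (k0 + 1 + m + 1) = 4 * B := by rw [hB]; ring
        rw [e1] at ih hle; rw [e2]
        have hBr : Real.exp (η / 2 * L) ≤ B := h2k.trans (by
          rw [hB]; push_cast; exact pow_le_pow_right₀ (by norm_num) (by omega))
        have S : Std N q B a β := ⟨hLo, hq, hqN, hβ, ha, hx1.trans hBr, (Nat.mul_le_mul (by omega) (by omega)).trans hss⟩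
        have hE := h N q B a β S ((le_max_right _ _).trans hx3) (hx2.trans hBr) hor
        refine le_trans ?_ (add_le_add ih hE)
        have : Icc 1 (min s (4 * B)) ⊆ Icc 1 (2 * B) ∪ Ioc (2 * B) (4 * B) := by
          intro x; simp only [mem_Icc, mem_union, mem_Ioc]; omega
        refine (sum_le_sum_of_subset_of_nonneg this
              fun _ _ _ => mul_nonneg vonMangoldt_nonneg (norm_nonneg _)).trans (le_of_eq (sum_union ?_))
        rw [disjoint_left]; intro x; simp only [mem_Icc, mem_Ioc]; omega
  have hk := key (Nat.log 2 N + 1)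
  have hsm : s ≤ 2 ^ (k0 + 1 + (Nat.log 2 N + 1)) := by
    have h1 := Nat.lt_pow_succ_log_self (by norm_num : 1 < 2) N
    have h2 := Nat.sqrt_le_self N
    refine (h2.trans h1.le).trans (Nat.pow_le_pow_right (by norm_num) (by omega))
  rw [min_eq_left hsm] at hk
  refine hk.trans ?_
  have hm : ((Nat.log 2 N + 1 : ℕ):ℝ) ≤ 3 * L := by
    have h1 : ((2:ℝ)) ^ (Nat.log 2 N) ≤ N := by exact_mod_cast Nat.pow_log_le_self 2 hN0.ne'
    have h2 := Real.log_le_log (by positivity) h1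
    rw [Real.log_pow] at h2
    push_cast
    nlinarith [show (0:ℝ) ≤ Nat.log 2 N by positivity]
  rw [div_le_iff₀ hε] at hx4
  have h5 : ((Nat.log 2 N + 1 : ℕ):ℝ) * (ε / 6 * N) ≤ 3 * L * (ε / 6 * N) := by gcongr
  have h6 : 6 * N * (η * L + 8) ≤ ε / 2 * N * L := by
    rw [hη]
    nlinarith
  linarith

lemma Dlog (N : ℕ) : ∑ n ∈ Icc 1 N, Λ n * (Real.log N - Real.log n) ≤ 6 * N := by
  induction N with
  | zero => simp
  | succ N ih =>
    rw [sum_Icc_succ_top (by omega), sub_self, mul_zero, add_zero]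
    rcases Nat.eq_zero_or_pos N with rfl | hN
    · simp
    have hN0 : (0:ℝ) < N := by exact_mod_cast hN
    have h1 : Real.log (N + 1 : ℕ) - Real.log N ≤ 1 / N := by
      rw [← Real.log_div (by positivity) (by positivity)]
      refine (Real.log_le_sub_one_of_pos (by positivity)).trans (le_of_eq ?_)
      push_cast; field_simp; ring
    have h2 : ∑ n ∈ Icc 1 N, Λ n * (Real.log (N + 1 : ℕ) - Real.log n) = ∑ n ∈ Icc 1 N, Λ n * (Real.log N - Real.log n)
        + (∑ n ∈ Icc 1 N, Λ n) * (Real.log (N + 1 : ℕ) - Real.log N) := by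
      rw [sum_mul, ← sum_add_distrib]; exact sum_congr rfl fun _ _ => by ring
    rw [h2]
    have h3 : (∑ n ∈ Icc 1 N, Λ n) * (Real.log (N + 1 : ℕ) - Real.log N) ≤ 6 * N * (1 / N) := by
      refine mul_le_mul (psiN N) h1 (sub_nonneg.2 (Real.log_le_log hN0 (by push_cast; linarith))) (by positivity)
    rw [mul_assoc, mul_one_div_cancel hN0.ne'] at h3
    push_cast at h3 ⊢; linarith

lemma minor (ε : ℝ) (hε : 0 < ε) : ∃ Q R L0 : ℝ, 0 < Q ∧ 0 < R ∧ ∀ (N q : ℕ) (a : ℤ) (β : ℝ), L0 ≤ Real.log N →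
    0 < q → q * Real.log N ^ 6 ≤ N → |β| * q * N ≤ Real.log N ^ 6 → IsCoprime a (q:ℤ) →
    (Q ≤ q ∨ R ≤ N * |β|) → ‖∑ n ∈ Icc 1 N, (Λ n : ℂ) * ee (n * (a / q + β))‖ ≤ ε * N := by
  obtain ⟨Q, R, L0, hQ, hR, h⟩ := bil_fin (ε / 8) (by positivity)
  set c := 8000000 / ε with hc
  have hc0 : 0 < c := by positivity
  refine ⟨max Q ((25 * c) ^ 2), max R c, max (max L0 1) (max (c ^ 2) (172 / ε)), by positivity, by positivity,
    fun N q a β hL hq hqN hβ ha hor => ?_⟩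
  simp only [max_le_iff] at hL hor
  set L := Real.log N with hLd
  obtain ⟨⟨hL0, hL1⟩, hLc, hLε⟩ := hL
  have hb := h N q a β hL0 hq hqN hβ ha (hor.imp And.left And.left)
  have hLp : 0 < L := by linarith
  have hq1 : (1:ℝ) ≤ q := by exact_mod_cast hq
  have hN0 : (0:ℝ) < N := lt_of_lt_of_le (by positivity) hqN
  set θ := (a / q + β : ℝ) with hθ
  have hφ : (1:ℝ) ≤ q.totient := by exact_mod_cast Nat.totient_pos.2 hq
  have hT : ‖∑ n ∈ Icc 1 N, ee (n * θ) * (sel N n : ℂ)‖ ≤ 1000000 * (N * √L + N * L * c⁻¹) := by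
    rcases hor with ⟨_, h1⟩ | ⟨_, h1⟩
    · refine (T1_le N q a β 1 hL1 hq hqN hβ ha zero_le_one (Or.inl le_rfl)).trans ?_
      gcongr
      rw [mul_one, div_eq_mul_inv]
      gcongr
      have h2 := qphi q hq
      have h3 : (q:ℝ) ^ (1/16 : ℝ) ≤ √q := by
        rw [Real.sqrt_eq_rpow]; exact Real.rpow_le_rpow_of_exponent_le hq1 (by norm_num)
      have h4 : 25 * c ≤ √q := Real.le_sqrt_of_sq_le h1
      rw [div_le_iff₀ (by positivity)] at h2
      have h5 : √q * √q ≤ 25 * √q * q.totient := by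
        rw [Real.mul_self_sqrt (by positivity)]; exact h2.trans (by gcongr)
      have h6 : 0 < √(q:ℝ) := by positivity
      nlinarith
    · refine (T1_le N q a β c⁻¹ hL1 hq hqN hβ ha (by positivity) (Or.inr ?_)).trans ?_
      · rw [inv_mul_eq_div, one_le_div hc0]; exact h1
      · gcongr
        exact div_le_self (by positivity) hφ
  have hB := hyperb θ N N.sqrt (Nat.sqrt_le N) (Nat.lt_succ_sqrt N)
  set Bil := ∑ n ∈ Icc 1 N, ee (n * θ) * ((∑ d ∈ n.divisors, Λ d * Λ (n / d) : ℝ) : ℂ)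
  set D := ∑ n ∈ Icc 1 N, ee (n * θ) * ((Λ n * (L - Real.log n) : ℝ) : ℂ) with hD
  have hDn : ‖D‖ ≤ 6 * N := by
    refine (norm_sum_le _ _).trans ((le_of_eq (sum_congr rfl fun n hn => ?_)).trans (Dlog N))
    rw [norm_mul, norm_ee, one_mul, Complex.norm_real, Real.norm_of_nonneg]
    have hn := mem_Icc.1 hn
    have : (0:ℝ) < n := by exact_mod_cast hn.1
    exact mul_nonneg vonMangoldt_nonneg (sub_nonneg.2 (Real.log_le_log this (by exact_mod_cast hn.2)))
  have hN1 : 1 ∈ Icc 1 N := by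
    rw [mem_Icc]; exact ⟨le_rfl, by exact_mod_cast hN0⟩
  have hid : (L:ℂ) * ∑ n ∈ Icc 1 N, (Λ n : ℂ) * ee (n * θ) =
      (∑ n ∈ Icc 1 N, ee (n * θ) * (sel N n : ℂ)) - Bil - D - ee θ * (L:ℂ) ^ 2 := by
    have e : ee θ * (L:ℂ) ^ 2 = ∑ n ∈ Icc 1 N, ee (n * θ) * ((if n = 1 then L ^ 2 else 0 : ℝ) : ℂ) := by
      rw [sum_eq_single_of_mem 1 hN1 fun n _ hn => by simp [hn]]; simp
    rw [e, mul_sum, ← sum_sub_distrib, ← sum_sub_distrib, ← sum_sub_distrib]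
    refine sum_congr rfl fun n hn => ?_
    rw [sel_eq hN0 (mem_Icc.1 hn).1, ← hLd]
    push_cast; ring
  have hL2 : ‖ee θ * (L:ℂ) ^ 2‖ ≤ N := by
    rw [norm_mul, norm_ee, one_mul, norm_pow, Complex.norm_real, Real.norm_of_nonneg hLp.le]
    calc L ^ 2 ≤ L ^ 6 := pow_le_pow_right₀ hL1 (by norm_num)
      _ ≤ q * L ^ 6 := le_mul_of_one_le_left (by positivity) hq1
      _ ≤ N := hqN
  have hn : L * ‖∑ n ∈ Icc 1 N, (Λ n : ℂ) * ee (n * θ)‖ ≤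
      1000000 * (N * √L + N * L * c⁻¹) + (2 * (ε / 8 * N * L) + 36 * N) + 6 * N + N := by
    calc _ = ‖(L:ℂ) * ∑ n ∈ Icc 1 N, (Λ n : ℂ) * ee (n * θ)‖ := by
          rw [norm_mul, Complex.norm_real, Real.norm_of_nonneg hLp.le]
      _ ≤ _ := by
          rw [hid]
          refine (norm_sub_le _ _).trans (add_le_add ((norm_sub_le _ _).trans (add_le_add ((norm_sub_le _ _).trans
            (add_le_add hT (hB.trans ?_))) hDn)) hL2)
          linarith
  refine le_of_mul_le_mul_left (hn.trans ?_) hLp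
  have hsL : √L ≤ L * c⁻¹ := by
    have : c ≤ √L := Real.le_sqrt_of_sq_le hLc
    rw [← div_eq_mul_inv, le_div_iff₀ hc0]
    nlinarith [Real.mul_self_sqrt hLp.le, Real.sqrt_nonneg L]
  have hci : c⁻¹ = ε / 8000000 := by rw [hc, inv_div]
  rw [hci] at hsL ⊢
  have h1 : N * √L ≤ N * (L * (ε / 8000000)) := by gcongr
  rw [div_le_iff₀ hε] at hLε
  have h2 : (N:ℝ) * 172 ≤ N * (L * ε) := by gcongr
  linarith

end Bil4
end PP

namespace PP
section Unif
open ArithmeticFunction Topology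

noncomputable def wt (W n : ℕ) : ℝ := Λ n - (W / W.totient : ℝ) * if n.Coprime W then 1 else 0

noncomputable def GG (W m : ℕ) [NeZero W] : ℝ := ∑ c : ZMod W, |∑ n ∈ Icc 1 m, if (n : ZMod W) = c then wt W n else 0|

lemma GG_lim (W : ℕ) [NeZero W] : Tendsto (fun m : ℕ => GG W m / m) atTop (𝓝 0) := by
  classical
  have hW : 0 < W := Nat.pos_of_ne_zero (NeZero.ne W)
  have hW0 : (0:ℝ) < W := by exact_mod_cast hW
  have hφ : (0:ℝ) < W.totient := by exact_mod_cast Nat.totient_pos.2 hW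
  set r : ZMod W → ℕ → ℝ := fun c m => ∑ n ∈ Icc 1 m, vonMangoldt.residueClass c n with hr
  have hrc : ∀ (c : ZMod W) (n : ℕ), vonMangoldt.residueClass c n = if (n : ZMod W) = c then Λ n else 0 := by
    intro c n; simp [vonMangoldt.residueClass, Set.indicator]
  -- units
  have hu : ∀ c : ZMod W, IsUnit c → Tendsto (fun m : ℕ => |∑ n ∈ Icc 1 m, if (n : ZMod W) = c then wt W n else 0| / m) atTop (𝓝 0) := by
    intro c hc
    have h1 := pnt_ap hc
    have h2 : Tendsto (fun m : ℕ => ((((Ioc 0 (0 + m)).filter (· ≡ c.val [MOD W])).card : ℝ) - m / W) / m) atTop (𝓝 0) := by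
      refine squeeze_zero_norm (fun m => ?_) tendsto_one_div_atTop_nhds_zero_nat
      rw [norm_div, Real.norm_eq_abs, Real.norm_natCast]
      gcongr
      exact card_ap 0 m W c.val hW
    have h3 : Tendsto (fun m : ℕ => (∑ n ∈ Icc 1 m, vonMangoldt.residueClass c n) / (m:ℝ) - (W / W.totient) *
        (((((Ioc 0 (0 + m)).filter (· ≡ c.val [MOD W])).card : ℝ) - m / W) / m + 1 / W)) atTop (𝓝 0) := by
      have := h1.sub ((h2.add_const (1 / (W:ℝ))).const_mul (W / W.totient : ℝ))
      convert this using 2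
      field_simp; ring
    have h4 := h3.abs
    rw [abs_zero] at h4
    refine h4.congr' ?_
    filter_upwards [eventually_gt_atTop 0] with m hm
    have hm0 : (0:ℝ) < m := by exact_mod_cast hm
    rw [← Nat.abs_cast m, ← abs_div, Nat.abs_cast]
    congr 1
    have e : ∀ n : ℕ, (n : ZMod W) = c ↔ n ≡ c.val [MOD W] := fun n => by
      rw [← ZMod.natCast_eq_natCast_iff, ZMod.natCast_zmod_val]
    have e2 : ∑ n ∈ Icc 1 m, (if (n : ZMod W) = c then wt W n else 0) = (∑ n ∈ Icc 1 m, vonMangoldt.residueClass c n)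
        - (W / W.totient) * (((Ioc 0 (0 + m)).filter (· ≡ c.val [MOD W])).card : ℝ) := by
      rw [zero_add, card_filter, Nat.cast_sum, mul_sum, show Ioc 0 m = Icc 1 m from rfl, ← sum_sub_distrib]
      refine sum_congr rfl fun n _ => ?_
      rw [hrc]
      by_cases h : (n : ZMod W) = c
      · have hcop : n.Coprime W := by rw [← ZMod.isUnit_iff_coprime, h]; exact hc
        rw [if_pos h, if_pos h, if_pos ((e n).1 h), wt, if_pos hcop]; simp
      · rw [if_neg h, if_neg h, if_neg (fun h' => h ((e n).2 h'))]; simp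
    rw [e2]; field_simp; ring
  have ht : Tendsto (fun m : ℕ => (∑ n ∈ Icc 1 m, Λ n) / (m:ℝ)) atTop (𝓝 1) := by
    have := pnt_ap (q := 1) (a := 0) (isUnit_of_subsingleton _)
    simpa [vonMangoldt.residueClass, Set.indicator, Subsingleton.elim _ (0 : ZMod 1)] using this
  have hU : Tendsto (fun m : ℕ => ∑ c : ZMod W with IsUnit c, r c m / m) atTop (𝓝 1) := by
    have := tendsto_finsetSum (univ.filter fun c : ZMod W => IsUnit c) (fun c hc => pnt_ap (mem_filter.1 hc).2)
    convert this using 2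
    rw [sum_const, nsmul_eq_mul]
    have : (univ.filter fun c : ZMod W => IsUnit c).card = W.totient := by
      rw [← ZMod.card_units_eq_totient, ← card_univ, ← card_image_of_injective univ (Units.val_injective (α := ZMod W))]
      congr 1; ext c; simp only [mem_filter, mem_univ, true_and, mem_image]; rfl
    rw [this]; field_simp
  have hN : Tendsto (fun m : ℕ => ∑ c : ZMod W with ¬ IsUnit c, r c m / m) atTop (𝓝 0) := by
    have := ht.sub hU
    rw [sub_self] at this
    refine this.congr fun m => ?_
    rw [sub_eq_iff_eq_add', sum_filter_add_sum_filter_not univ (fun c : ZMod W => IsUnit c), ← sum_div]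
    congr 1
    simp only [hr]
    rw [sum_comm]
    refine sum_congr rfl fun n _ => ?_
    simp [hrc]
  have hu2 := tendsto_finsetSum (univ.filter fun c : ZMod W => IsUnit c) (fun c hc => hu c (mem_filter.1 hc).2)
  have := hu2.add hN
  simp only [sum_const_zero, add_zero] at this
  refine this.congr fun m => ?_
  rw [GG, ← sum_filter_add_sum_filter_not univ (fun c : ZMod W => IsUnit c), add_div, sum_div, sum_div]
  congr 1
  refine sum_congr rfl fun c hc => ?_
  have hc := (mem_filter.1 hc).2
  congr 1
  simp only [hr]
  rw [abs_of_nonneg]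
  · refine sum_congr rfl fun n _ => ?_
    rw [hrc]
    split_ifs with h
    · have : ¬ n.Coprime W := by rw [← ZMod.isUnit_iff_coprime, h]; exact hc
      rw [wt, if_neg this]; simp
    · rfl
  · refine sum_nonneg fun n _ => ?_
    split_ifs with h
    · have : ¬ n.Coprime W := by rw [← ZMod.isUnit_iff_coprime, h]; exact hc
      rw [wt, if_neg this]; simp
    · rfl

lemma A_le (W m : ℕ) [NeZero W] (b : ℤ) : ‖∑ n ∈ Icc 1 m, (wt W n : ℂ) * ee (n * (b / W))‖ ≤ GG W m := by
  have hW0 : (W:ℝ) ≠ 0 := by exact_mod_cast NeZero.ne W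
  have e : ∀ n : ℕ, ee (n * (b / W)) = ee ((n : ZMod W).val * (b / W)) := by
    intro n
    rw [ZMod.val_natCast]
    conv_lhs => rw [← Nat.mod_add_div n W]
    have : ((n % W + W * (n / W) : ℕ) : ℝ) * (b / W) = (n % W : ℕ) * (b / W) + ((((n / W : ℕ) : ℤ) * b : ℤ) : ℝ) := by
      rw [Int.cast_mul, Int.cast_natCast, Nat.cast_add, Nat.cast_mul]; field_simp
    rw [this, ee_add, ee_int, mul_one]
  have : ∑ n ∈ Icc 1 m, (wt W n : ℂ) * ee (n * (b / W)) =
      ∑ c : ZMod W, ((∑ n ∈ Icc 1 m, if (n : ZMod W) = c then wt W n else 0 : ℝ) : ℂ) * ee (c.val * (b / W)) := by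
    push_cast
    simp only [sum_mul]
    rw [sum_comm]
    refine sum_congr rfl fun n _ => ?_
    rw [e, sum_eq_single (n : ZMod W) (fun c _ hc => by simp [hc.symm]) (by simp)]; simp
  rw [this]
  refine (norm_sum_le _ _).trans (le_of_eq (sum_congr rfl fun c _ => ?_))
  rw [norm_mul, norm_ee, mul_one, Complex.norm_real, Real.norm_eq_abs]

lemma abel (x : ℕ → ℂ) (γ : ℝ) (N : ℕ) (H : ℝ) (h : ∀ m ≤ N, ‖∑ n ∈ Icc 1 m, x n‖ ≤ H) :
    ‖∑ n ∈ Icc 1 N, x n * ee (n * γ)‖ ≤ H * (1 + 2 * Real.pi * |γ| * N) := by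
  have key : ∀ m : ℕ, ∑ n ∈ Icc 1 m, x n * ee (n * γ) = (∑ n ∈ Icc 1 m, x n) * ee (m * γ) -
      ∑ j ∈ range m, (∑ n ∈ Icc 1 j, x n) * (ee ((j + 1 : ℕ) * γ) - ee (j * γ)) := by
    intro m
    induction m with
    | zero => simp
    | succ m ih => rw [sum_Icc_succ_top (by omega), sum_Icc_succ_top (by omega), sum_range_succ, ih]; ring
  have hH : 0 ≤ H := by simpa using h 0 (by omega)
  rw [key]
  refine (norm_sub_le _ _).trans ?_
  rw [norm_mul, norm_ee, mul_one, mul_add, mul_one]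
  refine add_le_add (h N le_rfl) ((norm_sum_le _ _).trans ?_)
  calc _ ≤ ∑ j ∈ range N, H * (2 * Real.pi * |γ|) := by
        refine sum_le_sum fun j hj => ?_
        rw [norm_mul]
        refine mul_le_mul (h j (mem_range.1 hj).le) ?_ (norm_nonneg _) hH
        rw [ee_sub_sub]
        refine (ee_sub_le _).trans (le_of_eq ?_)
        push_cast; ring_nf
    _ = _ := by rw [sum_const, card_range, nsmul_eq_mul]; ring

lemma model (W N : ℕ) (θ : ℝ) : ‖∑ n ∈ Icc 1 N, ((if n.Coprime W then 1 else 0 : ℝ) : ℂ) * ee (n * θ)‖ * ‖ee (W * θ) - 1‖ ≤ 2 * W := by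
  set f : ℕ → ℂ := fun n => ((if n.Coprime W then 1 else 0 : ℝ) : ℂ) * ee (n * θ) with hf
  have hfn : ∀ n, ‖f n‖ ≤ 1 := by
    intro n; simp only [hf]; rw [norm_mul, norm_ee, mul_one]; split_ifs <;> simp
  have h1 : ∀ n, f n * ee (W * θ) = f (n + W) := by
    intro n; simp only [hf]
    rw [mul_assoc, ← ee_add]; simp only [Nat.coprime_add_self_left]; push_cast; ring_nf
  rw [← norm_mul]
  have h2 : (∑ n ∈ Icc 1 N, f n) * (ee (W * θ) - 1) = ∑ n ∈ Ioc N (N + W), f n - ∑ n ∈ Ioc 0 W, f n := by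
    rw [mul_sub, mul_one, sum_mul]
    simp only [h1]
    have e1 : ∑ n ∈ Icc 1 N, f (n + W) = ∑ n ∈ Ioc W (N + W), f n := by
      rw [← sum_image (s := Icc 1 N) (g := fun n => n + W) (f := f) (fun x _ y _ h => by simpa using h)]
      refine sum_congr ?_ fun _ _ => rfl
      ext n; simp only [mem_image, mem_Icc, mem_Ioc]
      exact ⟨fun ⟨a, h, e⟩ => by omega, fun h => ⟨n - W, by omega, by omega⟩⟩
    rw [e1, show Icc 1 N = Ioc 0 N from rfl]
    have a1 := sum_Ioc_consecutive f (Nat.zero_le W) (Nat.le_add_left W N)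
    have a2 := sum_Ioc_consecutive f (Nat.zero_le N) (Nat.le_add_right N W)
    linear_combination a1 - a2
  rw [h2]
  have h3 : ∀ x y : ℕ, ‖∑ n ∈ Ioc x (x + y), f n‖ ≤ y := fun x y => by
    refine (norm_sum_le_of_le _ fun n _ => hfn n).trans (le_of_eq ?_); simp
  have := norm_sub_le (∑ n ∈ Ioc N (N + W), f n) (∑ n ∈ Ioc 0 W, f n)
  have a := h3 N W
  have b := h3 0 W
  rw [zero_add] at b
  linarith

theorem unif (ε : ℝ) (hε : 0 < ε) : ∃ W N0 : ℕ, 0 < W ∧ ∀ N ≥ N0, ∀ θ : ℝ,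
    ‖∑ n ∈ Icc 1 N, (wt W n : ℂ) * ee (n * θ)‖ ≤ ε * N := by
  obtain ⟨Q, R, L0, hQ, hR, hmin⟩ := minor (ε / 2) (by positivity)
  set W := (⌈Q⌉₊).factorial with hWd
  have hW : 0 < W := Nat.factorial_pos _
  have : NeZero W := ⟨hW.ne'⟩
  have hW0 : (0:ℝ) < W := by exact_mod_cast hW
  have hW1 : (1:ℝ) ≤ W := by exact_mod_cast hW
  set K := max R (W / ε) with hK
  have hK0 : 0 < K := lt_max_of_lt_left hR
  set ε1 := ε / (2 * (1 + 2 * Real.pi * K)) with hε1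
  have hpi := Real.pi_pos
  have hε10 : 0 < ε1 := by positivity
  obtain ⟨m0, hm0⟩ := ((GG_lim W).eventually_le_const hε10).exists_forall_of_atTop
  set C := ∑ m ∈ range (m0 + 1), GG W m with hC
  have hG0 : ∀ m, 0 ≤ GG W m := fun m => sum_nonneg fun _ _ => abs_nonneg _
  have hC0 : 0 ≤ C := sum_nonneg fun _ _ => hG0 _
  have hG : ∀ m, GG W m ≤ ε1 * m + C := by
    intro m
    rcases lt_or_ge m (m0 + 1) with h | h
    · have : GG W m ≤ C := single_le_sum (f := fun m => GG W m) (fun _ _ => hG0 _) (mem_range.2 h)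
      have : 0 ≤ ε1 * m := by positivity
      linarith
    · have h1 := hm0 m (by omega)
      have : (0:ℝ) < m := by exact_mod_cast (by omega : 0 < m)
      rw [div_le_iff₀ this] at h1
      linarith
  have hlog : Tendsto (fun N : ℕ => Real.log N) atTop atTop := Real.tendsto_log_atTop.comp tendsto_natCast_atTop_atTop
  have ev1 : ∀ᶠ N : ℕ in atTop, Real.log N ^ 6 ≤ N := by
    have := (Real.isLittleO_pow_log_id_atTop (n := 6)).bound (show (0:ℝ) < 1 by norm_num)
    filter_upwards [tendsto_natCast_atTop_atTop.eventually this, hlog.eventually_ge_atTop 0] with N hN h0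
    rw [Real.norm_of_nonneg (by positivity), one_mul] at hN
    simpa using hN
  obtain ⟨N0, hN0⟩ := (ev1.and ((hlog.eventually_ge_atTop (max 1 L0)).and
    ((tendsto_natCast_atTop_atTop (R := ℝ)).eventually_ge_atTop (max 1 (C / ε1))))).exists_forall_of_atTop
  refine ⟨W, N0, hW, fun N hN θ => ?_⟩
  obtain ⟨hN6, hL, hNC⟩ := hN0 N hN
  set L := Real.log N with hLd
  have hL1 : 1 ≤ L := (le_max_left _ _).trans hL
  have hLp : 0 < L := by linarith
  have hNp : (0:ℝ) < N := by linarith [(le_max_left _ _).trans hNC]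
  by_cases hA : ∃ b : ℤ, |θ - b / W| ≤ K / N
  · obtain ⟨b, hb⟩ := hA
    have h1 := abel (fun n => (wt W n : ℂ) * ee (n * (b / W))) (θ - b / W) N (ε1 * N + C) (fun m hm => by
      refine (A_le W m b).trans ((hG m).trans ?_)
      gcongr)
    have e : ∑ n ∈ Icc 1 N, (wt W n : ℂ) * ee (n * (b / W)) * ee (n * (θ - b / W)) = ∑ n ∈ Icc 1 N, (wt W n : ℂ) * ee (n * θ) :=
      sum_congr rfl fun n _ => by rw [mul_assoc, ← ee_add]; ring_nf
    rw [e] at h1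
    refine h1.trans ?_
    have hC1 : C ≤ ε1 * N := by
      have := (le_max_right _ _).trans hNC
      rw [div_le_iff₀ hε10] at this; linarith
    rw [le_div_iff₀ hNp] at hb
    calc (ε1 * N + C) * (1 + 2 * Real.pi * |θ - b / W| * N) ≤ (ε1 * N + ε1 * N) * (1 + 2 * Real.pi * K) := by
          rw [mul_assoc (2 * Real.pi)]; gcongr
      _ = ε * N := by rw [hε1]; field_simp; ring
  push Not at hA
  have hsplit : ∑ n ∈ Icc 1 N, (wt W n : ℂ) * ee (n * θ) = ∑ n ∈ Icc 1 N, (Λ n : ℂ) * ee (n * θ) -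
      ((W / W.totient : ℝ) : ℂ) * ∑ n ∈ Icc 1 N, ((if n.Coprime W then 1 else 0 : ℝ) : ℂ) * ee (n * θ) := by
    rw [mul_sum, ← sum_sub_distrib]
    refine sum_congr rfl fun n _ => ?_
    rw [wt]; push_cast; ring
  have hφ : (1:ℝ) ≤ W.totient := by exact_mod_cast Nat.totient_pos.2 hW
  have hmod : ‖((W / W.totient : ℝ) : ℂ) * ∑ n ∈ Icc 1 N, ((if n.Coprime W then 1 else 0 : ℝ) : ℂ) * ee (n * θ)‖ ≤ ε / 2 * N := by
    have h1 := model W N θ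
    have h2 := hA (round (W * θ))
    set b := round (W * θ) with hb
    have h3 : ee (W * θ) = ee (W * θ - b) := by
      conv_lhs => rw [show (W * θ : ℝ) = (W * θ - b) + b by ring, ee_add, ee_int, mul_one]
    have h4 := ee_sub_ge (abs_sub_round (W * θ))
    rw [← hb, ← h3] at h4
    have h5 : (W * θ - b : ℝ) = W * (θ - b / W) := by field_simp
    rw [h5, abs_mul, abs_of_pos hW0] at h4
    have h6 : 4 * (W * (K / N)) ≤ ‖ee (W * θ) - 1‖ := by
      refine le_trans ?_ h4; gcongr
    set X := ‖∑ n ∈ Icc 1 N, ((if n.Coprime W then 1 else 0 : ℝ) : ℂ) * ee (n * θ)‖ with hX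
    have hX0 : 0 ≤ X := norm_nonneg _
    have h7 : X * (4 * (W * (K / N))) ≤ 2 * W := le_trans (by gcongr) h1
    have h8 : X * (2 * K) ≤ N := by
      have : X * (4 * (W * (K / N))) = 2 * W * (X * (2 * K) / N) := by ring
      rw [this] at h7
      have := le_of_mul_le_mul_left (h7.trans_eq (mul_one _).symm) (by positivity)
      rwa [div_le_one hNp] at this
    have h9 : (W:ℝ) ≤ K * ε := by
      rw [← div_le_iff₀ hε]; exact le_max_right _ _
    rw [norm_mul, Complex.norm_real, Real.norm_of_nonneg (by positivity), ← hX]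
    calc W / W.totient * X ≤ W * X := by gcongr; exact div_le_self hW0.le hφ
      _ ≤ K * ε * X := by gcongr
      _ ≤ ε / 2 * N := by nlinarith
  have hmaj : ‖∑ n ∈ Icc 1 N, (Λ n : ℂ) * ee (n * θ)‖ ≤ ε / 2 * N := by
    set n := ⌊N / L ^ 6⌋₊ with hn
    have hn0 : 0 < n := Nat.floor_pos.2 ((one_le_div (by positivity)).2 hN6)
    obtain ⟨ρ, hρ, hden⟩ := Real.exists_rat_abs_sub_le_and_den_le θ hn0
    have hq := ρ.den_pos
    have hq0 : (0:ℝ) < ρ.den := by exact_mod_cast hq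
    have hρc : (ρ:ℝ) = (ρ.num : ℝ) / ρ.den := Rat.cast_def ρ
    have hθ : θ = ρ.num / ρ.den + (θ - ρ) := by rw [hρc]; ring
    rw [hθ]
    refine hmin N ρ.den ρ.num (θ - ρ) ((le_max_right _ _).trans hL) hq ?_ ?_ ?_ ?_
    · have h1 : (ρ.den : ℝ) ≤ N / L ^ 6 := le_trans (by exact_mod_cast hden) (Nat.floor_le (by positivity))
      rwa [le_div_iff₀ (by positivity)] at h1
    · have h1 : N / L ^ 6 < n + 1 := Nat.lt_floor_add_one _
      rw [div_lt_iff₀ (by positivity)] at h1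
      rw [le_div_iff₀ (by positivity)] at hρ
      have h2 : 0 ≤ |θ - ρ| * ρ.den := by positivity
      calc |θ - ρ| * ρ.den * N ≤ |θ - ρ| * ρ.den * ((n + 1) * L ^ 6) := by gcongr
        _ = |θ - ρ| * ((n + 1) * ρ.den) * L ^ 6 := by ring
        _ ≤ 1 * L ^ 6 := by gcongr
        _ = _ := one_mul _
    · exact Int.isCoprime_iff_gcd_eq_one.2 (by simpa [Int.gcd, Nat.Coprime] using ρ.reduced)
    · by_cases hqQ : Q ≤ ρ.den
      · exact Or.inl hqQ
      right
      have hdvd : ρ.den ∣ W := Nat.dvd_factorial hq (by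
        have : (ρ.den:ℝ) ≤ ⌈Q⌉₊ := (not_le.1 hqQ).le.trans (Nat.le_ceil Q)
        exact_mod_cast this)
      obtain ⟨t, ht⟩ := hdvd
      have ht0 : (t:ℝ) ≠ 0 := by
        rintro h
        have : t = 0 := by exact_mod_cast h
        rw [this] at ht; omega
      have h1 := hA (ρ.num * t)
      have h2 : (((ρ.num * t : ℤ) : ℝ) / W) = ρ := by
        rw [hρc, ht]; push_cast; field_simp
      rw [h2, div_lt_iff₀ hNp] at h1
      have : R ≤ K := le_max_left _ _
      linarith
  rw [hsplit]
  refine (norm_sub_le _ _).trans ?_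
  linarith

end Unif
end PP

namespace PP
section Interp

lemma geo (s : ℝ) (hs : 0 < s) : ∃ D : ℝ, 0 < D ∧ ∀ w : ℝ, 0 ≤ w → ∀ J : Finset ℤ,
    ∑ j ∈ J.filter (fun j => (2:ℝ) ^ j < w), ((2:ℝ) ^ j) ^ s ≤ D * w ^ s := by
  set ρ := (2:ℝ) ^ s with hρ
  have hρ1 : 1 < ρ := Real.one_lt_rpow (by norm_num) hs
  have hρ0 : 0 < ρ := by linarith
  have hi0 : 0 ≤ ρ⁻¹ := by positivity
  have hi1 : ρ⁻¹ < 1 := inv_lt_one_of_one_lt₀ hρ1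
  have hz : ∀ j : ℤ, ((2:ℝ) ^ j) ^ s = ρ ^ j := fun j => by
    rw [hρ, ← Real.rpow_intCast, ← Real.rpow_intCast, ← Real.rpow_mul (by norm_num), ← Real.rpow_mul (by norm_num), mul_comm]
  refine ⟨(1 - ρ⁻¹)⁻¹, inv_pos.2 (by linarith), fun w hw J => ?_⟩
  rcases hw.eq_or_lt with rfl | hw
  · rw [filter_false_of_mem fun j _ => not_lt.2 (by positivity), Real.zero_rpow hs.ne']; simp
  obtain ⟨n, hn1, hn2⟩ := exists_mem_Ico_zpow hw (by norm_num : (1:ℝ) < 2)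
  set J' := J.filter (fun j => (2:ℝ) ^ j < w) with hJ'
  have hle : ∀ j ∈ J', j ≤ n := fun j hj => by
    have := (zpow_lt_zpow_iff_right₀ (by norm_num : (1:ℝ) < 2)).1 ((mem_filter.1 hj).2.trans hn2)
    omega
  have h1 : ∑ j ∈ J', ((2:ℝ) ^ j) ^ s = ρ ^ n * ∑ i ∈ J'.image (fun j => (n - j).toNat), ρ⁻¹ ^ i := by
    rw [sum_image (fun x hx y hy h => by
      have := hle x hx
      have := hle y hy
      beta_reduce at h
      omega), mul_sum]
    refine sum_congr rfl fun j hj => ?_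
    have e : j = n - ((n - j).toNat : ℤ) := by
      have := hle j hj
      omega
    rw [hz]
    conv_lhs => rw [e]
    rw [zpow_sub₀ hρ0.ne', zpow_natCast, inv_pow, div_eq_mul_inv]
  rw [h1, mul_comm]
  refine mul_le_mul ?_ ?_ (by positivity) (inv_nonneg.2 (by linarith))
  · rw [← tsum_geometric_of_lt_one hi0 hi1]
    exact (summable_geometric_of_lt_one hi0 hi1).sum_le_tsum _ fun _ _ => by positivity
  · rw [← hz]
    exact Real.rpow_le_rpow (by positivity) hn1 hs.le

variable {ι : Type} [Fintype ι]

def HH (h : ι → ι → ℝ) (g : ι → ℝ) (x : ι) : ℝ := ∑ y, h x y * g y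

lemma interp_gt (r A : ℝ) (hr : 2 < r) (hA : 0 < A) : ∃ D : ℝ, 0 < D ∧ ∀ (ι : Type) [Fintype ι] (h : ι → ι → ℝ) (η : ℝ),
    (∀ x, ∑ y, |h x y| ≤ A) → (∀ g, ∑ x, HH h g x ^ 2 ≤ η * ∑ x, g x ^ 2) →
    ∀ g, ∑ x, |HH h g x| ^ r ≤ D * η * ∑ x, |g x| ^ r := by
  obtain ⟨D, hD, hgeo⟩ := geo (r - 2) (by linarith)
  refine ⟨4 * (4 * A) ^ (r - 2) * D, by positivity, fun ι _ h η hrow hl2 g => ?_⟩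
  have hη : ∀ g : ι → ℝ, 0 ≤ η * ∑ x, g x ^ 2 := fun g => le_trans (sum_nonneg fun _ _ => sq_nonneg _) (hl2 g)
  set gj : ℤ → ι → ℝ := fun j y => if (2:ℝ) ^ j < |g y| then g y else 0 with hgj
  have hex : ∀ x, ∃ j : ℤ, |HH h g x| ^ r ≤ 4 * (4 * A) ^ (r - 2) * ((2:ℝ) ^ j) ^ (r - 2) * HH h (gj j) x ^ 2 := by
    intro x
    rcases (abs_nonneg (HH h g x)).eq_or_lt with h0 | h0
    · exact ⟨0, by rw [← h0, Real.zero_rpow (by linarith)]; positivity⟩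
    set v := |HH h g x| with hv
    obtain ⟨j, hj1, hj2⟩ := exists_mem_Ico_zpow (show 0 < v / (2 * A) by positivity) (by norm_num : (1:ℝ) < 2)
    refine ⟨j, ?_⟩
    rw [le_div_iff₀ (by positivity)] at hj1
    rw [div_lt_iff₀ (by positivity), zpow_add_one₀ (by norm_num)] at hj2
    have hd : |HH h g x - HH h (gj j) x| ≤ A * (2:ℝ) ^ j := by
      rw [HH, HH, ← sum_sub_distrib]
      refine (abs_sum_le_sum_abs _ _).trans (le_trans ?_ (mul_le_mul_of_nonneg_right (hrow x) (by positivity)))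
      rw [sum_mul]
      refine sum_le_sum fun y _ => ?_
      rw [← mul_sub, abs_mul]
      gcongr
      simp only [hgj]
      split_ifs with hy
      · rw [sub_self, abs_zero]; positivity
      · rw [sub_zero]; exact not_lt.1 hy
    have h2 : v ≤ 2 * |HH h (gj j) x| := by
      have := abs_sub_abs_le_abs_sub (HH h g x) (HH h (gj j) x)
      rw [← hv] at this
      linarith
    calc v ^ r = v ^ (r - 2) * v ^ 2 := by
          rw [← Real.rpow_natCast, ← Real.rpow_add h0]; norm_num
      _ ≤ (4 * A * (2:ℝ) ^ j) ^ (r - 2) * (2 * |HH h (gj j) x|) ^ 2 := by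
          gcongr
          · linarith
      _ = _ := by
          rw [Real.mul_rpow (by positivity) (by positivity), mul_pow, sq_abs]; ring
  choose j hj using hex
  set J := univ.image j with hJ
  calc ∑ x, |HH h g x| ^ r ≤ ∑ x, ∑ i ∈ J, 4 * (4 * A) ^ (r - 2) * ((2:ℝ) ^ i) ^ (r - 2) * HH h (gj i) x ^ 2 := by
        refine sum_le_sum fun x _ => (hj x).trans ?_
        exact single_le_sum (f := fun i => 4 * (4 * A) ^ (r - 2) * ((2:ℝ) ^ i) ^ (r - 2) * HH h (gj i) x ^ 2)
          (fun _ _ => by positivity) (mem_image_of_mem _ (mem_univ x))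
    _ = ∑ i ∈ J, 4 * (4 * A) ^ (r - 2) * ((2:ℝ) ^ i) ^ (r - 2) * ∑ x, HH h (gj i) x ^ 2 := by
        rw [sum_comm]; simp only [mul_sum]
    _ ≤ ∑ i ∈ J, 4 * (4 * A) ^ (r - 2) * ((2:ℝ) ^ i) ^ (r - 2) * (η * ∑ x, gj i x ^ 2) := by
        gcongr with i; exact hl2 _
    _ = 4 * (4 * A) ^ (r - 2) * η * ∑ x, g x ^ 2 * ∑ i ∈ J.filter (fun i => (2:ℝ) ^ i < |g x|), ((2:ℝ) ^ i) ^ (r - 2) := by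
        simp only [mul_sum, sum_filter]
        rw [sum_comm]
        refine sum_congr rfl fun x _ => sum_congr rfl fun i _ => ?_
        simp only [hgj]
        split_ifs <;> ring
    _ ≤ 4 * (4 * A) ^ (r - 2) * D * η * ∑ x, |g x| ^ r := by
        rcases isEmpty_or_nonempty ι with hi | ⟨⟨x0⟩⟩
        · simp
        have hη0 : 0 ≤ η := by
          classical
          have := hη (Pi.single x0 1)
          simpa [Pi.single_apply] using this
        have : ∑ x, g x ^ 2 * ∑ i ∈ J.filter (fun i => (2:ℝ) ^ i < |g x|), ((2:ℝ) ^ i) ^ (r - 2) ≤ D * ∑ x, |g x| ^ r := by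
          rw [mul_sum]
          refine sum_le_sum fun x _ => ?_
          refine (mul_le_mul_of_nonneg_left (hgeo _ (abs_nonneg _) J) (sq_nonneg _)).trans (le_of_eq ?_)
          rcases (abs_nonneg (g x)).eq_or_lt with h0 | h0
          · rw [← h0, ← sq_abs, ← h0, Real.zero_rpow (by linarith), Real.zero_rpow (by linarith)]; simp
          · have : |g x| ^ r = |g x| ^ (r - 2) * |g x| ^ 2 := by
              rw [← Real.rpow_natCast, ← Real.rpow_add h0]; norm_num
            rw [this, sq_abs]; ring
        calc _ ≤ 4 * (4 * A) ^ (r - 2) * η * (D * ∑ x, |g x| ^ r) := by gcongr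
          _ = _ := by ring

/-- the transposed l2 bound -/
lemma l2_tr (h : ι → ι → ℝ) (η : ℝ) (hl2 : ∀ g, ∑ x, HH h g x ^ 2 ≤ η * ∑ x, g x ^ 2) (g : ι → ℝ) :
    ∑ x, HH (fun x y => h y x) g x ^ 2 ≤ η * ∑ x, g x ^ 2 := by
  set k := HH (fun x y => h y x) g with hk
  set S := ∑ x, k x ^ 2 with hS
  have h1 : S = ∑ y, g y * HH h k y := by
    rw [hS]
    simp only [HH, mul_sum]
    rw [sum_comm]
    refine sum_congr rfl fun x _ => ?_
    rw [pow_two]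
    nth_rw 1 [hk]
    rw [HH, sum_mul]
    exact sum_congr rfl fun y _ => by ring
  have h2 : S ^ 2 ≤ (∑ x, g x ^ 2) * (η * S) := by
    conv_lhs => rw [h1]
    exact (sum_mul_sq_le_sq_mul_sq _ _ _).trans (mul_le_mul_of_nonneg_left (hl2 k) (sum_nonneg fun _ _ => sq_nonneg _))
  have hS0 : 0 ≤ S := sum_nonneg fun _ _ => sq_nonneg _
  rcases hS0.eq_or_lt with h0 | h0
  · rw [← h0]; exact le_trans (sum_nonneg fun _ _ => sq_nonneg _) (hl2 g)
  · refine le_of_mul_le_mul_left ?_ h0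
    linarith

theorem interp (r A ε : ℝ) (hr : 1 < r) (hA : 0 < A) (hε : 0 < ε) : ∃ η : ℝ, 0 < η ∧ ∀ (ι : Type) [Fintype ι] (h : ι → ι → ℝ),
    (∀ x, ∑ y, |h x y| ≤ A) → (∀ y, ∑ x, |h x y| ≤ A) → (∀ g, ∑ x, HH h g x ^ 2 ≤ η * ∑ x, g x ^ 2) →
    ∀ g, ∑ x, |HH h g x| ^ r ≤ ε * ∑ x, |g x| ^ r := by
  rcases lt_trichotomy r 2 with h2 | rfl | h2
  · set r' := r / (r - 1) with hr'
    have hr0 : 0 < r - 1 := by linarith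
    have hc : r.HolderConjugate r' := (Real.holderConjugate_iff_eq_conjExponent hr).2 hr'
    have hr'2 : 2 < r' := by rw [hr', lt_div_iff₀ hr0]; linarith
    obtain ⟨D, hD, hgt⟩ := interp_gt r' A hr'2 hA
    refine ⟨(ε ^ (1 / r)) ^ r' / D, by positivity, fun ι _ h hrow hcol hl2 g => ?_⟩
    set S := ∑ x, |HH h g x| ^ r with hS
    set φ : ι → ℝ := fun x => SignType.sign (HH h g x) * |HH h g x| ^ (r - 1) with hφ
    have hφa : ∀ x, |φ x| = |HH h g x| ^ (r - 1) := by
      intro x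
      simp only [hφ]
      rw [abs_mul, abs_of_nonneg (Real.rpow_nonneg (abs_nonneg _) _)]
      rcases eq_or_ne (HH h g x) 0 with h0 | h0
      · rw [h0, abs_zero, Real.zero_rpow hr0.ne', mul_zero]
      · rcases lt_or_gt_of_ne h0 with h1 | h1 <;> simp [h1]
    have hφr : ∀ x, |φ x| ^ r' = |HH h g x| ^ r := by
      intro x
      rw [hφa, ← Real.rpow_mul (abs_nonneg _), hr', mul_div_cancel₀ _ hr0.ne']
    have hφH : ∀ x, φ x * HH h g x = |HH h g x| ^ r := by
      intro x
      simp only [hφ]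
      rw [mul_right_comm, sign_mul_self]
      rcases (abs_nonneg (HH h g x)).eq_or_lt with h0 | h0
      · rw [← h0, zero_mul, Real.zero_rpow (by linarith)]
      · nth_rw 1 [← Real.rpow_one (|HH h g x|)]
        rw [← Real.rpow_add h0]; congr 1; ring
    have h1 : S = ∑ y, g y * HH (fun x y => h y x) φ y := by
      rw [hS, sum_congr rfl fun x _ => (hφH x).symm]
      clear_value φ
      simp only [HH, mul_sum]
      rw [sum_comm]
      exact sum_congr rfl fun x _ => sum_congr rfl fun y _ => by ring
    have h2 := Real.inner_le_Lp_mul_Lq univ g (HH (fun x y => h y x) φ) hc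
    have h3 := hgt ι (fun x y => h y x) _ hcol (l2_tr h _ hl2) φ
    rw [← h1] at h2
    simp only [hφr] at h3
    rw [mul_div_cancel₀ _ hD.ne', ← hS] at h3
    have hS0 : 0 ≤ S := sum_nonneg fun _ _ => by positivity
    set G := ∑ x, |g x| ^ r with hG
    have hG0 : 0 ≤ G := sum_nonneg fun _ _ => by positivity
    have hr'0 : 0 < r' := by linarith
    have h4 : S ≤ G ^ (1 / r) * (ε ^ (1 / r) * S ^ (1 / r')) := by
      refine h2.trans (mul_le_mul_of_nonneg_left ?_ (by positivity))
      calc _ ≤ ((ε ^ (1 / r)) ^ r' * S) ^ (1 / r') := by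
            refine Real.rpow_le_rpow (sum_nonneg fun _ _ => by positivity) h3 (by positivity)
        _ = _ := by
            rw [Real.mul_rpow (by positivity) hS0, ← Real.rpow_mul (by positivity), mul_one_div_cancel hr'0.ne', Real.rpow_one]
    rcases hS0.eq_or_lt with h0 | h0
    · rw [← h0]; positivity
    have h5 : S ^ (1 / r) ≤ (ε * G) ^ (1 / r) := by
      rw [Real.mul_rpow hε.le hG0]
      have e : S = S ^ (1 / r) * S ^ (1 / r') := by
        rw [← Real.rpow_add h0, one_div, one_div, hc.inv_add_inv_eq_one, Real.rpow_one]
      have : S ^ (1 / r) * S ^ (1 / r') ≤ (ε ^ (1 / r) * G ^ (1 / r)) * S ^ (1 / r') := by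
        rw [← e]; linarith
      exact le_of_mul_le_mul_right this (by positivity)
    exact (Real.rpow_le_rpow_iff hS0 (by positivity) (by positivity)).1 h5
  · refine ⟨ε, hε, fun ι _ h _ _ hl2 g => ?_⟩
    simpa using hl2 g
  · obtain ⟨D, hD, hgt⟩ := interp_gt r A h2 hA
    refine ⟨ε / D, by positivity, fun ι _ h hrow _ hl2 g => ?_⟩
    have := hgt ι h _ hrow hl2 g
    rwa [mul_div_cancel₀ _ hD.ne'] at this

end Interp
end PP

namespace PP
section Cyc
open ZMod

lemma parseval {P : ℕ} [NeZero P] (a : ZMod P → ℂ) :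
    ∑ ξ, ‖∑ x, a x * stdAddChar (x * ξ)‖ ^ 2 = P * ∑ x, ‖a x‖ ^ 2 := by
  have hc : ∀ z : ZMod P, (starRingEnd ℂ) (stdAddChar z) = stdAddChar (-z) := fun z => by
    rw [AddChar.map_neg_eq_conj]
  have h : ((∑ ξ, ‖∑ x, a x * stdAddChar (x * ξ)‖ ^ 2 : ℝ) : ℂ) = ((P * ∑ x, ‖a x‖ ^ 2 : ℝ) : ℂ) := by
    push_cast
    calc _ = ∑ ξ : ZMod P, ∑ x, ∑ y, a x * (starRingEnd ℂ) (a y) * stdAddChar (ξ * (x - y)) := by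
          refine sum_congr rfl fun ξ _ => ?_
          rw [← Complex.mul_conj', map_sum, sum_mul_sum]
          refine sum_congr rfl fun x _ => sum_congr rfl fun y _ => ?_
          rw [map_mul (starRingEnd ℂ), hc, mul_sub, sub_eq_add_neg, AddChar.map_add_eq_mul, mul_comm x ξ, mul_comm y ξ]
          ring
      _ = ∑ x, ∑ y, a x * (starRingEnd ℂ) (a y) * ∑ ξ : ZMod P, stdAddChar (ξ * (x - y)) := by
          rw [sum_comm]
          refine sum_congr rfl fun x _ => ?_
          rw [sum_comm]
          simp only [mul_sum]
      _ = _ := by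
          rw [mul_sum]
          refine sum_congr rfl fun x _ => ?_
          simp only [AddChar.sum_mulShift _ (isPrimitive_stdAddChar P), sub_eq_zero, ZMod.card]
          rw [sum_eq_single x (fun y _ h => by rw [if_neg h.symm]; simp) (by simp), if_pos rfl, Complex.mul_conj', mul_comm]
  exact_mod_cast h

lemma cyc_l2 {P : ℕ} [NeZero P] (N : ℕ) (k : ℕ → ℝ) (δ : ℝ)
    (hk : ∀ θ : ℝ, ‖∑ n ∈ Icc 1 N, (k n : ℂ) * ee (n * θ)‖ ≤ δ) (g : ZMod P → ℝ) :
    ∑ x, (∑ n ∈ Icc 1 N, k n * g (x + n)) ^ 2 ≤ δ ^ 2 * ∑ x, g x ^ 2 := by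
  have hP : (0:ℝ) < P := Nat.cast_pos.2 (NeZero.pos P)
  have h1 := parseval (P := P) (fun x => ((∑ n ∈ Icc 1 N, k n * g (x + n) : ℝ) : ℂ))
  have h2 := parseval (P := P) (fun x => (g x : ℂ))
  simp only [Complex.norm_real, Real.norm_eq_abs, sq_abs] at h1 h2
  refine le_of_mul_le_mul_left ?_ hP
  rw [← h1, mul_left_comm, ← h2, mul_sum]
  refine sum_le_sum fun ξ _ => ?_
  rw [← mul_pow]
  refine pow_le_pow_left₀ (norm_nonneg _) ?_ 2
  have e : ∑ x, ((∑ n ∈ Icc 1 N, k n * g (x + n) : ℝ) : ℂ) * stdAddChar (x * ξ)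
      = (∑ n ∈ Icc 1 N, (k n : ℂ) * ee (n * (-(ξ.val / P : ℝ)))) * ∑ x, (g x : ℂ) * stdAddChar (x * ξ) := by
    push_cast
    simp only [sum_mul]
    rw [sum_comm]
    refine sum_congr rfl fun n _ => ?_
    rw [mul_sum, ← Equiv.sum_comp (Equiv.addRight (n : ZMod P)) (fun x => (k n : ℂ) * ee (n * (-(ξ.val / P : ℝ))) * ((g x : ℂ) * stdAddChar (x * ξ)))]
    refine sum_congr rfl fun x _ => ?_
    have : stdAddChar ((n : ZMod P) * ξ) = ee (n * (ξ.val / P : ℝ)) := by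
      have := stdAddChar_coe (N := P) ((n * ξ.val : ℕ) : ℤ)
      push_cast at this
      rw [natCast_zmod_val] at this
      rw [this, ee]
      congr 1
      push_cast
      ring
    rw [Equiv.coe_addRight, add_mul, AddChar.map_add_eq_mul, this]
    have h0 : ee (n * (-(ξ.val / P : ℝ))) * ee (n * (ξ.val / P : ℝ)) = 1 := by
      rw [← ee_add, mul_neg, neg_add_cancel, ee_zero]
    linear_combination -(k n * g (x + n) * stdAddChar (x * ξ)) * h0
  rw [e, norm_mul]
  exact mul_le_mul_of_nonneg_right (hk _) (norm_nonneg _)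

lemma cyc (r A ε : ℝ) (hr : 1 < r) (hA : 0 < A) (hε : 0 < ε) : ∃ δ : ℝ, 0 < δ ∧ ∀ (P N : ℕ) [NeZero P] (k : ℕ → ℝ),
    ∑ n ∈ Icc 1 N, |k n| ≤ A → (∀ θ : ℝ, ‖∑ n ∈ Icc 1 N, (k n : ℂ) * ee (n * θ)‖ ≤ δ) →
    ∀ g : ZMod P → ℝ, ∑ x, |∑ n ∈ Icc 1 N, k n * g (x + n)| ^ r ≤ ε * ∑ x, |g x| ^ r := by
  obtain ⟨η, hη, H⟩ := interp r A ε hr hA hε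
  refine ⟨√η, Real.sqrt_pos.2 hη, fun P N _ k hkA hk g => ?_⟩
  set h : ZMod P → ZMod P → ℝ := fun x y => ∑ n ∈ Icc 1 N, if y = x + n then k n else 0 with hh
  have hHH : ∀ g x, HH h g x = ∑ n ∈ Icc 1 N, k n * g (x + n) := fun g x => by
    simp only [HH, hh, sum_mul]
    rw [sum_comm]
    exact sum_congr rfl fun n _ => by simp
  have hab : ∀ x y, |h x y| ≤ ∑ n ∈ Icc 1 N, if y = x + n then |k n| else 0 := fun x y =>
    (abs_sum_le_sum_abs _ _).trans (le_of_eq (sum_congr rfl fun n _ => by split_ifs <;> simp))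
  have := H (ZMod P) h (fun x => ?_) (fun y => ?_) (fun g => ?_) g
  · simpa only [hHH] using this
  · refine (sum_le_sum fun y _ => hab x y).trans ?_
    rw [sum_comm]; simpa using hkA
  · refine (sum_le_sum fun x _ => hab x y).trans ?_
    rw [sum_comm]; simpa [← sub_eq_iff_eq_add] using hkA
  · simpa only [hHH, Real.sq_sqrt hη.le] using cyc_l2 N k _ hk g

lemma add_rpow_le (r : ℝ) (hr : 0 < r) (a b : ℝ) (ha : 0 ≤ a) (hb : 0 ≤ b) : (a + b) ^ r ≤ 2 ^ r * (a ^ r + b ^ r) := by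
  have h1 : (a + b) ^ r ≤ (2 * max a b) ^ r :=
    Real.rpow_le_rpow (by positivity) (by linarith [le_max_left a b, le_max_right a b]) hr.le
  rw [Real.mul_rpow (by norm_num) (by positivity)] at h1
  refine h1.trans (mul_le_mul_of_nonneg_left ?_ (by positivity))
  have := Real.rpow_nonneg ha r
  have := Real.rpow_nonneg hb r
  rcases max_cases a b with h | h <;> rw [h.1] <;> linarith

lemma normle {𝕜 : Type*} [RCLike 𝕜] (z : 𝕜) : ‖z‖ ≤ |RCLike.re z| + |RCLike.im z| := by
  refine abs_le_of_sq_le_sq' ?_ (by positivity) |>.2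
  rw [RCLike.norm_sq_eq_def]
  nlinarith [abs_mul_abs_self (RCLike.re z), abs_mul_abs_self (RCLike.im z), abs_nonneg (RCLike.re z), abs_nonneg (RCLike.im z), mul_nonneg (abs_nonneg (RCLike.re z)) (abs_nonneg (RCLike.im z))]

lemma line {𝕜 : Type*} [RCLike 𝕜] (r A ε : ℝ) (hr : 1 < r) (hA : 0 < A) (hε : 0 < ε) : ∃ δ : ℝ, 0 < δ ∧ ∀ (N : ℕ) (k : ℕ → ℝ), 0 < N →
    ∑ n ∈ Icc 1 N, |k n| ≤ A → (∀ θ : ℝ, ‖∑ n ∈ Icc 1 N, (k n : ℂ) * ee (n * θ)‖ ≤ δ) →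
    ∀ g : ℕ → 𝕜, ∑ m ∈ range N, ‖∑ n ∈ Icc 1 N, (k n : 𝕜) * g (m + n)‖ ^ r ≤ ε * ∑ m ∈ range (2 * N), ‖g m‖ ^ r := by
  obtain ⟨δ, hδ, H⟩ := cyc r A (ε / (2 ^ r * 2)) hr hA (by positivity)
  refine ⟨δ, hδ, fun N k hN hkA hk g => ?_⟩
  have : NeZero (2 * N) := ⟨by omega⟩
  have hre : ∀ G : ℕ → ℝ, ∑ m ∈ range N, |∑ n ∈ Icc 1 N, k n * G (m + n)| ^ r ≤ ε / (2 ^ r * 2) * ∑ m ∈ range (2 * N), |G m| ^ r := by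
    intro G
    have h1 := H (2 * N) N k hkA hk (fun x => G x.val)
    have hs : ∀ F : ZMod (2 * N) → ℝ, ∑ x, F x = ∑ m ∈ range (2 * N), F m := fun F => by
      refine sum_nbij' (fun x => x.val) (fun m => (m : ZMod (2 * N))) (fun x _ => mem_range.2 x.val_lt) (by simp) (by simp) (fun m hm => ?_) (by simp)
      simp [Nat.mod_eq_of_lt (mem_range.1 hm)]
    rw [hs, hs] at h1
    have e : ∀ m ∈ range (2 * N), |G (m : ZMod (2 * N)).val| ^ r = |G m| ^ r := fun m hm => by
      rw [ZMod.val_natCast, Nat.mod_eq_of_lt (mem_range.1 hm)]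
    rw [sum_congr rfl e] at h1
    refine le_trans ?_ h1
    rw [← sum_range_add_sum_Ico _ (by omega : N ≤ 2 * N)]
    refine le_trans (le_of_eq (sum_congr rfl fun m hm => ?_)) (le_add_of_nonneg_right (sum_nonneg fun _ _ => by positivity))
    congr 2
    refine sum_congr rfl fun n hn => ?_
    rw [mem_range] at hm
    rw [mem_Icc] at hn
    rw [← Nat.cast_add, ZMod.val_natCast, Nat.mod_eq_of_lt (by omega)]
  have h2 : ∀ m, ‖∑ n ∈ Icc 1 N, (k n : 𝕜) * g (m + n)‖ ^ r ≤ 2 ^ r * (|∑ n ∈ Icc 1 N, k n * RCLike.re (g (m + n))| ^ r + |∑ n ∈ Icc 1 N, k n * RCLike.im (g (m + n))| ^ r) := by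
    intro m
    refine le_trans (Real.rpow_le_rpow (norm_nonneg _) (normle _) (by linarith)) ?_
    simp only [map_sum, RCLike.re_ofReal_mul, RCLike.im_ofReal_mul]
    exact add_rpow_le r (by linarith) _ _ (abs_nonneg _) (abs_nonneg _)
  have hR := hre (fun m => RCLike.re (g m))
  have hI := hre (fun m => RCLike.im (g m))
  have hR' : ∑ m ∈ range (2 * N), |RCLike.re (g m)| ^ r ≤ ∑ m ∈ range (2 * N), ‖g m‖ ^ r :=
    sum_le_sum fun m _ => Real.rpow_le_rpow (abs_nonneg _) (RCLike.abs_re_le_norm _) (by linarith)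
  have hI' : ∑ m ∈ range (2 * N), |RCLike.im (g m)| ^ r ≤ ∑ m ∈ range (2 * N), ‖g m‖ ^ r :=
    sum_le_sum fun m _ => Real.rpow_le_rpow (abs_nonneg _) (RCLike.abs_im_le_norm _) (by linarith)
  have hc : 0 ≤ ε / (2 ^ r * 2) := by positivity
  refine (sum_le_sum fun m _ => h2 m).trans ?_
  rw [← mul_sum, sum_add_distrib]
  calc _ ≤ 2 ^ r * (ε / (2 ^ r * 2) * ∑ m ∈ range (2 * N), ‖g m‖ ^ r + ε / (2 ^ r * 2) * ∑ m ∈ range (2 * N), ‖g m‖ ^ r) := by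
        refine mul_le_mul_of_nonneg_left (add_le_add ?_ ?_) (by positivity)
        · exact hR.trans (mul_le_mul_of_nonneg_left hR' hc)
        · exact hI.trans (mul_le_mul_of_nonneg_left hI' hc)
    _ = _ := by field_simp; ring

end Cyc

section Trans
variable {𝕜 : Type*} [RCLike 𝕜] {Ω : Type*} [MeasurableSpace Ω] {μ : Measure Ω} {r : ℝ≥0∞} [Fact (1 ≤ r)]

lemma lp_int (hr2 : r ≠ ⊤) (f : Lp 𝕜 r μ) : Integrable (fun x => ‖f x‖ ^ r.toReal) μ ∧ ‖f‖ ^ r.toReal = ∫ x, ‖f x‖ ^ r.toReal ∂μ := by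
  have h0 : r ≠ 0 := (lt_of_lt_of_le one_pos (Fact.out : 1 ≤ r)).ne'
  have h1 : 0 < r.toReal := ENNReal.toReal_pos h0 hr2
  refine ⟨(Lp.memLp f).integrable_norm_rpow h0 hr2, ?_⟩
  have hi : 0 ≤ ∫ x, ‖f x‖ ^ r.toReal ∂μ := integral_nonneg fun _ => by positivity
  rw [Lp.norm_def, (Lp.memLp f).eLpNorm_eq_integral_rpow_norm h0 hr2, ENNReal.toReal_ofReal (by positivity),
    ← Real.rpow_mul hi, inv_mul_cancel₀ h1.ne', Real.rpow_one]

lemma trans_lp (hr1 : 1 < r) (hr2 : r ≠ ⊤) (A ε : ℝ) (hA : 0 < A) (hε : 0 < ε) : ∃ δ : ℝ, 0 < δ ∧ ∀ (N : ℕ) (k : ℕ → ℝ), 0 < N →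
    ∑ n ∈ Icc 1 N, |k n| ≤ A → (∀ θ : ℝ, ‖∑ n ∈ Icc 1 N, (k n : ℂ) * ee (n * θ)‖ ≤ δ) →
    ∀ F : ℕ → Lp 𝕜 r μ, ∑ m ∈ range N, ‖∑ n ∈ Icc 1 N, (k n : 𝕜) • F (m + n)‖ ^ r.toReal ≤ ε * ∑ m ∈ range (2 * N), ‖F m‖ ^ r.toReal := by
  have hr : 1 < r.toReal := by
    rw [← ENNReal.toReal_one]; exact (ENNReal.toReal_lt_toReal (by simp) hr2).2 hr1
  obtain ⟨δ, hδ, H⟩ := line (𝕜 := 𝕜) r.toReal A ε hr hA hε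
  refine ⟨δ, hδ, fun N k hN hkA hk F => ?_⟩
  simp only [fun f => (lp_int (𝕜 := 𝕜) (μ := μ) hr2 f).2]
  rw [← integral_finsetSum _ fun m _ => (lp_int hr2 _).1, ← integral_finsetSum _ fun m _ => (lp_int hr2 _).1, ← integral_const_mul]
  refine integral_mono_ae (integrable_finsetSum _ fun m _ => (lp_int hr2 _).1) ((integrable_finsetSum _ fun m _ => (lp_int hr2 _).1).const_mul _) ?_
  have h1 : ∀ᵐ x ∂μ, ∀ m, (∑ n ∈ Icc 1 N, (k n : 𝕜) • F (m + n) : Lp 𝕜 r μ) x = ∑ n ∈ Icc 1 N, ((k n : 𝕜) • F (m + n) : Lp 𝕜 r μ) x :=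
    ae_all_iff.2 fun m => by
      filter_upwards [Lp.coeFn_finsetSum (Icc 1 N) (fun n => (k n : 𝕜) • F (m + n))] with x hx
      rw [hx, Finset.sum_apply]
  have h2 : ∀ᵐ x ∂μ, ∀ m n, ((k n : 𝕜) • F (m + n) : Lp 𝕜 r μ) x = (k n : 𝕜) * F (m + n) x :=
    ae_all_iff.2 fun m => ae_all_iff.2 fun n => by
      filter_upwards [Lp.coeFn_smul (k n : 𝕜) (F (m + n))] with x hx
      rw [hx]; rfl
  filter_upwards [h1, h2] with x hx1 hx2
  simp only [hx1, hx2]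
  exact H N k hN hkA hk (fun m => F m x)

/-- transference for a doubly power-bounded operator -/
lemma transfer (hr1 : 1 < r) (hr2 : r ≠ ⊤) (C A ε : ℝ) (hA : 0 < A) (hε : 0 < ε) : ∃ δ : ℝ, 0 < δ ∧
    ∀ (u : (Lp 𝕜 r μ →L[𝕜] Lp 𝕜 r μ)ˣ), (∀ n : ℤ, ‖((u ^ n : (Lp 𝕜 r μ →L[𝕜] Lp 𝕜 r μ)ˣ) : Lp 𝕜 r μ →L[𝕜] Lp 𝕜 r μ)‖ ≤ C) →
    ∀ (N : ℕ) (k : ℕ → ℝ), 0 < N →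
    ∑ n ∈ Icc 1 N, |k n| ≤ A → (∀ θ : ℝ, ‖∑ n ∈ Icc 1 N, (k n : ℂ) * ee (n * θ)‖ ≤ δ) →
    ∀ f : Lp 𝕜 r μ, ‖∑ n ∈ Icc 1 N, (k n : 𝕜) • ((u : Lp 𝕜 r μ →L[𝕜] Lp 𝕜 r μ) ^ n) f‖ ≤ ε * ‖f‖ := by
  have hr0 : 0 < r.toReal := ENNReal.toReal_pos (lt_of_lt_of_le one_pos (Fact.out : 1 ≤ r)).ne' hr2
  set D := |C| + 1 with hD
  have hD0 : 0 < D := by positivity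
  obtain ⟨δ, hδ, H⟩ := trans_lp (𝕜 := 𝕜) (μ := μ) hr1 hr2 A (((ε / (D * D)) ^ r.toReal) / 2) hA (by positivity)
  refine ⟨δ, hδ, fun u hu N k hN hkA hk f => ?_⟩
  set U : Lp 𝕜 r μ →L[𝕜] Lp 𝕜 r μ := (u : Lp 𝕜 r μ →L[𝕜] Lp 𝕜 r μ) with hU
  have hCD : C ≤ D := by linarith [le_abs_self C]
  have h1 : ∀ m (g : Lp 𝕜 r μ), ‖(U ^ m) g‖ ≤ D * ‖g‖ := fun m g => by
    have := hu m
    rw [zpow_natCast, Units.val_pow_eq_pow_val] at this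
    exact ((U ^ m).le_opNorm g).trans (mul_le_mul_of_nonneg_right (this.trans hCD) (norm_nonneg _))
  have h2 : ∀ m (g : Lp 𝕜 r μ), ‖g‖ ≤ D * ‖(U ^ m) g‖ := fun m g => by
    have := hu (-m)
    have e : ((u ^ (-m : ℤ) : (Lp 𝕜 r μ →L[𝕜] Lp 𝕜 r μ)ˣ) : Lp 𝕜 r μ →L[𝕜] Lp 𝕜 r μ) ((U ^ m) g) = g := by
      rw [hU, ← Units.val_pow_eq_pow_val, ← mul_apply_eq_comp, ← Units.val_mul, zpow_neg, zpow_natCast, inv_mul_cancel]; rfl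
    calc ‖g‖ = _ := (congrArg norm e).symm
      _ ≤ _ := (ContinuousLinearMap.le_opNorm _ _).trans (mul_le_mul_of_nonneg_right (this.trans hCD) (norm_nonneg _))
  have h3 := H N k hN hkA hk (fun m => (U ^ m) f)
  set v := ∑ n ∈ Icc 1 N, (k n : 𝕜) • (U ^ n) f with hv
  have e : ∀ m, ∑ n ∈ Icc 1 N, (k n : 𝕜) • (U ^ (m + n)) f = (U ^ m) v := fun m => by
    rw [hv, map_sum]
    exact sum_congr rfl fun n _ => by rw [map_smul, pow_add]; rfl
  simp only [e] at h3
  have hN' : (0:ℝ) < N := Nat.cast_pos.2 hN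
  have h4 : N * (‖v‖ / D) ^ r.toReal ≤ ∑ m ∈ range N, ‖(U ^ m) v‖ ^ r.toReal := by
    rw [← nsmul_eq_mul, ← card_range N, ← sum_const, card_range]
    refine sum_le_sum fun m _ => Real.rpow_le_rpow (by positivity) ?_ hr0.le
    rw [div_le_iff₀' hD0]; exact h2 m v
  have h5 : ∑ m ∈ range (2 * N), ‖(U ^ m) f‖ ^ r.toReal ≤ 2 * N * (D * ‖f‖) ^ r.toReal := by
    refine (sum_le_sum fun m _ => Real.rpow_le_rpow (norm_nonneg _) (h1 m f) hr0.le).trans (le_of_eq ?_)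
    rw [sum_const, card_range, nsmul_eq_mul]; push_cast; ring
  have h6 : (‖v‖ / D) ^ r.toReal ≤ (ε / (D * D) * (D * ‖f‖)) ^ r.toReal := by
    rw [Real.mul_rpow (by positivity) (by positivity)]
    have h7 := mul_le_mul_of_nonneg_left h5 (show 0 ≤ ((ε / (D * D)) ^ r.toReal) / 2 by positivity)
    refine le_of_mul_le_mul_left ?_ hN'
    linarith
  rw [Real.rpow_le_rpow_iff (by positivity) (by positivity) hr0, div_le_iff₀ hD0] at h6
  refine h6.trans (le_of_eq ?_)
  field_simp

end Trans
end PP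

namespace PP
section UC
variable {𝕜 : Type*} [RCLike 𝕜]

/-- convexity defect -/
noncomputable def dft (p : ℝ) (a b : 𝕜) : ℝ := (‖a‖ ^ p + ‖b‖ ^ p) / 2 - ‖(2:𝕜)⁻¹ * (a + b)‖ ^ p

lemma dft_pos {p : ℝ} (hp : 1 < p) {a b : 𝕜} (h : a ≠ b) : 0 < dft p a b := by
  have h1 : ‖(2:𝕜)⁻¹ * (a + b)‖ = ‖a + b‖ / 2 := by
    rw [norm_mul, norm_inv, RCLike.norm_ofNat]; ring
  rw [dft, sub_pos, h1]
  by_cases hab : ‖a‖ = ‖b‖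
  · have h2 : ‖a + b‖ / 2 < ‖a‖ := by
      have h3 := parallelogram_law_with_norm 𝕜 a b
      have h4 : 0 < ‖a - b‖ := norm_pos_iff.2 (sub_ne_zero.2 h)
      rw [← hab] at h3
      nlinarith [norm_nonneg a, norm_nonneg (a + b)]
    rw [← hab, add_self_div_two]
    exact Real.rpow_lt_rpow (by positivity) h2 (by linarith)
  · have h2 := (strictConvexOn_rpow hp).2 (Set.mem_Ici.2 (norm_nonneg a)) (Set.mem_Ici.2 (norm_nonneg b)) hab
      (by norm_num : (0:ℝ) < 1 / 2) (by norm_num : (0:ℝ) < 1 / 2) (by norm_num)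
    simp only [smul_eq_mul] at h2
    have h3 : (‖a + b‖ / 2) ^ p ≤ (1 / 2 * ‖a‖ + 1 / 2 * ‖b‖) ^ p :=
      Real.rpow_le_rpow (by positivity) (by linarith [norm_add_le a b]) (by linarith)
    linarith

lemma dft_nonneg {p : ℝ} (hp : 1 < p) (a b : 𝕜) : 0 ≤ dft p a b := by
  rcases eq_or_ne a b with rfl | h
  · have : (2:𝕜)⁻¹ * (a + a) = a := by rw [← two_mul, inv_mul_cancel_left₀ two_ne_zero]
    rw [dft, this]; simp
  · exact (dft_pos hp h).le

lemma uc_pt (p ε : ℝ) (hp : 1 < p) (hε : 0 < ε) : ∃ C : ℝ, 0 < C ∧ ∀ a b : 𝕜,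
    ‖a - b‖ ^ p ≤ ε * (‖a‖ ^ p + ‖b‖ ^ p) + C * dft p a b := by
  have hp0 : 0 < p := by linarith
  have hcont : Continuous fun z : 𝕜 × 𝕜 => dft p z.1 z.2 := by
    unfold dft
    have : ∀ F : 𝕜 × 𝕜 → 𝕜, Continuous F → Continuous fun z => ‖F z‖ ^ p := fun F hF =>
      hF.norm.rpow_const fun _ => Or.inr hp0.le
    exact (((this _ continuous_fst).add (this _ continuous_snd)).div_const _).sub (this _ (by fun_prop))
  have hcd : Continuous fun z : 𝕜 × 𝕜 => ‖z.1 - z.2‖ ^ p :=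
    (continuous_fst.sub continuous_snd).norm.rpow_const fun _ => Or.inr hp0.le
  set K : Set (𝕜 × 𝕜) := Metric.sphere 0 1 ∩ {z | ε ≤ ‖z.1 - z.2‖ ^ p} with hK
  have hKc : IsCompact K := (isCompact_sphere _ _).inter_right (isClosed_le continuous_const hcd)
  obtain ⟨c, hc, hmin⟩ : ∃ c : ℝ, 0 < c ∧ ∀ z ∈ K, c ≤ dft p z.1 z.2 := by
    rcases K.eq_empty_or_nonempty with h | h
    · exact ⟨1, one_pos, by simp [h]⟩
    · obtain ⟨z, hz, hm⟩ := hKc.exists_isMinOn h hcont.continuousOn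
      refine ⟨_, dft_pos hp fun h => ?_, fun w hw => hm hw⟩
      have := hz.2
      rw [Set.mem_ofPred_eq, h, sub_self, norm_zero, Real.zero_rpow hp0.ne'] at this
      linarith
  refine ⟨2 ^ p / c, by positivity, fun a b => ?_⟩
  have hsph : ∀ z : 𝕜 × 𝕜, ‖z‖ = 1 → ‖z.1 - z.2‖ ^ p ≤ ε * (‖z.1‖ ^ p + ‖z.2‖ ^ p) + 2 ^ p / c * dft p z.1 z.2 := by
    intro z hz
    have h0 := dft_nonneg hp z.1 z.2
    by_cases hz2 : ε ≤ ‖z.1 - z.2‖ ^ p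
    · have h1 := hmin z ⟨by simpa using hz, hz2⟩
      have h2 : ‖z.1 - z.2‖ ^ p ≤ 2 ^ p := by
        refine Real.rpow_le_rpow (norm_nonneg _) ((norm_sub_le _ _).trans ?_) hp0.le
        linarith [norm_fst_le z, norm_snd_le z]
      have h3 : (2:ℝ) ^ p ≤ 2 ^ p / c * dft p z.1 z.2 := by
        rw [div_mul_eq_mul_div, le_div_iff₀ hc]
        exact mul_le_mul_of_nonneg_left h1 (by positivity)
      have : 0 ≤ ε * (‖z.1‖ ^ p + ‖z.2‖ ^ p) := by positivity
      linarith
    · have h1 : 1 ≤ ‖z.1‖ ^ p + ‖z.2‖ ^ p := by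
        have := Real.rpow_nonneg (norm_nonneg z.1) p
        have := Real.rpow_nonneg (norm_nonneg z.2) p
        rw [Prod.norm_def] at hz
        rcases max_cases ‖z.1‖ ‖z.2‖ with h | h <;> rw [h.1] at hz <;> rw [hz, Real.one_rpow] <;> linarith
      have h3 : 0 ≤ 2 ^ p / c * dft p z.1 z.2 := by positivity
      nlinarith
  rcases eq_or_ne ((a, b) : 𝕜 × 𝕜) 0 with h | h
  · obtain ⟨rfl, rfl⟩ := Prod.mk_eq_zero.1 h
    simp [dft, Real.zero_rpow hp0.ne']
  set t := ‖((a, b) : 𝕜 × 𝕜)‖ with ht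
  have ht0 : 0 < t := norm_pos_iff.2 h
  have hn : ∀ x : 𝕜, ‖((t⁻¹ : ℝ) : 𝕜) * x‖ ^ p = (t⁻¹) ^ p * ‖x‖ ^ p := fun x => by
    rw [norm_mul, RCLike.norm_ofReal, abs_of_pos (by positivity), Real.mul_rpow (by positivity) (norm_nonneg _)]
  have hz := hsph (((t⁻¹ : ℝ) : 𝕜) * a, ((t⁻¹ : ℝ) : 𝕜) * b) (by
    have : ((((t⁻¹ : ℝ) : 𝕜) * a, ((t⁻¹ : ℝ) : 𝕜) * b) : 𝕜 × 𝕜) = ((t⁻¹ : ℝ) : 𝕜) • (a, b) := rfl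
    rw [this, norm_smul, RCLike.norm_ofReal, abs_of_pos (by positivity), ← ht, inv_mul_cancel₀ ht0.ne'])
  simp only [dft, ← mul_sub, ← mul_add, mul_left_comm (2:𝕜)⁻¹, hn] at hz
  have ht1 : 0 < (t⁻¹) ^ p := by positivity
  refine le_of_mul_le_mul_left ?_ ht1
  rw [dft]
  linarith

variable {Ω : Type*} [MeasurableSpace Ω] {μ : Measure Ω} {r : ℝ≥0∞} [Fact (1 ≤ r)]

lemma uc (hr1 : 1 < r) (hr2 : r ≠ ⊤) (ε : ℝ) (hε : 0 < ε) : ∃ C : ℝ, 0 < C ∧ ∀ a b : Lp 𝕜 r μ,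
    ‖a - b‖ ^ r.toReal ≤ ε * (‖a‖ ^ r.toReal + ‖b‖ ^ r.toReal) +
      C * ((‖a‖ ^ r.toReal + ‖b‖ ^ r.toReal) / 2 - ‖(2:𝕜)⁻¹ • (a + b)‖ ^ r.toReal) := by
  have hr : 1 < r.toReal := by
    rw [← ENNReal.toReal_one]; exact (ENNReal.toReal_lt_toReal (by simp) hr2).2 hr1
  obtain ⟨C, hC, H⟩ := uc_pt (𝕜 := 𝕜) r.toReal ε hr hε
  refine ⟨C, hC, fun a b => ?_⟩
  simp only [fun f => (lp_int (𝕜 := 𝕜) (μ := μ) hr2 f).2]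
  have i := fun f => (lp_int (𝕜 := 𝕜) (μ := μ) hr2 f).1
  have i1 : Integrable (fun x => ‖a x‖ ^ r.toReal + ‖b x‖ ^ r.toReal) μ := (i a).add (i b)
  have i2 : Integrable (fun x => (‖a x‖ ^ r.toReal + ‖b x‖ ^ r.toReal) / 2 - ‖((2:𝕜)⁻¹ • (a + b) : Lp 𝕜 r μ) x‖ ^ r.toReal) μ :=
    (i1.div_const 2).sub (i _)
  rw [← integral_add (i _) (i _), ← integral_div, ← integral_sub (i1.div_const 2) (i _),
    ← integral_const_mul, ← integral_const_mul, ← integral_add (i1.const_mul _) (i2.const_mul _)]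
  refine integral_mono_ae (i _) ((i1.const_mul _).add (i2.const_mul _)) ?_
  filter_upwards [Lp.coeFn_sub a b, Lp.coeFn_add a b, Lp.coeFn_smul (2:𝕜)⁻¹ (a + b)] with x h1 h2 h3
  have := H (a x) (b x)
  rw [h1, h3]
  simp only [Pi.smul_apply, Pi.sub_apply, h2, Pi.add_apply, smul_eq_mul]
  exact this

end UC

section ME
variable {𝕜 : Type*} [RCLike 𝕜] {E : Type*} [NormedAddCommGroup E] [NormedSpace 𝕜 E] [CompleteSpace E]

lemma conv_of_approx (a : ℕ → E) (h : ∀ ε : ℝ, 0 < ε → ∃ b : ℕ → E, (∃ g, Tendsto b atTop (nhds g)) ∧ ∀ᶠ n in atTop, ‖a n - b n‖ ≤ ε) :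
    ∃ g, Tendsto a atTop (nhds g) := by
  refine cauchySeq_tendsto_of_complete (Metric.cauchySeq_iff'.2 fun ε hε => ?_)
  obtain ⟨b, ⟨g, hb⟩, hab⟩ := h (ε / 8) (by positivity)
  have hb' := (tendsto_iff_norm_sub_tendsto_zero.1 hb).eventually_le_const (show 0 < ε / 8 by positivity)
  obtain ⟨N, hN⟩ := (hab.and hb').exists_forall_of_atTop
  refine ⟨N, fun n hn => ?_⟩
  rw [dist_eq_norm]
  have e : a n - a N = (a n - b n) + (b n - g) - (a N - b N) - (b N - g) := by abel
  rw [e]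
  have := norm_sub_le ((a n - b n) + (b n - g) - (a N - b N)) (b N - g)
  have := norm_sub_le ((a n - b n) + (b n - g)) (a N - b N)
  have := norm_add_le (a n - b n) (b n - g)
  have := hN n hn
  have := hN N le_rfl
  linarith [this.1, this.2, (hN n hn).1, (hN n hn).2]

lemma inv_tendsto (𝕜 : Type*) [RCLike 𝕜] (B : ℝ) (a : ℕ → E) [NormedSpace 𝕜 E] (h : ∀ n, ‖a n‖ ≤ B) :
    Tendsto (fun n : ℕ => (n : 𝕜)⁻¹ • a n) atTop (nhds 0) := by
  refine squeeze_zero_norm (a := fun n : ℕ => (n : ℝ)⁻¹ * B) (fun n => ?_) ?_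
  · rw [norm_smul, norm_inv, RCLike.norm_natCast]
    exact mul_le_mul_of_nonneg_left (h n) (by positivity)
  · simpa using tendsto_inv_atTop_nhds_zero_nat.mul_const B

/-- power bounds -/
lemma pb {u : (E →L[𝕜] E)ˣ} {C : ℝ} (hu : ∀ n : ℤ, ‖((u ^ n : (E →L[𝕜] E)ˣ) : E →L[𝕜] E)‖ ≤ C) (n : ℕ) (f : E) :
    ‖((u : E →L[𝕜] E) ^ n) f‖ ≤ C * ‖f‖ := by
  have := hu n
  rw [zpow_natCast, Units.val_pow_eq_pow_val] at this
  exact (((u : E →L[𝕜] E) ^ n).le_opNorm f).trans (mul_le_mul_of_nonneg_right this (norm_nonneg _))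

lemma mean_erg (p : ℝ) (hp : 1 < p) (huc : ∀ ε : ℝ, 0 < ε → ∃ C : ℝ, 0 < C ∧ ∀ a b : E,
    ‖a - b‖ ^ p ≤ ε * (‖a‖ ^ p + ‖b‖ ^ p) + C * ((‖a‖ ^ p + ‖b‖ ^ p) / 2 - ‖(2:𝕜)⁻¹ • (a + b)‖ ^ p))
    (u : (E →L[𝕜] E)ˣ) (C : ℝ) (hu : ∀ n : ℤ, ‖((u ^ n : (E →L[𝕜] E)ˣ) : E →L[𝕜] E)‖ ≤ C) (f : E) :
    ∃ g, Tendsto (fun N : ℕ => (N : 𝕜)⁻¹ • ∑ n ∈ range N, ((u : E →L[𝕜] E) ^ n) f) atTop (nhds g) := by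
  have hp0 : 0 < p := by linarith
  set V : ℤ → E → E := fun n x => ((u ^ n : (E →L[𝕜] E)ˣ) : E →L[𝕜] E) x with hV
  set A : ℕ → E → E := fun N x => (N : 𝕜)⁻¹ • ∑ n ∈ range N, ((u : E →L[𝕜] E) ^ n) x with hA
  have hVb : ∀ n x, ‖V n x‖ ≤ C * ‖x‖ := fun n x =>
    (ContinuousLinearMap.le_opNorm _ _).trans (mul_le_mul_of_nonneg_right (hu n) (norm_nonneg _))
  have hV0 : ∀ x, V 0 x = x := fun x => by simp [hV]
  have hVV : ∀ m n x, V m (V n x) = V (m + n) x := fun m n x => by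
    simp only [hV, zpow_add, Units.val_mul]; rfl
  set S : E → ℝ := fun x => ⨆ n : ℤ, ‖V n x‖ with hS
  have hbdd : ∀ x, BddAbove (Set.range fun n : ℤ => ‖V n x‖) := fun x =>
    ⟨C * ‖x‖, by rintro _ ⟨n, rfl⟩; exact hVb n x⟩
  have hle : ∀ n x, ‖V n x‖ ≤ S x := fun n x => le_ciSup (hbdd x) n
  have hS0 : ∀ x, 0 ≤ S x := fun x => (norm_nonneg _).trans (hle 0 x)
  set K : Set E := {x | Tendsto (fun N => A N x - A N f) atTop (nhds 0)} with hK
  have hfK : f ∈ K := by simp [hK]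
  have hadd : ∀ N x y, A N (x + y) = A N x + A N y := fun N x y => by simp [hA, sum_add_distrib]
  have hsm : ∀ N (c : 𝕜) x, A N (c • x) = c • A N x := fun N c x => by
    simp only [hA, map_smul, ← smul_sum]; rw [smul_comm]
  have hsub : ∀ N x y, A N (x - y) = A N x - A N y := fun N x y => by simp [hA, sum_sub_distrib, smul_sub]
  have hmod : ∀ X Y Z : E, (2:𝕜)⁻¹ • (X - Z + (Y - Z)) = (2:𝕜)⁻¹ • (X + Y) - Z := fun X Y Z => by
    rw [sub_add_sub_comm, smul_sub, ← two_smul 𝕜 Z, inv_smul_smul₀ two_ne_zero]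
  have hmid : ∀ x ∈ K, ∀ y ∈ K, (2:𝕜)⁻¹ • (x + y) ∈ K := by
    intro x hx y hy
    have := (Tendsto.add hx hy).const_smul (2:𝕜)⁻¹
    simp only [add_zero, smul_zero] at this
    refine this.congr fun N => ?_
    rw [hsm, hadd]
    exact hmod _ _ _
  have hT1 : ∀ x ∈ K, V 1 x ∈ K := by
    intro x hx
    have h1 : Tendsto (fun N => A N (V 1 x) - A N x) atTop (nhds 0) := by
      refine (inv_tendsto 𝕜 (2 * (C * ‖x‖)) (fun N => ((u : E →L[𝕜] E) ^ N) x - x) fun N => ?_).congr fun N => ?_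
      · have := pb hu N x
        have := pb hu 0 x
        have := norm_sub_le (((u : E →L[𝕜] E) ^ N) x) x
        rw [pow_zero] at *
        simp only [one_apply_eq_self] at *
        linarith
      · simp only [hA, ← smul_sub, ← sum_sub_distrib]
        congr 1
        have := sum_range_sub (fun n => ((u : E →L[𝕜] E) ^ n) x) N
        rw [pow_zero] at this
        simp only [one_apply_eq_self] at this
        rw [← this]
        refine sum_congr rfl fun n _ => ?_
        rw [pow_succ]
        simp [hV]
    have := h1.add hx
    rw [hK, Set.mem_ofPred_eq]
    simpa using this
  have hTj : ∀ j : ℕ, ∀ x ∈ K, V j x ∈ K := by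
    intro j
    induction j with
    | zero => intro x hx; simpa [hV0] using hx
    | succ j ih =>
      intro x hx
      have := hT1 _ (ih x hx)
      rw [hVV] at this
      rwa [Nat.cast_succ, add_comm]
  set d := sInf (S '' K) with hd
  have hdb : BddBelow (S '' K) := ⟨0, by rintro _ ⟨x, _, rfl⟩; exact hS0 x⟩
  have hd0 : 0 ≤ d := Real.sInf_nonneg (by rintro _ ⟨x, _, rfl⟩; exact hS0 x)
  have hSd : ∀ x ∈ K, d ≤ S x := fun x hx => csInf_le hdb ⟨x, hx, rfl⟩
  have hC0 : 0 ≤ C := (norm_nonneg _).trans (hu 0)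
  refine conv_of_approx _ fun ε hε => ?_
  set D := C + 1 with hD
  have hDp : 0 < D := by linarith
  set ε1 := (ε / (2 * D)) ^ p with hε1
  have hε1p : 0 < ε1 := by positivity
  obtain ⟨M, hM, huc'⟩ := huc (ε1 / (4 * (d + 1) ^ p)) (by positivity)
  -- choose δ small
  obtain ⟨δ, hδ0, hδ1, hδ⟩ : ∃ δ : ℝ, 0 < δ ∧ δ ≤ 1 ∧ M * ((d + δ) ^ p - (max (d - δ) 0) ^ p) ≤ ε1 / 2 := by
    have hc : Tendsto (fun δ : ℝ => M * ((d + δ) ^ p - (max (d - δ) 0) ^ p)) (nhdsWithin 0 (Set.Ioi 0)) (nhds 0) := by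
      have : Continuous fun δ : ℝ => M * ((d + δ) ^ p - (max (d - δ) 0) ^ p) := by
        refine continuous_const.mul (Continuous.sub ?_ ?_)
        · exact (by fun_prop : Continuous fun δ : ℝ => d + δ).rpow_const fun _ => Or.inr hp0.le
        · exact (by fun_prop : Continuous fun δ : ℝ => max (d - δ) 0).rpow_const fun _ => Or.inr hp0.le
      have h := this.tendsto 0
      simp only [add_zero, sub_zero, max_eq_left hd0, sub_self, mul_zero] at h
      exact h.mono_left nhdsWithin_le_nhds
    have h1 := hc.eventually_le_const (show 0 < ε1 / 2 by positivity)
    have h2 : ∀ᶠ δ : ℝ in nhdsWithin 0 (Set.Ioi 0), δ ≤ 1 :=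
      nhdsWithin_le_nhds (Iic_mem_nhds one_pos)
    obtain ⟨δ, ⟨h1, h2⟩, h3⟩ := ((h1.and h2).and self_mem_nhdsWithin).exists
    exact ⟨δ, h3, h2, h1⟩
  obtain ⟨_, ⟨g, hgK, rfl⟩, hg⟩ := exists_lt_of_csInf_lt (⟨_, f, hfK, rfl⟩ : (S '' K).Nonempty) (lt_add_of_pos_right d hδ0)
  have key : ∀ j : ℕ, ‖V j g - g‖ ≤ ε / 2 := by
    intro j
    have hmK := hmid _ (hTj j g hgK) g hgK
    obtain ⟨n, hn⟩ := exists_lt_of_lt_ciSup (show d - δ < S ((2:𝕜)⁻¹ • (V j g + g)) by linarith [hSd _ hmK])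
    have e1 : V n (V j g - g) = V n (V j g) - V n g := by simp [hV]
    have e2 : V n ((2:𝕜)⁻¹ • (V j g + g)) = (2:𝕜)⁻¹ • (V n (V j g) + V n g) := by simp [hV]
    rw [e2] at hn
    have h1 := huc' (V n (V j g)) (V n g)
    have ha : ‖V n (V j g)‖ ^ p ≤ (d + δ) ^ p := by
      rw [hVV]; exact Real.rpow_le_rpow (norm_nonneg _) ((hle _ _).trans hg.le) hp0.le
    have hb : ‖V n g‖ ^ p ≤ (d + δ) ^ p := Real.rpow_le_rpow (norm_nonneg _) ((hle _ _).trans hg.le) hp0.le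
    have hm : (max (d - δ) 0) ^ p ≤ ‖(2:𝕜)⁻¹ • (V n (V j g) + V n g)‖ ^ p :=
      Real.rpow_le_rpow (le_max_right _ _) (max_le hn.le (norm_nonneg _)) hp0.le
    have hdd : (d + δ) ^ p ≤ (d + 1) ^ p := Real.rpow_le_rpow (by positivity) (by linarith) hp0.le
    have h2 : ‖V n (V j g) - V n g‖ ^ p ≤ ε1 := by
      calc _ ≤ _ := h1
        _ ≤ ε1 / (4 * (d + 1) ^ p) * ((d + 1) ^ p + (d + 1) ^ p) + M * ((d + δ) ^ p - (max (d - δ) 0) ^ p) := by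
            refine add_le_add (mul_le_mul_of_nonneg_left (by linarith) (by positivity)) (mul_le_mul_of_nonneg_left (by linarith) hM.le)
        _ ≤ ε1 / 2 + ε1 / 2 := by
            refine add_le_add (le_of_eq ?_) hδ
            have : 0 < (d + 1) ^ p := by positivity
            field_simp; ring
        _ = ε1 := by ring
    rw [hε1, Real.rpow_le_rpow_iff (norm_nonneg _) (by positivity) hp0, ← e1] at h2
    have h3 := hVb (-n) (V n (V j g - g))
    rw [hVV, neg_add_cancel, hV0] at h3
    calc _ ≤ _ := h3
      _ ≤ D * (ε / (2 * D)) := mul_le_mul (by linarith) h2 (norm_nonneg _) hDp.le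
      _ = ε / 2 := by field_simp
  refine ⟨fun _ => g, ⟨g, tendsto_const_nhds⟩, ?_⟩
  have h1 : ∀ᶠ N in atTop, ‖A N g - A N f‖ ≤ ε / 2 := by
    have := (tendsto_zero_iff_norm_tendsto_zero.1 (hgK : Tendsto (fun N => A N g - A N f) atTop (nhds 0)))
    exact this.eventually_le_const (by positivity)
  filter_upwards [h1, eventually_gt_atTop 0] with N hN hN0
  have hN' : (N : 𝕜) ≠ 0 := Nat.cast_ne_zero.2 hN0.ne'
  have h2 : ‖A N g - g‖ ≤ ε / 2 := by
    have e : A N g - g = (N : 𝕜)⁻¹ • ∑ n ∈ range N, (V n g - g) := by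
      rw [sum_sub_distrib, sum_const, card_range, smul_sub, ← Nat.cast_smul_eq_nsmul 𝕜, inv_smul_smul₀ hN']
      simp [hA, hV]
    rw [e, norm_smul, norm_inv, RCLike.norm_natCast, inv_mul_le_iff₀ (Nat.cast_pos.2 hN0)]
    refine (norm_sum_le_of_le _ fun n _ => key n).trans (le_of_eq ?_)
    simp
  have e : A N f - g = (A N g - g) - (A N g - A N f) := by abel
  have h3 := norm_sub_le (A N g - g) (A N g - A N f)
  rw [← e] at h3
  exact h3.trans (by linarith)

end ME
end PP

namespace PP
section Model
variable {𝕜 : Type*} [RCLike 𝕜] {E : Type*} [NormedAddCommGroup E] [NormedSpace 𝕜 E] [CompleteSpace E]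

lemma cop_avg (W : ℕ) (hW : 0 < W) (u : (E →L[𝕜] E)ˣ) (C : ℝ) (hu : ∀ n : ℤ, ‖((u ^ n : (E →L[𝕜] E)ˣ) : E →L[𝕜] E)‖ ≤ C)
    (hme : ∀ f, ∃ g, Tendsto (fun N : ℕ => (N : 𝕜)⁻¹ • ∑ n ∈ range N, (((u ^ W : (E →L[𝕜] E)ˣ) : E →L[𝕜] E) ^ n) f) atTop (nhds g))
    (f : E) : ∃ g, Tendsto (fun N : ℕ => (N : 𝕜)⁻¹ • ∑ n ∈ Icc 1 N, (if n.Coprime W then (1:𝕜) else 0) • ((u : E →L[𝕜] E) ^ n) f) atTop (nhds g) := by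
  set U : E →L[𝕜] E := (u : E →L[𝕜] E) with hU
  set χ : ℕ → 𝕜 := fun n => if n.Coprime W then (1:𝕜) else 0 with hχ
  have hb : ∀ n, ‖χ n • (U ^ n) f‖ ≤ C * ‖f‖ := fun n => by
    have h1 := pb hu n f
    simp only [hχ]
    split_ifs
    · rw [one_smul]; exact h1
    · rw [zero_smul, norm_zero]; exact (norm_nonneg _).trans h1
  have hC0 : 0 ≤ C * ‖f‖ := (norm_nonneg _).trans (hb 0)
  set F := ∑ c ∈ range W, χ c • (U ^ c) f with hF
  set B : ℕ → E := fun N => ∑ n ∈ range N, χ n • (U ^ n) f with hB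
  have hBM : ∀ M, B (W * M) = ∑ n ∈ range M, (((u ^ W : (E →L[𝕜] E)ˣ) : E →L[𝕜] E) ^ n) F := by
    intro M
    induction M with
    | zero => simp [hB]
    | succ M ih =>
      rw [sum_range_succ, ← ih, mul_add, mul_one]
      simp only [hB]
      rw [sum_range_add]
      congr 1
      rw [hF, map_sum]
      refine sum_congr rfl fun c _ => ?_
      have e : χ (W * M + c) = χ c := by
        simp only [hχ]
        simp only [add_comm (W * M) c, Nat.coprime_add_mul_left_left]
      rw [e, map_smul, pow_add, pow_mul, Units.val_pow_eq_pow_val]; rfl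
  obtain ⟨g, hg⟩ := hme F
  have hdiv : Tendsto (fun N : ℕ => N / W) atTop atTop := Nat.tendsto_div_const_atTop hW.ne'
  have h1 : Tendsto (fun N : ℕ => (N : 𝕜)⁻¹ * ((N / W : ℕ) : 𝕜)) atTop (nhds (W : 𝕜)⁻¹) := by
    have h0 := inv_tendsto (E := 𝕜) 𝕜 W (fun N : ℕ => ((N % W : ℕ) : 𝕜)) fun n => by
      rw [RCLike.norm_natCast]; exact_mod_cast (Nat.mod_lt _ hW).le
    have h2 := (tendsto_const_nhds (x := (W : 𝕜)⁻¹)).sub (h0.const_mul (W : 𝕜)⁻¹)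
    rw [mul_zero, sub_zero] at h2
    refine h2.congr' ?_
    filter_upwards [eventually_gt_atTop 0] with N hN
    have e : (N : 𝕜) = W * ((N / W : ℕ) : 𝕜) + ((N % W : ℕ) : 𝕜) := by exact_mod_cast (Nat.div_add_mod N W).symm
    have hN' : (N : 𝕜) ≠ 0 := Nat.cast_ne_zero.2 hN.ne'
    have hW' : (W : 𝕜) ≠ 0 := Nat.cast_ne_zero.2 hW.ne'
    rw [smul_eq_mul]
    field_simp
    linear_combination e
  have h2 := h1.smul (hg.comp hdiv)
  have h3 := inv_tendsto 𝕜 ((W + 1) * (C * ‖f‖)) (fun N => (∑ n ∈ Icc 1 N, χ n • (U ^ n) f) - B (W * (N / W))) fun N => by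
    have e : ∑ n ∈ Icc 1 N, χ n • (U ^ n) f = B (N + 1) - χ 0 • (U ^ 0) f := by
      simp only [hB]
      rw [sum_range_succ', add_sub_cancel_right, ← Ico_succ_right_eq_Icc, sum_Ico_eq_sum_range]
      simp [add_comm]
    have hle : W * (N / W) ≤ N + 1 := (Nat.mul_div_le N W).trans (Nat.le_succ N)
    have e2 : B (N + 1) - B (W * (N / W)) = ∑ n ∈ Ico (W * (N / W)) (N + 1), χ n • (U ^ n) f := by
      rw [sum_Ico_eq_sub _ hle]
    have h4 : ‖B (N + 1) - B (W * (N / W))‖ ≤ W * (C * ‖f‖) := by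
      rw [e2]
      refine (norm_sum_le_of_le _ fun n _ => hb n).trans ?_
      rw [sum_const, Nat.card_Ico, nsmul_eq_mul]
      refine mul_le_mul_of_nonneg_right ?_ hC0
      have := Nat.div_add_mod N W
      have := Nat.mod_lt N hW
      exact_mod_cast (by omega : N + 1 - W * (N / W) ≤ W)
    rw [e, sub_right_comm]
    have := norm_sub_le (B (N + 1) - B (W * (N / W))) (χ 0 • (U ^ 0) f)
    linarith [hb 0]
  refine ⟨_, (h2.add h3).congr' ?_⟩
  filter_upwards [eventually_ge_atTop W] with N hN
  have hM : ((N / W : ℕ) : 𝕜) ≠ 0 := Nat.cast_ne_zero.2 (Nat.div_pos hN hW).ne'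
  rw [Function.comp, mul_smul, smul_inv_smul₀ hM, ← hBM, smul_sub, add_sub_cancel]

end Model

section Lam
open ArithmeticFunction
variable {𝕜 : Type*} [RCLike 𝕜] {E : Type*} [NormedAddCommGroup E] [NormedSpace 𝕜 E] [CompleteSpace E]

lemma lam_avg (V : ℕ → E) (f : E)
    (H : ∀ ε : ℝ, 0 < ε → ∃ δ : ℝ, 0 < δ ∧ ∀ (N : ℕ) (k : ℕ → ℝ), 0 < N →
      ∑ n ∈ Icc 1 N, |k n| ≤ 13 → (∀ θ : ℝ, ‖∑ n ∈ Icc 1 N, (k n : ℂ) * ee (n * θ)‖ ≤ δ) →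
      ‖∑ n ∈ Icc 1 N, (k n : 𝕜) • V n‖ ≤ ε * ‖f‖)
    (hc : ∀ W : ℕ, 0 < W → ∃ g, Tendsto (fun N : ℕ => (N : 𝕜)⁻¹ • ∑ n ∈ Icc 1 N, (if n.Coprime W then (1:𝕜) else 0) • V n) atTop (nhds g)) :
    ∃ g, Tendsto (fun N : ℕ => (N : 𝕜)⁻¹ • ∑ n ∈ Icc 1 N, ((vonMangoldt n : ℝ) : 𝕜) • V n) atTop (nhds g) := by
  refine conv_of_approx _ fun ε hε => ?_
  obtain ⟨δ, hδ, H⟩ := H (ε / (‖f‖ + 1)) (by positivity)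
  obtain ⟨W, N0, hW, hun⟩ := unif (min δ 1) (by positivity)
  obtain ⟨g, hg⟩ := hc W hW
  refine ⟨_, ⟨_, hg.const_smul (((W / W.totient : ℝ)) : 𝕜)⟩, ?_⟩
  filter_upwards [eventually_ge_atTop N0, eventually_gt_atTop 0] with N hN hN0
  have hN' : (0:ℝ) < N := Nat.cast_pos.2 hN0
  have hsc : ∀ θ : ℝ, ‖∑ n ∈ Icc 1 N, ((wt W n / N : ℝ) : ℂ) * ee (n * θ)‖ ≤ min δ 1 := fun θ => by
    have := hun N hN θ
    have e : ∑ n ∈ Icc 1 N, ((wt W n / N : ℝ) : ℂ) * ee (n * θ) = (N : ℂ)⁻¹ * ∑ n ∈ Icc 1 N, (wt W n : ℂ) * ee (n * θ) := by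
      rw [mul_sum]; exact sum_congr rfl fun n _ => by push_cast; ring
    rw [e, norm_mul, norm_inv, Complex.norm_natCast, inv_mul_le_iff₀ hN']
    linarith
  have hA : ∑ n ∈ Icc 1 N, |wt W n / N| ≤ 13 := by
    have h1 : |∑ n ∈ Icc 1 N, wt W n| ≤ 1 * N := by
      have := (hun N hN 0).trans (mul_le_mul_of_nonneg_right (min_le_right _ _) hN'.le)
      simp only [mul_zero, ee_zero, mul_one] at this
      rwa [← Complex.ofReal_sum, Complex.norm_real, Real.norm_eq_abs] at this
    have h2 : ∀ n, |wt W n| ≤ 2 * vonMangoldt n - wt W n := fun n => by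
      have h0 : 0 ≤ (W / W.totient : ℝ) * if n.Coprime W then 1 else 0 := by positivity
      have := vonMangoldt_nonneg (n := n)
      rw [wt]
      exact abs_le.2 ⟨by linarith, by linarith⟩
    have h3 := psiN N
    simp only [abs_div, Nat.abs_cast]
    rw [← sum_div, div_le_iff₀ hN']
    refine (sum_le_sum fun n _ => h2 n).trans ?_
    rw [sum_sub_distrib, ← mul_sum]
    linarith [(abs_le.1 h1).1]
  have h := H N (fun n => wt W n / N) hN0 hA (fun θ => (hsc θ).trans (min_le_left _ _))
  refine le_trans (le_of_eq ?_) (h.trans ?_)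
  · congr 1
    rw [smul_comm, ← smul_sub, smul_sum, ← sum_sub_distrib, smul_sum]
    refine sum_congr rfl fun n _ => ?_
    rw [smul_smul, ← sub_smul, smul_smul]
    congr 1
    rw [wt]
    push_cast
    split_ifs <;> simp <;> ring
  · rw [div_mul_eq_mul_div, div_le_iff₀ (by positivity)]
    nlinarith [norm_nonneg f]

/-- re-indexing over primes -/
lemma prime_reindex {E : Type*} [AddCommMonoid E] (F : ℕ → E) (N : ℕ) :
    ∑ j ∈ range (Nat.primeCounting N), F (Nat.nth Nat.Prime j) = ∑ n ∈ Icc 1 N, if n.Prime then F n else 0 := by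
  have h : ∀ N, ∑ j ∈ range (Nat.count Nat.Prime N), F (Nat.nth Nat.Prime j) = ∑ n ∈ range N, if n.Prime then F n else 0 := by
    intro N
    induction N with
    | zero => simp
    | succ N ih =>
      rw [Nat.count_succ, sum_range_succ _ N, ← ih]
      split_ifs with hp
      · rw [sum_range_succ, Nat.nth_count hp]
      · simp
  rw [Nat.primeCounting, Nat.primeCounting', h, sum_range_succ', ← Ico_succ_right_eq_Icc, sum_Ico_eq_sum_range]
  simp [Nat.not_prime_zero, add_comm]

end Lam
end PP

namespace PP
section Fin
open ArithmeticFunction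
variable {𝕜 : Type*} [RCLike 𝕜] {E : Type*} [NormedAddCommGroup E] [NormedSpace 𝕜 E]

lemma theta_nat (N : ℕ) : Chebyshev.theta N = ∑ n ∈ Icc 1 N, if n.Prime then Real.log n else 0 := by
  rw [Chebyshev.theta, Nat.floor_natCast, sum_filter]; rfl

lemma theta_avg (V : ℕ → E) (B : ℝ) (hB : ∀ n, ‖V n‖ ≤ B) (g : E)
    (h : Tendsto (fun N : ℕ => (N : 𝕜)⁻¹ • ∑ n ∈ Icc 1 N, ((vonMangoldt n : ℝ) : 𝕜) • V n) atTop (nhds g)) :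
    Tendsto (fun N : ℕ => (N : 𝕜)⁻¹ • ∑ n ∈ Icc 1 N, if n.Prime then ((Real.log n : ℝ) : 𝕜) • V n else 0) atTop (nhds g) := by
  have hB0 : 0 ≤ B := (norm_nonneg _).trans (hB 0)
  have h0 : Tendsto (fun N : ℕ => 2 * B * (Real.log N / (N : ℝ) ^ (1 / 2 : ℝ))) atTop (nhds 0) := by
    have := (isLittleO_log_rpow_atTop (show (0:ℝ) < 1 / 2 by norm_num)).tendsto_div_nhds_zero
    simpa using (this.comp tendsto_natCast_atTop_atTop).const_mul (2 * B)
  have h1 : Tendsto (fun N : ℕ => (N : 𝕜)⁻¹ • ∑ n ∈ Icc 1 N, ((vonMangoldt n : ℝ) : 𝕜) • V n -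
      (N : 𝕜)⁻¹ • ∑ n ∈ Icc 1 N, if n.Prime then ((Real.log n : ℝ) : 𝕜) • V n else 0) atTop (nhds 0) := by
    refine squeeze_zero_norm' ?_ h0
    filter_upwards [eventually_gt_atTop 0] with N hN
    have hN' : (0:ℝ) < N := Nat.cast_pos.2 hN
    have hc := Chebyshev.abs_psi_sub_theta_le_sqrt_mul_log (x := N) (by exact_mod_cast hN)
    rw [← smul_sub, ← sum_sub_distrib, norm_smul, norm_inv, RCLike.norm_natCast, inv_mul_le_iff₀ hN']
    calc _ ≤ ∑ n ∈ Icc 1 N, (vonMangoldt n - if n.Prime then Real.log n else 0) * B := by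
          refine norm_sum_le_of_le _ fun n _ => ?_
          split_ifs with hp
          · rw [vonMangoldt_apply_prime hp]; simp
          · rw [sub_zero, sub_zero, norm_smul, RCLike.norm_ofReal, abs_of_nonneg vonMangoldt_nonneg]
            exact mul_le_mul_of_nonneg_left (hB n) vonMangoldt_nonneg
      _ = (Chebyshev.psi N - Chebyshev.theta N) * B := by
          rw [← sum_mul, sum_sub_distrib, theta_nat, Chebyshev.psi, Nat.floor_natCast]; rfl
      _ ≤ 2 * √N * Real.log N * B := mul_le_mul_of_nonneg_right ((le_abs_self _).trans hc) hB0
      _ = _ := by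
          rw [← Real.sqrt_eq_rpow]
          have := Real.sqrt_pos.2 hN'
          field_simp
          rw [Real.sq_sqrt hN'.le]; ring
  simpa using h.sub h1

lemma theta_one : Tendsto (fun N : ℕ => Chebyshev.theta N / N) atTop (nhds 1) := by
  have h := pnt_ap (q := 1) (a := 0) (isUnit_of_subsingleton _)
  have h' : Tendsto (fun N : ℕ => (N : ℝ)⁻¹ • ∑ n ∈ Icc 1 N, ((vonMangoldt n : ℝ) : ℝ) • (1:ℝ)) atTop (nhds 1) := by
    simpa [vonMangoldt.residueClass, Set.indicator, Subsingleton.elim _ (0 : ZMod 1), div_eq_inv_mul] using h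
  have := theta_avg (𝕜 := ℝ) (fun _ => (1:ℝ)) 1 (by simp) 1 h'
  simpa [theta_nat, div_eq_inv_mul] using this

lemma pi_theta : Tendsto (fun N : ℕ => (Nat.primeCounting N * Real.log N - Chebyshev.theta N) / N) atTop (nhds 0) := by
  have h1 := (Chebyshev.primeCounting_sub_theta_div_log_isBigO.comp_tendsto (tendsto_natCast_atTop_atTop (R := ℝ)))
  have hl : Tendsto (fun N : ℕ => Real.log N) atTop atTop := Real.tendsto_log_atTop.comp tendsto_natCast_atTop_atTop
  have h2 := h1.mul (Asymptotics.isBigO_refl (fun N : ℕ => Real.log N / N) atTop)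
  refine Asymptotics.IsBigO.trans_tendsto (g'' := fun N : ℕ => (Real.log N)⁻¹) ?_ hl.inv_tendsto_atTop
  refine h2.congr' ?_ ?_ <;>
  · filter_upwards [eventually_gt_atTop 1] with N hN
    have hN' : (1:ℝ) < N := by exact_mod_cast hN
    have := Real.log_pos hN'
    simp only [Function.comp, Nat.floor_natCast]
    field_simp

lemma prime_avg (V : ℕ → E) (B : ℝ) (hB : ∀ n, ‖V n‖ ≤ B) (g : E)
    (h : Tendsto (fun N : ℕ => (N : 𝕜)⁻¹ • ∑ n ∈ Icc 1 N, if n.Prime then ((Real.log n : ℝ) : 𝕜) • V n else 0) atTop (nhds g)) :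
    Tendsto (fun N : ℕ => ((Nat.primeCounting N : ℕ) : 𝕜)⁻¹ • ∑ n ∈ Icc 1 N, if n.Prime then V n else 0) atTop (nhds g) := by
  have hB0 : 0 ≤ B := (norm_nonneg _).trans (hB 0)
  have hcard : ∀ N, (Nat.primeCounting N : ℝ) = ∑ n ∈ Icc 1 N, if n.Prime then (1:ℝ) else 0 := fun N => by
    rw [← prime_reindex (fun _ => (1:ℝ)) N]; simp
  have h1 : Tendsto (fun N : ℕ => (N : 𝕜)⁻¹ • ((Real.log N : ℝ) : 𝕜) • (∑ n ∈ Icc 1 N, if n.Prime then V n else 0) -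
      (N : 𝕜)⁻¹ • ∑ n ∈ Icc 1 N, if n.Prime then ((Real.log n : ℝ) : 𝕜) • V n else 0) atTop (nhds 0) := by
    have h0 := pi_theta.mul_const B
    rw [zero_mul] at h0
    refine squeeze_zero_norm' ?_ h0
    filter_upwards [eventually_gt_atTop 0] with N hN
    have hN' : (0:ℝ) < N := Nat.cast_pos.2 hN
    rw [← smul_sub, smul_sum, ← sum_sub_distrib, norm_smul, norm_inv, RCLike.norm_natCast, inv_mul_le_iff₀ hN']
    calc _ ≤ ∑ n ∈ Icc 1 N, ((if n.Prime then (1:ℝ) else 0) * Real.log N - if n.Prime then Real.log n else 0) * B := by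
          refine norm_sum_le_of_le _ fun n hn => ?_
          rw [mem_Icc] at hn
          split_ifs with hp
          · have : Real.log n ≤ Real.log N := Real.log_le_log (by exact_mod_cast hn.1) (by exact_mod_cast hn.2)
            rw [← sub_smul, ← RCLike.ofReal_sub, norm_smul, RCLike.norm_ofReal, abs_of_nonneg (by linarith), one_mul]
            exact mul_le_mul_of_nonneg_left (hB n) (by linarith)
          · simp
      _ = _ := by
          rw [← sum_mul, sum_sub_distrib, ← sum_mul, ← hcard, ← theta_nat]
          field_simp
  have h2 : Tendsto (fun N : ℕ => (Nat.primeCounting N * Real.log N) / N) atTop (nhds 1) := by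
    have := pi_theta.add theta_one
    rw [zero_add] at this
    exact this.congr fun N => by rw [← add_div, sub_add_cancel]
  have h3 : Tendsto (fun N : ℕ => (((Nat.primeCounting N * Real.log N) / N : ℝ) : 𝕜)⁻¹) atTop (nhds 1) := by
    have := ((RCLike.continuous_ofReal (K := 𝕜)).tendsto 1).comp h2
    rw [RCLike.ofReal_one] at this
    simpa using this.inv₀ one_ne_zero
  have h4 := h3.smul (h1.add h)
  simp only [sub_add_cancel, zero_add, one_smul] at h4
  refine h4.congr' ?_
  filter_upwards [eventually_gt_atTop 1] with N hN
  have hN' : (1:ℝ) < N := by exact_mod_cast hN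
  have hl : ((Real.log N : ℝ) : 𝕜) ≠ 0 := RCLike.ofReal_ne_zero.2 (Real.log_pos hN').ne'
  have hn : (N : 𝕜) ≠ 0 := Nat.cast_ne_zero.2 (by omega)
  rw [smul_smul, smul_smul]
  congr 1
  push_cast
  rw [inv_div]
  field_simp

lemma both (V : ℕ → E) (B : ℝ) (hB : ∀ n, ‖V n‖ ≤ B)
    (h : ∃ g, Tendsto (fun N : ℕ => (N : 𝕜)⁻¹ • ∑ n ∈ Icc 1 N, ((vonMangoldt n : ℝ) : 𝕜) • V n) atTop (nhds g)) :
    (∃ g, Tendsto (fun n : ℕ => (n : 𝕜)⁻¹ • ∑ j ∈ range n, V (Nat.nth Nat.Prime j)) atTop (nhds g)) ∧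
    ∃ g, Tendsto (fun N : ℕ => (N : 𝕜)⁻¹ • ∑ j ∈ range (Nat.primeCounting N),
      ((Real.log (Nat.nth Nat.Prime j) : ℝ) : 𝕜) • V (Nat.nth Nat.Prime j)) atTop (nhds g) := by
  obtain ⟨g, hg⟩ := h
  have h1 := theta_avg V B hB g hg
  have h2 := prime_avg V B hB g h1
  refine ⟨⟨g, (tendsto_add_atTop_iff_nat 1).1 ?_⟩, g, h1.congr fun N => ?_⟩
  · have h3 : Tendsto (Nat.nth Nat.Prime) atTop atTop := (Nat.nth_strictMono Nat.infinite_setOfPred_prime).tendsto_atTop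
    refine (h2.comp h3).congr fun n => ?_
    have e : Nat.primeCounting (Nat.nth Nat.Prime n) = n + 1 := by
      rw [Nat.primeCounting, Nat.primeCounting', Nat.count_nth_succ_of_infinite Nat.infinite_setOfPred_prime]
    simp only [Function.comp]
    rw [← prime_reindex, e]
  · rw [prime_reindex (fun n => ((Real.log n : ℝ) : 𝕜) • V n)]

lemma absfin [CompleteSpace E] (p : ℝ) (hp : 1 < p) (huc : ∀ ε : ℝ, 0 < ε → ∃ C : ℝ, 0 < C ∧ ∀ a b : E,
    ‖a - b‖ ^ p ≤ ε * (‖a‖ ^ p + ‖b‖ ^ p) + C * ((‖a‖ ^ p + ‖b‖ ^ p) / 2 - ‖(2:𝕜)⁻¹ • (a + b)‖ ^ p))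
    (u : (E →L[𝕜] E)ˣ) (C : ℝ) (hu : ∀ n : ℤ, ‖((u ^ n : (E →L[𝕜] E)ˣ) : E →L[𝕜] E)‖ ≤ C) (f : E)
    (H : ∀ ε : ℝ, 0 < ε → ∃ δ : ℝ, 0 < δ ∧ ∀ (N : ℕ) (k : ℕ → ℝ), 0 < N →
      ∑ n ∈ Icc 1 N, |k n| ≤ 13 → (∀ θ : ℝ, ‖∑ n ∈ Icc 1 N, (k n : ℂ) * ee (n * θ)‖ ≤ δ) →
      ‖∑ n ∈ Icc 1 N, (k n : 𝕜) • ((u : E →L[𝕜] E) ^ n) f‖ ≤ ε * ‖f‖) :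
    (∃ g, Tendsto (fun n : ℕ => (n : 𝕜)⁻¹ • ∑ j ∈ range n, ((u : E →L[𝕜] E) ^ (Nat.nth Nat.Prime j)) f) atTop (nhds g)) ∧
    ∃ g, Tendsto (fun N : ℕ => (N : 𝕜)⁻¹ • ∑ j ∈ range (Nat.primeCounting N),
      ((Real.log (Nat.nth Nat.Prime j) : ℝ) : 𝕜) • ((u : E →L[𝕜] E) ^ (Nat.nth Nat.Prime j)) f) atTop (nhds g) := by
  refine both (fun n => ((u : E →L[𝕜] E) ^ n) f) (C * ‖f‖) (fun n => pb hu n f) ?_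
  refine lam_avg _ f H fun W hW => ?_
  refine cop_avg W hW u C hu (fun f => mean_erg p hp huc (u ^ W) C (fun n => ?_) f) f
  have := hu (W * n)
  rwa [zpow_mul, zpow_natCast] at this

end Fin
end PP

theorem stmt17 {𝕜 : Type*} [RCLike 𝕜] {Ω : Type*} [MeasurableSpace Ω] (μ : Measure Ω)
    [SigmaFinite μ] (r : ℝ≥0∞) [Fact (1 ≤ r)] (hr1 : 1 < r) (hr2 : r ≠ ⊤)
    (u : (Lp 𝕜 r μ →L[𝕜] Lp 𝕜 r μ)ˣ)
    (hu : ∃ C : ℝ, ∀ n : ℤ, ‖((u ^ n : (Lp 𝕜 r μ →L[𝕜] Lp 𝕜 r μ)ˣ) :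
        Lp 𝕜 r μ →L[𝕜] Lp 𝕜 r μ)‖ ≤ C)
    (f : Lp 𝕜 r μ) :
    (∃ g : Lp 𝕜 r μ, Tendsto (fun n : ℕ =>
        (n : 𝕜)⁻¹ • ∑ j ∈ range n,
          ((u : Lp 𝕜 r μ →L[𝕜] Lp 𝕜 r μ) ^ (Nat.nth Nat.Prime j)) f) atTop (nhds g)) ∧
    (∃ h : Lp 𝕜 r μ, Tendsto (fun N : ℕ =>
        (N : 𝕜)⁻¹ • ∑ j ∈ range (Nat.primeCounting N),
          ((Real.log (Nat.nth Nat.Prime j) : ℝ) : 𝕜) •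
            ((u : Lp 𝕜 r μ →L[𝕜] Lp 𝕜 r μ) ^ (Nat.nth Nat.Prime j)) f) atTop (nhds h)) := by
  obtain ⟨C, hu⟩ := hu
  have hr : 1 < r.toReal := by
    rw [← ENNReal.toReal_one]; exact (ENNReal.toReal_lt_toReal (by simp) hr2).2 hr1
  refine PP.absfin (E := Lp 𝕜 r μ) r.toReal hr (PP.uc hr1 hr2) u C hu f (fun ε hε => ?_)
  obtain ⟨δ, hδ, H⟩ := PP.transfer (𝕜 := 𝕜) (μ := μ) hr1 hr2 C 13 ε (by norm_num) hε
  exact ⟨δ, hδ, fun N k hN h1 h2 => H u hu N k hN h1 h2 f⟩
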